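/- arXiv:math/9404230 — 4 statements merged into one kernel-verified Lean document; each statement's English description precedes it below -/
import Mathlib

section
/- (Papadimitrakis; Gardner.) For every n ≥ 5 there exist centered convex bodies K₁ and K₂ in ℝⁿ such that λ_{n−1}(K₁ ∩ u^⊥) ≤ λ_{n−1}(K₂ ∩ u^⊥) for every u ∈ S^{n−1}, and yet λ_n(K₁) > λ_n(K₂). Hence the Busemann–Petty problem has a negative answer in ℝⁿ for n ≥ 5. -/
open MeasureTheory Metric
open scoped RealInnerProductSpace ENNReal

noncomputable section

abbrev E (n : ℕ) := EuclideanSpace ℝ (Fin n)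

/-- The radial function of a set: `ρ_K(x) = max {c ≥ 0 : c • x ∈ K}`. -/
def radialFn {n : ℕ} (K : Set (E n)) (x : E n) : ℝ :=
  sSup {c : ℝ | 0 ≤ c ∧ c • x ∈ K}

/-- A convex body: compact convex set with nonempty interior. -/
def IsConvexBody {n : ℕ} (K : Set (E n)) : Prop :=
  IsCompact K ∧ Convex ℝ K ∧ (interior K).Nonempty

/-- Centered: symmetric about the origin. -/
def IsCentered {n : ℕ} (K : Set (E n)) : Prop :=
  ∀ x, x ∈ K ↔ -x ∈ K

/-- The hyperplane through the origin orthogonal to `u`. -/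
def hyperplane {n : ℕ} (u : E n) : Set (E n) := {x | ⟪x, u⟫ = 0}

/-- A star body: compact, star-shaped at the origin (contains the origin), with
continuous radial function on the unit sphere. -/
def IsStarBody {n : ℕ} (L : Set (E n)) : Prop :=
  IsCompact L ∧ (0 : E n) ∈ L ∧ StarConvex ℝ 0 L ∧
    ContinuousOn (radialFn L) (sphere (0 : E n) 1)

/-- `L` is the intersection body of `M`: `ρ_L(u) = λ_{n-1}(M ∩ u^⊥)` for `u ∈ S^{n-1}`. -/
def IsIntersectionBodyOf {n : ℕ} (L M : Set (E n)) : Prop :=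
  ∀ u ∈ sphere (0 : E n) 1,
    radialFn L u = (μH[(n : ℝ) - 1] (M ∩ hyperplane u)).toReal

/-- The spherical Radon transform:
`(Rg)(u) = ∫_{S^{n-1} ∩ u^⊥} g dλ_{n-2}`. -/
def radon (n : ℕ) (g : E n → ℝ) (u : E n) : ℝ :=
  ∫ v in (sphere (0 : E n) 1 ∩ hyperplane u), g v ∂μH[(n : ℝ) - 2]

/-- A function on the sphere is C^∞ if its 0-homogeneous extension is smooth
away from the origin. -/
def SmoothOnSphere {n : ℕ} (h : E n → ℝ) : Prop :=
  ContDiffOn ℝ (⊤ : ℕ∞) (fun x : E n => h (‖x‖⁻¹ • x)) {(0 : E n)}ᶜ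

/-- A body of revolution about the axis `u₀`: invariant under every (linear)
isometry of `ℝⁿ` fixing `u₀`. -/
def IsRevolutionBody {n : ℕ} (u₀ : E n) (K : Set (E n)) : Prop :=
  ∀ f : E n ≃ₗᵢ[ℝ] E n, f u₀ = u₀ → f '' K = K

/-- Weighted AM-GM for `α ^ (j + 2)` and `β ^ (j + 2)`. -/
theorem mul_pow_mul_sq_le (j : ℕ) {α β : ℝ} (hα : 0 ≤ α) (hβ : 0 ≤ β) :
    (j + 2) * α ^ j * β ^ 2 ≤ 2 * β ^ (j + 2) + j * α ^ (j + 2) := by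
  induction j with
  | zero => simp
  | succ j ih =>
    have key : 0 ≤ (β - α) * (2 * β ^ (j + 2) - α ^ (j + 1) * (α + β)) := by
      rcases le_total α β with h | h
      · refine mul_nonneg (by linarith) ?_
        have := pow_le_pow_left₀ hα h (j + 1)
        have h0 : 0 ≤ α ^ (j + 1) := by positivity
        have : α ^ (j + 1) * (α + β) ≤ β ^ (j + 1) * (β + β) := by gcongr
        rw [pow_succ β (j + 1)]; linarith
      · refine mul_nonneg_of_nonpos_of_nonpos (by linarith) ?_
        have : β ^ (j + 1) * (β + β) ≤ α ^ (j + 1) * (α + β) := by gcongr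
        rw [pow_succ β (j + 1)]; linarith
    have := mul_le_mul_of_nonneg_left ih hα
    push_cast
    ring_nf at this key ⊢
    linarith

/-- Gradient inequality for the convex function `a ↦ a₊ ^ ((j + 2) / 2)`. -/
theorem sqrt_pow_add_le (j : ℕ) (hj : j ≠ 0) (a h : ℝ) :
    √a ^ (j + 2) + (j + 2) / 2 * √a ^ j * h ≤ √(a + h) ^ (j + 2) := by
  rcases lt_or_ge a 0 with ha | ha
  · simp [Real.sqrt_eq_zero_of_nonpos ha.le, hj]
  · have h1 := mul_pow_mul_sq_le j (Real.sqrt_nonneg a) (Real.sqrt_nonneg (a + h))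
    have h2 : h ≤ √(a + h) ^ 2 - √a ^ 2 := by
      rw [Real.sq_sqrt ha]
      rcases le_total 0 (a + h) with h' | h'
      · rw [Real.sq_sqrt h']; linarith
      · rw [Real.sqrt_eq_zero_of_nonpos h']; linarith
    have h3 : (j + 2) / 2 * √a ^ j * h ≤ (j + 2) / 2 * √a ^ j * (√(a + h) ^ 2 - √a ^ 2) := by
      gcongr
    have h4 : √a ^ (j + 2) = √a ^ j * √a ^ 2 := pow_add _ _ _
    nlinarith [h1, h3, h4]

theorem integral_profile : ∫ t in (-1 : ℝ)..1, (48 - 147 * t ^ 2) = -2 := by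
  rw [intervalIntegral.integral_sub (by simp) (by apply Continuous.intervalIntegrable; fun_prop)]
  simp only [intervalIntegral.integral_const, intervalIntegral.integral_const_mul, integral_pow]
  norm_num

/-- Concavity in `t ^ 2` together with a tangent line bound for the square root. -/
theorem sqrt_mul_profile_ge {b c : ℝ} (hb : 0 ≤ b) (hb1 : b ≤ 1) (hc : 0 < c)
    {t : ℝ} (ht : t ∈ Set.Icc (-1 : ℝ) 1) :
    48 * (1 - t ^ 2 + t ^ 2 * b) - 147 * (t ^ 2 * (((1 - (1 - b ^ 2) * t ^ 2) / c + c) / 2)) ≤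
      √(1 - (1 - b ^ 2) * t ^ 2) * (48 - 147 * t ^ 2) := by
  have ht2 : t ^ 2 ≤ 1 := by nlinarith [ht.1, ht.2]
  have ht0 : 0 ≤ t ^ 2 := sq_nonneg t
  have hb2 : b ^ 2 ≤ 1 := by nlinarith
  have hu : 0 ≤ 1 - (1 - b ^ 2) * t ^ 2 := by nlinarith
  set s := √(1 - (1 - b ^ 2) * t ^ 2) with hs
  have hss : s ^ 2 = 1 - (1 - b ^ 2) * t ^ 2 := Real.sq_sqrt hu
  have h1 : 1 - t ^ 2 + t ^ 2 * b ≤ s := by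
    apply Real.le_sqrt_of_sq_le
    nlinarith [mul_nonneg (mul_nonneg ht0 (sub_nonneg.2 ht2)) (sq_nonneg (1 - b))]
  have h2 : s ≤ ((1 - (1 - b ^ 2) * t ^ 2) / c + c) / 2 := by
    rw [← hss]
    have : s ^ 2 / c + c - 2 * s = (s - c) ^ 2 / c := by field_simp; ring
    have : 0 ≤ (s - c) ^ 2 / c := by positivity
    linarith
  nlinarith [mul_le_mul_of_nonneg_left h2 ht0]

theorem integral_sqrt_mul_profile_ge {b : ℝ} (hb : 0 ≤ b) (hb1 : b ≤ 1) :
    -2 * b ^ 3 ≤ ∫ t in (-1 : ℝ)..1, √(1 - (1 - b ^ 2) * t ^ 2) * (48 - 147 * t ^ 2) := by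
  set c : ℝ := (5 + 3 * b) / 8 with hcdef
  have hc : 0 < c := by positivity
  have hmono : ∫ t in (-1 : ℝ)..1, (48 * (1 - t ^ 2 + t ^ 2 * b) -
        147 * (t ^ 2 * (((1 - (1 - b ^ 2) * t ^ 2) / c + c) / 2))) ≤
      ∫ t in (-1 : ℝ)..1, √(1 - (1 - b ^ 2) * t ^ 2) * (48 - 147 * t ^ 2) := by
    apply intervalIntegral.integral_mono_on (by norm_num)
    · apply Continuous.intervalIntegrable; fun_prop
    · apply Continuous.intervalIntegrable; fun_prop
    · intro t ht
      exact sqrt_mul_profile_ge hb hb1 hc ht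
  refine le_trans ?_ hmono
  have hint : ∫ t in (-1 : ℝ)..1, (48 * (1 - t ^ 2 + t ^ 2 * b) -
        147 * (t ^ 2 * (((1 - (1 - b ^ 2) * t ^ 2) / c + c) / 2))) =
      32 * (2 + b) - 49 * ((2 + 3 * b ^ 2) / (5 * c) + c) := by
    have : ∀ t : ℝ, (48 * (1 - t ^ 2 + t ^ 2 * b) -
        147 * (t ^ 2 * (((1 - (1 - b ^ 2) * t ^ 2) / c + c) / 2))) =
        48 + (48 * (b - 1) - 147 / 2 * (1 / c + c)) * t ^ 2 +
          (147 / 2 * (1 - b ^ 2) / c) * t ^ 4 := by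
      intro t; field_simp; ring
    simp_rw [this]
    rw [intervalIntegral.integral_add (by apply Continuous.intervalIntegrable; fun_prop)
      (by apply Continuous.intervalIntegrable; fun_prop),
      intervalIntegral.integral_add (by simp)
      (by apply Continuous.intervalIntegrable; fun_prop)]
    simp only [intervalIntegral.integral_const, intervalIntegral.integral_const_mul, integral_pow]
    norm_num
    field_simp
    ring
  rw [hint]
  have h1 : (2 + 3 * b ^ 2) / (5 * c) + c ≤ (32 * (2 + b) + 2 * b ^ 3) / 49 := by
    rw [div_add' _ _ _ (by positivity), div_le_div_iff₀ (by positivity) (by norm_num)]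
    rw [hcdef]
    have h2 : 0 ≤ b * (1 - b) := mul_nonneg hb (by linarith)
    nlinarith [mul_nonneg h2 hb, mul_nonneg (mul_nonneg h2 hb) hb, pow_nonneg hb 3]
  linarith

/-- The profile changes sign at `|t| = 4 / 7`, so it pairs nonnegatively with anything that
exceeds its value at `4 / 7` inside and is exceeded by it outside. -/
theorem profile_mul_nonneg {f t : ℝ} (h1 : t ^ 2 ≤ 16 / 49 → 0 ≤ f)
    (h2 : 16 / 49 ≤ t ^ 2 → f ≤ 0) : 0 ≤ f * (48 - 147 * t ^ 2) := by
  rcases le_total (t ^ 2) (16 / 49) with h | h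
  · exact mul_nonneg (h1 h) (by linarith)
  · exact mul_nonneg_of_nonpos_of_nonpos (h2 h) (by linarith)

theorem integral_sqrt_pow_mul_profile_ge_of_le_one {M : ℝ} (hM : 0 ≤ M) (hM1 : M ≤ 1) (j : ℕ) :
    -2 * √(1 - M) ^ (j + 3) ≤
      ∫ t in (-1 : ℝ)..1, √(1 - M * t ^ 2) ^ (j + 1) * (48 - 147 * t ^ 2) := by
  set b := √(1 - M) with hb
  have hb0 : 0 ≤ b := Real.sqrt_nonneg _
  have hbsq : b ^ 2 = 1 - M := Real.sq_sqrt (by linarith)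
  have hb1 : b ≤ 1 := by nlinarith
  have hbase := integral_sqrt_mul_profile_ge hb0 hb1
  rw [show 1 - b ^ 2 = M by linarith] at hbase
  set a : ℝ → ℝ := fun t => √(1 - M * t ^ 2) with ha
  have hac : Continuous a := by fun_prop
  set S : ℝ → ℝ := fun t => ∑ i ∈ Finset.range (j + 1), a t ^ i * b ^ (j + 1 - 1 - i) with hS
  have hanti : ∀ s t : ℝ, s ^ 2 ≤ t ^ 2 → a t ≤ a s := by
    intro s t h
    apply Real.sqrt_le_sqrt
    nlinarith
  have ha0 : ∀ t, 0 ≤ a t := fun t => Real.sqrt_nonneg _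
  have hSanti : ∀ s t : ℝ, s ^ 2 ≤ t ^ 2 → S t ≤ S s := by
    intro s t h
    apply Finset.sum_le_sum
    intro i _
    have := hanti s t h
    have := ha0 t
    gcongr
  have hfac : ∀ t, a t ^ (j + 1) - b ^ (j + 1) = S t * (a t - b) :=
    fun t => (geom_sum₂_mul (a t) b (j + 1)).symm
  have hS0 : b ^ j ≤ S (4 / 7) := by
    have h := Finset.single_le_sum (s := Finset.range (j + 1))
      (f := fun i => a (4 / 7) ^ i * b ^ (j + 1 - 1 - i))
      (fun i _ => mul_nonneg (pow_nonneg (ha0 _) _) (pow_nonneg hb0 _))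
      (Finset.mem_range.2 (Nat.succ_pos j))
    simpa [hS] using h
  have hmono : ∫ t in (-1 : ℝ)..1, (S (4 / 7) * (a t * (48 - 147 * t ^ 2)) -
        (S (4 / 7) * b - b ^ (j + 1)) * (48 - 147 * t ^ 2)) ≤
      ∫ t in (-1 : ℝ)..1, a t ^ (j + 1) * (48 - 147 * t ^ 2) := by
    apply intervalIntegral.integral_mono_on (by norm_num)
    · apply Continuous.intervalIntegrable; fun_prop
    · apply Continuous.intervalIntegrable; fun_prop
    · intro t ht
      have ht2 : t ^ 2 ≤ 1 := by nlinarith [ht.1, ht.2]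
      have hab : b ≤ a t := by
        have := hanti t 1 (by simpa using ht2)
        simpa [ha, hb] using this
      have h := profile_mul_nonneg (f := (S t - S (4 / 7)) * (a t - b)) (t := t)
        (fun h => mul_nonneg (sub_nonneg.2 (hSanti _ _ (by norm_num; linarith))) (by linarith))
        (fun h => mul_nonpos_of_nonpos_of_nonneg
          (sub_nonpos.2 (hSanti _ _ (by norm_num; linarith))) (by linarith))
      have := hfac t
      have e : a t ^ (j + 1) = S t * (a t - b) + b ^ (j + 1) := by linarith
      rw [e]
      linarith
  refine le_trans ?_ hmono
  rw [intervalIntegral.integral_sub (by apply Continuous.intervalIntegrable; fun_prop)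
    (by apply Continuous.intervalIntegrable; fun_prop), intervalIntegral.integral_const_mul,
    intervalIntegral.integral_const_mul, integral_profile]
  have h1 : S (4 / 7) * (-2 * b ^ 3) ≤
      S (4 / 7) * ∫ t in (-1 : ℝ)..1, a t * (48 - 147 * t ^ 2) :=
    mul_le_mul_of_nonneg_left hbase (le_trans (by positivity) hS0)
  have h2 : b ^ j * (b * (1 - b ^ 2)) ≤ S (4 / 7) * (b * (1 - b ^ 2)) :=
    mul_le_mul_of_nonneg_right hS0 (mul_nonneg hb0 (by nlinarith))
  have e1 : b ^ (j + 3) = b ^ j * b ^ 3 := pow_add _ _ _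
  have e2 : b ^ (j + 1) = b ^ j * b := pow_succ _ _
  rw [e1, e2]
  nlinarith

theorem integral_sqrt_pow_mul_profile_nonneg {M : ℝ} (hM1 : 1 ≤ M) (j : ℕ) :
    0 ≤ ∫ t in (-1 : ℝ)..1, √(1 - M * t ^ 2) ^ (j + 1) * (48 - 147 * t ^ 2) := by
  have hbase := integral_sqrt_mul_profile_ge le_rfl zero_le_one
  norm_num at hbase
  set a : ℝ → ℝ := fun t => √(1 - M * t ^ 2) with ha
  have hac : Continuous a := by fun_prop
  set s : ℝ := √(1 - 16 / 49) with hs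
  have hs0 : 0 < s := Real.sqrt_pos.2 (by norm_num)
  have ha0 : ∀ t, 0 ≤ a t := fun t => Real.sqrt_nonneg _
  have hanti : ∀ s t : ℝ, s ^ 2 ≤ t ^ 2 → a t ≤ a s := by
    intro s t h
    apply Real.sqrt_le_sqrt
    nlinarith
  have hmono : ∫ t in (-1 : ℝ)..1, (a (4 / 7) ^ (j + 1) / s) *
        (√(1 - t ^ 2) * (48 - 147 * t ^ 2)) ≤
      ∫ t in (-1 : ℝ)..1, a t ^ (j + 1) * (48 - 147 * t ^ 2) := by
    apply intervalIntegral.integral_mono_on (by norm_num)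
    · apply Continuous.intervalIntegrable; fun_prop
    · apply Continuous.intervalIntegrable; fun_prop
    · intro t ht
      have ht2 : t ^ 2 ≤ 1 := by nlinarith [ht.1, ht.2]
      have h1 : t ^ 2 ≤ 16 / 49 → a (4 / 7) * √(1 - t ^ 2) ≤ a t * s := by
        intro h
        rw [ha, hs, ← Real.sqrt_mul' _ (by linarith), ← Real.sqrt_mul' _ (by norm_num)]
        apply Real.sqrt_le_sqrt
        nlinarith
      have h2 : 16 / 49 ≤ t ^ 2 → a t * s ≤ a (4 / 7) * √(1 - t ^ 2) := by
        intro h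
        rw [ha, hs, ← Real.sqrt_mul' _ (by norm_num), ← Real.sqrt_mul' _ (by linarith)]
        apply Real.sqrt_le_sqrt
        nlinarith
      have h := profile_mul_nonneg (f := a t ^ (j + 1) * s - a (4 / 7) ^ (j + 1) * √(1 - t ^ 2))
        (t := t)
        (fun h => by
          have h3 := h1 h
          have h4 := pow_le_pow_left₀ (ha0 _) (hanti t (4 / 7) (by norm_num; linarith)) j
          have := mul_le_mul h4 h3 (by have := ha0 (4 / 7); positivity) (pow_nonneg (ha0 _) _)
          rw [pow_succ, pow_succ]; linarith)
        (fun h => by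
          have h3 := h2 h
          have h4 := pow_le_pow_left₀ (ha0 _) (hanti (4 / 7) t (by norm_num; linarith)) j
          have := mul_le_mul h4 h3 (by have := ha0 t; positivity) (pow_nonneg (ha0 _) _)
          rw [pow_succ, pow_succ]; linarith)
      have e : a t ^ (j + 1) * (48 - 147 * t ^ 2) -
          (a (4 / 7) ^ (j + 1) / s) * (√(1 - t ^ 2) * (48 - 147 * t ^ 2)) =
          ((a t ^ (j + 1) * s - a (4 / 7) ^ (j + 1) * √(1 - t ^ 2)) * (48 - 147 * t ^ 2)) / s := by
        field_simp
      have := div_nonneg h hs0.le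
      linarith
  refine le_trans ?_ hmono
  rw [intervalIntegral.integral_const_mul]
  have := ha0 (4 / 7)
  exact mul_nonneg (by positivity) hbase

theorem integral_sqrt_pow_mul_profile_ge {M : ℝ} (hM : 0 ≤ M) (j : ℕ) :
    -2 * √(1 - M) ^ (j + 3) ≤
      ∫ t in (-1 : ℝ)..1, √(1 - M * t ^ 2) ^ (j + 1) * (48 - 147 * t ^ 2) := by
  rcases le_total M 1 with h | h
  · exact integral_sqrt_pow_mul_profile_ge_of_le_one hM h j
  · refine le_trans ?_ (integral_sqrt_pow_mul_profile_nonneg h j)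
    have : 0 ≤ √(1 - M) ^ (j + 3) := by positivity
    linarith

theorem integral_sqrt_pow_cylinder_le {M ε b : ℝ} (hM : 0 ≤ M) (hε : 0 ≤ ε) (hb : 0 ≤ b) (j : ℕ)
    (hbε : b = 1 - ε * ((j + 3) / 2)) :
    ∫ t in (-b)..b, √(1 - M * t ^ 2) ^ (j + 3) ≤
      ∫ t in (-1 : ℝ)..1, √(1 + ε * (48 - 147 * t ^ 2) - M * t ^ 2) ^ (j + 3) := by
  have hb1 : b ≤ 1 := by rw [hbε]; nlinarith [mul_nonneg hε (by positivity : (0:ℝ) ≤ (j + 3) / 2)]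
  set a : ℝ → ℝ := fun t => √(1 - M * t ^ 2) with ha
  have hac : Continuous a := by fun_prop
  have hint : ∀ u v, IntervalIntegrable (fun t => a t ^ (j + 3)) volume u v := fun u v => by
    apply Continuous.intervalIntegrable; fun_prop
  have hend : ∀ u v : ℝ, u ≤ v → (∀ t ∈ Set.Icc u v, t ^ 2 ≤ 1) →
      (v - u) * √(1 - M) ^ (j + 3) ≤ ∫ t in u..v, a t ^ (j + 3) := by
    intro u v huv h
    have := intervalIntegral.integral_mono_on (f := fun _ => √(1 - M) ^ (j + 3)) huv
      (by simp) (hint u v) (fun t ht => by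
        have := h t ht
        exact pow_le_pow_left₀ (Real.sqrt_nonneg _) (Real.sqrt_le_sqrt (by nlinarith)) _)
    simpa using this
  have hl := hend (-1) (-b) (by linarith) (fun t ht => by nlinarith [ht.1, ht.2])
  have hr := hend b 1 hb1 (fun t ht => by nlinarith [ht.1, ht.2])
  have hsplit : ∫ t in (-1 : ℝ)..1, a t ^ (j + 3) = (∫ t in (-1 : ℝ)..(-b), a t ^ (j + 3)) +
      (∫ t in (-b)..b, a t ^ (j + 3)) + ∫ t in b..1, a t ^ (j + 3) := by
    rw [intervalIntegral.integral_add_adjacent_intervals (hint _ _) (hint _ _),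
      intervalIntegral.integral_add_adjacent_intervals (hint _ _) (hint _ _)]
  have hmain := integral_sqrt_pow_mul_profile_ge hM j
  have hmono : ∫ t in (-1 : ℝ)..1, (a t ^ (j + 3) +
        ε * ((j + 3) / 2) * (a t ^ (j + 1) * (48 - 147 * t ^ 2))) ≤
      ∫ t in (-1 : ℝ)..1, √(1 + ε * (48 - 147 * t ^ 2) - M * t ^ 2) ^ (j + 3) := by
    apply intervalIntegral.integral_mono_on (by norm_num)
    · apply Continuous.intervalIntegrable; fun_prop
    · apply Continuous.intervalIntegrable; fun_prop
    · intro t _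
      have := sqrt_pow_add_le (j + 1) (by omega) (1 - M * t ^ 2) (ε * (48 - 147 * t ^ 2))
      rw [show 1 + ε * (48 - 147 * t ^ 2) - M * t ^ 2 =
        1 - M * t ^ 2 + ε * (48 - 147 * t ^ 2) by ring]
      refine le_trans (le_of_eq ?_) this
      push_cast
      ring
  rw [intervalIntegral.integral_add (hint _ _) (by apply Continuous.intervalIntegrable; fun_prop),
    intervalIntegral.integral_const_mul] at hmono
  have h5 := mul_le_mul_of_nonneg_left hmain
    (mul_nonneg hε (by positivity : (0 : ℝ) ≤ ((j : ℝ) + 3) / 2))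
  have h6 : 1 - b = ε * ((j + 3) / 2) := by linarith
  rw [← h6] at h5 hmono
  linarith

theorem exists_integral_sqrt_pow_lt (j : ℕ) :
    ∃ ε : ℝ, 0 < ε ∧ 0 < 1 - ε * ((j + 3) / 2) ∧
      ∫ t in (-1 : ℝ)..1, √(1 + ε * (48 - 147 * t ^ 2)) ^ (j + 4) <
        2 * (1 - ε * ((j + 3) / 2)) := by
  set I : ℝ → ℝ := fun ε => ∫ t in (-1 : ℝ)..1,
    (48 - 147 * t ^ 2) * √(1 + ε * (48 - 147 * t ^ 2)) ^ (j + 2) with hI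
  have hIc : Continuous I := by
    apply intervalIntegral.continuous_parametric_intervalIntegral_of_continuous'
    fun_prop
  have hI0 : I 0 = -2 := by simpa [hI] using integral_profile
  have hev : ∀ᶠ ε in nhds (0 : ℝ), ((j : ℝ) + 4) / 2 * I ε < -(j + 3) ∧
      0 < 1 - ε * (((j : ℝ) + 3) / 2) := by
    refine Filter.Eventually.and ?_ ?_
    · have : Continuous fun ε => ((j : ℝ) + 4) / 2 * I ε := by fun_prop
      exact this.continuousAt.eventually_lt continuousAt_const (by rw [hI0]; linarith)
    · have : Continuous fun ε : ℝ => 1 - ε * (((j : ℝ) + 3) / 2) := by fun_prop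
      exact continuousAt_const.eventually_lt this.continuousAt (by simp)
  obtain ⟨ε, ⟨h1, h2⟩, hε⟩ := ((hev.filter_mono nhdsWithin_le_nhds).and
    (self_mem_nhdsWithin (a := (0 : ℝ)) (s := Set.Ioi 0))).exists
  refine ⟨ε, hε, h2, ?_⟩
  have hε : 0 < ε := hε
  have hmono : ∫ t in (-1 : ℝ)..1, √(1 + ε * (48 - 147 * t ^ 2)) ^ (j + 4) ≤
      ∫ t in (-1 : ℝ)..1, (1 + ε * (((j : ℝ) + 4) / 2) *
        ((48 - 147 * t ^ 2) * √(1 + ε * (48 - 147 * t ^ 2)) ^ (j + 2))) := by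
    apply intervalIntegral.integral_mono_on (by norm_num)
    · apply Continuous.intervalIntegrable; fun_prop
    · apply Continuous.intervalIntegrable; fun_prop
    · intro t _
      have := sqrt_pow_add_le (j + 2) (by omega) (1 + ε * (48 - 147 * t ^ 2))
        (-(ε * (48 - 147 * t ^ 2)))
      rw [add_neg_cancel_right, Real.sqrt_one, one_pow] at this
      push_cast at this
      rw [show j + 4 = j + 2 + 2 by ring]
      linarith
  refine lt_of_le_of_lt hmono ?_
  rw [intervalIntegral.integral_add (by simp)
    (by apply Continuous.intervalIntegrable; fun_prop), intervalIntegral.integral_const_mul]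
  change _ + ε * (((j : ℝ) + 4) / 2) * I ε < _
  simp only [intervalIntegral.integral_const]
  have := mul_lt_mul_of_pos_left h1 hε
  norm_num
  linarith

section RevolutionSet

variable {F : Type*} [NormedAddCommGroup F] [InnerProductSpace ℝ F]

/-- Decomposition of a space along a nonzero vector `v` and its orthogonal complement, in which the
first coordinate is the inner product with `v`. -/
def sliceEquiv (v : F) (hv : v ≠ 0) : (ℝ × (ℝ ∙ v)ᗮ) ≃ₗ[ℝ] F where
  toFun p := (p.1 / ‖v‖ ^ 2) • v + p.2
  map_add' p q := by
    simp only [Prod.fst_add, Prod.snd_add, Submodule.coe_add, add_div, add_smul]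
    abel
  map_smul' c p := by
    simp only [Prod.smul_fst, Prod.smul_snd, Submodule.coe_smul, smul_eq_mul, mul_div_assoc,
      mul_smul, smul_add, RingHom.id_apply]
  invFun x := (⟪v, x⟫, ⟨x - (⟪v, x⟫ / ‖v‖ ^ 2) • v, by
    have : ‖v‖ ≠ 0 := norm_ne_zero_iff.2 hv
    rw [Submodule.mem_orthogonal_singleton_iff_inner_right, inner_sub_right, inner_smul_right,
      real_inner_self_eq_norm_sq]
    field_simp
    ring⟩)
  left_inv p := by
    have hn : ‖v‖ ≠ 0 := norm_ne_zero_iff.2 hv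
    have hp := Submodule.mem_orthogonal_singleton_iff_inner_right.1 p.2.2
    have h : ⟪v, (p.1 / ‖v‖ ^ 2) • v + p.2⟫ = p.1 := by
      rw [inner_add_right, inner_smul_right, real_inner_self_eq_norm_sq, hp]
      field_simp
      ring
    ext
    · exact h
    · simp [h]
  right_inv x := by simp

theorem inner_sliceEquiv (v : F) (hv : v ≠ 0) (p : ℝ × (ℝ ∙ v)ᗮ) :
    ⟪v, sliceEquiv v hv p⟫ = p.1 :=
  congrArg Prod.fst ((sliceEquiv v hv).symm_apply_apply p)

theorem norm_sliceEquiv_sq (v : F) (hv : v ≠ 0) (p : ℝ × (ℝ ∙ v)ᗮ) :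
    ‖sliceEquiv v hv p‖ ^ 2 = p.1 ^ 2 / ‖v‖ ^ 2 + ‖p.2‖ ^ 2 := by
  have hn : ‖v‖ ≠ 0 := norm_ne_zero_iff.2 hv
  have hp := Submodule.mem_orthogonal_singleton_iff_inner_right.1 p.2.2
  change ‖(p.1 / ‖v‖ ^ 2) • v + (p.2 : F)‖ ^ 2 = _
  rw [norm_add_sq_real, inner_smul_left, hp, norm_smul, mul_pow, Real.norm_eq_abs, sq_abs]
  simp
  field_simp

/-- The set of points whose component along `e` is `t ∈ [-c, c]` and whose component orthogonal
to `e` has squared norm at most `R t` (for a unit vector `e`). -/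
def revolutionSet (e : F) (c : ℝ) (R : ℝ → ℝ) : Set F :=
  {x | |⟪e, x⟫| ≤ c ∧ ‖x‖ ^ 2 ≤ ⟪e, x⟫ ^ 2 + R ⟪e, x⟫}

theorem isClosed_revolutionSet (e : F) (c : ℝ) {R : ℝ → ℝ} (hR : Continuous R) :
    IsClosed (revolutionSet e c R) := by
  simp only [revolutionSet, Set.ofPred_and]
  exact (isClosed_le (by fun_prop) (by fun_prop)).inter (isClosed_le (by fun_prop) (by fun_prop))

theorem convex_revolutionSet {e : F} (he : ‖e‖ = 1) (c : ℝ) {R : ℝ → ℝ} {r q : ℝ} (hq : 0 ≤ q)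
    (hR : ∀ t, R t = r - q * t ^ 2) : Convex ℝ (revolutionSet e c R) := by
  rintro x ⟨hx1, hx2⟩ y ⟨hy1, hy2⟩ a b ha hb hab
  rw [hR] at hx2 hy2
  have hi : ⟪e, a • x + b • y⟫ = a * ⟪e, x⟫ + b * ⟪e, y⟫ := by
    rw [inner_add_right, inner_smul_right, inner_smul_right]
  refine ⟨?_, ?_⟩
  · rw [hi]
    rw [abs_le] at *
    constructor <;> nlinarith
  · rw [hi, hR]
    have hnorm : ‖a • x + b • y‖ ^ 2 =
        a ^ 2 * ‖x‖ ^ 2 + 2 * (a * b * ⟪x, y⟫) + b ^ 2 * ‖y‖ ^ 2 := by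
      rw [norm_add_sq_real, norm_smul, norm_smul, mul_pow, mul_pow, inner_smul_left,
        inner_smul_right]
      simp
      ring
    have hcs : (⟪e, x⟫ - ⟪e, y⟫) ^ 2 ≤ ‖x‖ ^ 2 - 2 * ⟪x, y⟫ + ‖y‖ ^ 2 := by
      rw [← norm_sub_sq_real, ← inner_sub_right]
      have := abs_real_inner_le_norm e (x - y)
      rw [he, one_mul] at this
      exact sq_le_sq' (by linarith [abs_le.1 this]) (abs_le.1 this).2
    have h1 := mul_le_mul_of_nonneg_left hcs (mul_nonneg ha hb)
    have h2 := mul_le_mul_of_nonneg_left hx2 ha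
    have h3 := mul_le_mul_of_nonneg_left hy2 hb
    have h4 : 0 ≤ q * (a * b * (⟪e, x⟫ - ⟪e, y⟫) ^ 2) := by positivity
    obtain rfl : b = 1 - a := by linarith
    rw [hnorm]
    nlinarith

theorem zero_mem_interior_revolutionSet (e : F) {c : ℝ} (hc : 0 < c) {R : ℝ → ℝ}
    (hR : Continuous R) (hR0 : 0 < R 0) : 0 ∈ interior (revolutionSet e c R) := by
  rw [mem_interior_iff_mem_nhds]
  have h1 : ∀ᶠ x in nhds (0 : F), |⟪e, x⟫| < c :=
    Continuous.tendsto (by fun_prop) 0 |>.eventually_lt_const (by simpa using hc)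
  have h2 : ∀ᶠ x in nhds (0 : F), ‖x‖ ^ 2 < ⟪e, x⟫ ^ 2 + R ⟪e, x⟫ :=
    ContinuousAt.eventually_lt (by fun_prop) (by fun_prop) (by simpa using hR0)
  filter_upwards [h1, h2] with x h1 h2 using ⟨h1.le, h2.le⟩

theorem mem_revolutionSet_iff_neg_mem (e : F) (c : ℝ) {R : ℝ → ℝ} (hR : ∀ t, R (-t) = R t)
    (x : F) : x ∈ revolutionSet e c R ↔ -x ∈ revolutionSet e c R := by
  simp [revolutionSet, hR]

theorem isCompact_revolutionSet [ProperSpace F] (e : F) (c : ℝ) {R : ℝ → ℝ} {r : ℝ}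
    (hR : Continuous R) (hr : ∀ t, R t ≤ r) : IsCompact (revolutionSet e c R) := by
  refine (isCompact_closedBall (0 : F) √(c ^ 2 + r)).of_isClosed_subset
    (isClosed_revolutionSet e c hR) fun x hx => ?_
  rw [mem_closedBall_zero_iff]
  apply Real.le_sqrt_of_sq_le
  have := sq_le_sq' (by linarith [abs_le.1 hx.1]) (abs_le.1 hx.1).2
  linarith [hx.2, hr ⟪e, x⟫]

/-- A section of a set of revolution by a subspace is a set of revolution around the projected
axis. -/
theorem image_subtype_revolutionSet (U : Submodule ℝ F) [U.HasOrthogonalProjection] (e : F) (c : ℝ)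
    (R : ℝ → ℝ) :
    Subtype.val '' revolutionSet (U.orthogonalProjectionOnto e) c R = revolutionSet e c R ∩ U := by
  have hmem : ∀ y : U, y ∈ revolutionSet (U.orthogonalProjectionOnto e) c R ↔
      (y : F) ∈ revolutionSet e c R := by
    intro y
    change |⟪U.orthogonalProjectionOnto e, y⟫| ≤ c ∧ _ ≤ ⟪U.orthogonalProjectionOnto e, y⟫ ^ 2 +
      R ⟪U.orthogonalProjectionOnto e, y⟫ ↔ _
    rw [Submodule.inner_orthogonalProjectionOnto_eq_of_mem_right]
    rfl
  ext x
  constructor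
  · rintro ⟨y, hy, rfl⟩
    exact ⟨(hmem y).1 hy, y.2⟩
  · rintro ⟨hx, hU⟩
    exact ⟨⟨x, hU⟩, (hmem ⟨x, hU⟩).2 hx, rfl⟩

variable [FiniteDimensional ℝ F] [MeasurableSpace F] [BorelSpace F]

/-- Haar measure of a set of revolution by slicing. -/
theorem exists_measure_revolutionSet_eq (μ : Measure F) [μ.IsAddHaarMeasure] {v : F} (hv : v ≠ 0)
    (d : ℕ) (hd : d ≠ 0) (hF : Module.finrank ℝ F = d + 1) :
    ∃ C : ℝ≥0∞, C ≠ 0 ∧ C ≠ ∞ ∧ ∀ (c : ℝ) (R : ℝ → ℝ), 0 ≤ c → Continuous R →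
      μ (revolutionSet v c R) =
        C * ENNReal.ofReal (∫ t in (-c)..c, √(R t - (1 / ‖v‖ ^ 2 - 1) * t ^ 2) ^ d) := by
  have : Fact (Module.finrank ℝ F = d + 1) := ⟨hF⟩
  have hW : Module.finrank ℝ (ℝ ∙ v)ᗮ = d := Submodule.finrank_orthogonal_span_singleton hv
  set Φ := (sliceEquiv v hv).toContinuousLinearEquiv with hΦ
  set ν : Measure (ℝ × (ℝ ∙ v)ᗮ) := volume.prod volume with hν
  have hH : (ν.map Φ).IsAddHaarMeasure := Φ.isAddHaarMeasure_map ν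
  set k := Measure.addHaarScalarFactor μ (ν.map Φ) with hk
  have hk0 : 0 < k := Measure.addHaarScalarFactor_pos_of_isAddHaarMeasure _ _
  have hμ : μ = k • ν.map Φ := Measure.isAddLeftInvariant_eq_smul _ _
  set B := volume (closedBall (0 : (ℝ ∙ v)ᗮ) 1) with hB
  refine ⟨k * B, ?_, ?_, ?_⟩
  · refine mul_ne_zero (by exact_mod_cast hk0.ne') (measure_closedBall_pos _ _ one_pos).ne'
  · exact ENNReal.mul_ne_top ENNReal.coe_ne_top measure_closedBall_lt_top.ne
  intro c R hc hR
  set r : ℝ → ℝ := fun t => R t - (1 / ‖v‖ ^ 2 - 1) * t ^ 2 with hr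
  have hrc : Continuous r := by fun_prop
  have hS := (isClosed_revolutionSet v c hR).measurableSet
  have hpre : ∀ t, volume (Prod.mk t ⁻¹' (Φ ⁻¹' revolutionSet v c R)) =
      (Set.Icc (-c) c).indicator (fun t => ENNReal.ofReal (√(r t) ^ d) * B) t := by
    intro t
    have hmem : ∀ w : (ℝ ∙ v)ᗮ, w ∈ Prod.mk t ⁻¹' (Φ ⁻¹' revolutionSet v c R) ↔
        |t| ≤ c ∧ ‖w‖ ^ 2 ≤ r t := by
      intro w
      change |⟪v, sliceEquiv v hv (t, w)⟫| ≤ c ∧ ‖sliceEquiv v hv (t, w)‖ ^ 2 ≤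
        ⟪v, sliceEquiv v hv (t, w)⟫ ^ 2 + R ⟪v, sliceEquiv v hv (t, w)⟫ ↔ _
      rw [inner_sliceEquiv, norm_sliceEquiv_sq]
      refine and_congr_right fun _ => ?_
      simp only [hr]
      constructor <;> intro h <;> ring_nf at h ⊢ <;> linarith
    by_cases ht : t ∈ Set.Icc (-c) c
    · rw [Set.indicator_of_mem ht]
      rcases lt_or_ge (r t) 0 with h | h
      · have : Prod.mk t ⁻¹' (Φ ⁻¹' revolutionSet v c R) = ∅ := by
          ext w
          rw [hmem]
          simp only [Set.mem_empty_iff_false, iff_false, not_and, not_le]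
          intro _
          exact lt_of_lt_of_le h (sq_nonneg _)
        rw [this, Real.sqrt_eq_zero_of_nonpos h.le]
        simp [hd]
      · have : Prod.mk t ⁻¹' (Φ ⁻¹' revolutionSet v c R) = closedBall 0 √(r t) := by
          ext w
          rw [hmem, mem_closedBall_zero_iff, Real.le_sqrt (norm_nonneg _) h, abs_le]
          exact and_iff_right ht
        rw [this, Measure.addHaar_closedBall' _ _ (Real.sqrt_nonneg _), hW]
    · rw [Set.indicator_of_notMem ht]
      have : Prod.mk t ⁻¹' (Φ ⁻¹' revolutionSet v c R) = ∅ := by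
        ext w
        rw [hmem, abs_le]
        simp only [Set.mem_empty_iff_false, iff_false, not_and]
        exact fun h => absurd h ht
      rw [this, measure_empty]
  rw [hμ, Measure.smul_apply, Measure.map_apply Φ.continuous.measurable hS, hν,
    Measure.prod_apply (Φ.continuous.measurable hS)]
  simp_rw [hpre]
  rw [lintegral_indicator measurableSet_Icc, lintegral_mul_const _ (by fun_prop),
    intervalIntegral.integral_of_le (by linarith), ← integral_Icc_eq_integral_Ioc,
    ofReal_integral_eq_lintegral_ofReal]
  · rw [ENNReal.smul_def, smul_eq_mul]
    ring
  · apply Continuous.integrableOn_Icc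
    fun_prop
  · exact Filter.Eventually.of_forall fun t => by positivity

end RevolutionSet

theorem hausdorffMeasure_revolutionSet_inter_hyperplane {n : ℕ} (hn : 1 ≤ n) (e u : E n) (c : ℝ)
    (R : ℝ → ℝ) :
    μH[(n : ℝ) - 1] (revolutionSet e c R ∩ hyperplane u) =
      μH[(n : ℝ) - 1] (revolutionSet ((ℝ ∙ u)ᗮ.orthogonalProjectionOnto e) c R) := by
  have hU : hyperplane u = ((ℝ ∙ u)ᗮ : Submodule ℝ (E n)) := by
    ext x
    exact Submodule.mem_orthogonal_singleton_iff_inner_left.symm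
  have hn' : (1 : ℝ) ≤ n := by exact_mod_cast hn
  rw [hU, ← image_subtype_revolutionSet]
  exact isometry_subtype_coe.hausdorffMeasure_image (Or.inl (by linarith)) _

/-- (Papadimitrakis; Gardner.) The Busemann–Petty problem has a negative answer
in `ℝⁿ` for every `n ≥ 5`. -/
theorem busemann_petty_negative_dim_ge_five (n : ℕ) (hn : 5 ≤ n) :
    ∃ K₁ K₂ : Set (E n),
      IsConvexBody K₁ ∧ IsCentered K₁ ∧ IsConvexBody K₂ ∧ IsCentered K₂ ∧
      (∀ u ∈ sphere (0 : E n) 1,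
        μH[(n : ℝ) - 1] (K₁ ∩ hyperplane u) ≤ μH[(n : ℝ) - 1] (K₂ ∩ hyperplane u)) ∧
      μH[(n : ℝ)] K₂ < μH[(n : ℝ)] K₁ := by
  obtain ⟨j, rfl⟩ := Nat.exists_eq_add_of_le' hn
  obtain ⟨ε, hε, hb, hvol⟩ := exists_integral_sqrt_pow_lt j
  set b : ℝ := 1 - ε * ((j + 3) / 2) with hbdef
  set e : E (j + 5) := EuclideanSpace.single 0 1 with hedef
  have he : ‖e‖ = 1 := by simp [hedef]
  have he0 : e ≠ 0 := norm_ne_zero_iff.1 (by rw [he]; exact one_ne_zero)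
  set R₁ : ℝ → ℝ := fun _ => 1 with hR₁
  set R₂ : ℝ → ℝ := fun t => 1 + ε * (48 - 147 * t ^ 2) with hR₂
  have hc₁ : Continuous R₁ := by fun_prop
  have hc₂ : Continuous R₂ := by fun_prop
  refine ⟨revolutionSet e b R₁, revolutionSet e 1 R₂, ⟨?_, ?_, 0, ?_⟩, ?_, ⟨?_, ?_, 0, ?_⟩, ?_,
    ?_, ?_⟩
  · exact isCompact_revolutionSet e b hc₁ (fun _ => le_rfl)
  · exact convex_revolutionSet he b (r := 1) le_rfl (fun t => by simp [hR₁])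
  · exact zero_mem_interior_revolutionSet e hb hc₁ one_pos
  · exact mem_revolutionSet_iff_neg_mem e b (fun _ => rfl)
  · exact isCompact_revolutionSet e 1 (r := 1 + ε * 48) hc₂ (fun t => by
      simp only [hR₂]; gcongr; nlinarith [sq_nonneg t])
  · exact convex_revolutionSet he 1 (r := 1 + ε * 48) (q := ε * 147) (by positivity)
      (fun t => by simp only [hR₂]; ring)
  · exact zero_mem_interior_revolutionSet e one_pos hc₂ (by simp only [hR₂]; norm_num; positivity)
  · exact mem_revolutionSet_iff_neg_mem e 1 (fun t => by simp [hR₂])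
  · intro u hu
    have hu0 : u ≠ 0 := by rintro rfl; simp at hu
    rw [hausdorffMeasure_revolutionSet_inter_hyperplane (by omega),
      hausdorffMeasure_revolutionSet_inter_hyperplane (by omega)]
    set v := (ℝ ∙ u)ᗮ.orthogonalProjectionOnto e with hv
    by_cases hv0 : v = 0
    · refine measure_mono fun x hx => ?_
      have := hx.2
      simp only [revolutionSet, hv0, inner_zero_left, hR₁, hR₂, Set.mem_ofPred_eq] at this ⊢
      exact ⟨by simp, by nlinarith⟩
    · have : Fact (Module.finrank ℝ (E (j + 5)) = (j + 4) + 1) := ⟨by simp⟩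
      have hU : Module.finrank ℝ (ℝ ∙ u)ᗮ = (j + 3) + 1 :=
        Submodule.finrank_orthogonal_span_singleton hu0
      have hdim : ((j + 5 : ℕ) : ℝ) - 1 = Module.finrank ℝ (ℝ ∙ u)ᗮ := by
        rw [hU]; push_cast; ring
      rw [hdim]
      obtain ⟨C, -, -, hC⟩ := exists_measure_revolutionSet_eq
        (μH[(Module.finrank ℝ (ℝ ∙ u)ᗮ : ℝ)]) hv0 (j + 3) (by omega) hU
      rw [hC b R₁ hb.le hc₁, hC 1 R₂ zero_le_one hc₂]
      have hv1 : ‖v‖ ≤ 1 := he ▸ Submodule.norm_orthogonalProjectionOnto_apply_le _ e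
      have hM : 0 ≤ 1 / ‖v‖ ^ 2 - 1 := by
        have : 0 < ‖v‖ := norm_pos_iff.2 hv0
        rw [sub_nonneg, le_div_iff₀ (by positivity), one_mul]
        exact pow_le_one₀ (norm_nonneg _) hv1
      gcongr
      exact integral_sqrt_pow_cylinder_le hM hε.le hb.le j hbdef
  · have hE : Module.finrank ℝ (E (j + 5)) = (j + 4) + 1 := by simp
    have hdim : ((j + 5 : ℕ) : ℝ) = Module.finrank ℝ (E (j + 5)) := by simp
    rw [hdim]
    obtain ⟨C, hC0, hC1, hC⟩ := exists_measure_revolutionSet_eq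
      (μH[(Module.finrank ℝ (E (j + 5)) : ℝ)]) he0 (j + 4) (by omega) hE
    rw [hC b R₁ hb.le hc₁, hC 1 R₂ zero_le_one hc₂]
    refine ENNReal.mul_lt_mul_right hC0 hC1 ((ENNReal.ofReal_lt_ofReal_iff ?_).2 ?_)
    · simp [hR₁, he]; linarith
    · simp only [hR₁, hR₂, he]
      norm_num at hvol ⊢
      linarith
end
end

section
/- There exist a centered circular cylinder C = {(x₁,x₂,x₃) ∈ ℝ³ : x₁² + x₂² ≤ a², |x₃| ≤ h} for some a, h > 0 and a centered star body M that is NOT convex such that ρ_C(u) = λ₂(M ∩ u^⊥) for all u ∈ S²; that is, a centered cylinder in ℝ³ is the intersection body of a nonconvex centered star body. -/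
open MeasureTheory Metric
open scoped RealInnerProductSpace ENNReal

noncomputable section

/-- The squared radial function of the nonconvex body, up to scaling, as a function of the sine of
the latitude. -/
def profile (t : ℝ) : ℝ :=
  (16 / 25) / (1 - (min |t| (3 / 5)) ^ 2) *
    ((9 / 25) / (max |t| (3 / 5) *
      (4 / 5 * max |t| (3 / 5) + √((max |t| (3 / 5)) ^ 2 - 9 / 25))))

lemma one_sub_min_sq_pos (t : ℝ) : 0 < 1 - (min |t| (3 / 5)) ^ 2 := by
  have h1 : min |t| (3 / 5) ≤ 3 / 5 := min_le_right _ _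
  have h2 : 0 ≤ min |t| (3 / 5) := le_min (abs_nonneg t) (by norm_num)
  nlinarith

lemma max_mul_pos (t : ℝ) : 0 < max |t| (3 / 5) *
    (4 / 5 * max |t| (3 / 5) + √((max |t| (3 / 5)) ^ 2 - 9 / 25)) := by
  have h1 : 3 / 5 ≤ max |t| (3 / 5) := le_max_right _ _
  have h2 := Real.sqrt_nonneg ((max |t| (3 / 5)) ^ 2 - 9 / 25)
  have h3 : 0 < max |t| (3 / 5) := by linarith
  positivity

lemma profile_pos (t : ℝ) : 0 < profile t :=
  mul_pos (div_pos (by norm_num) (one_sub_min_sq_pos t))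
    (div_pos (by norm_num) (max_mul_pos t))

lemma continuous_profile : Continuous profile := by
  unfold profile
  refine Continuous.mul (Continuous.div (by fun_prop) (by fun_prop) fun t => ?_)
    (Continuous.div (by fun_prop) (by fun_prop) fun t => ?_)
  · exact (one_sub_min_sq_pos t).ne'
  · exact (max_mul_pos t).ne'

lemma profile_neg (t : ℝ) : profile (-t) = profile t := by simp [profile]

lemma profile_of_le {t : ℝ} (h0 : 0 ≤ t) (h : t ≤ 3 / 5) :
    profile t = (4 / 5) / (1 - t ^ 2) := by
  have h1 : 0 < 1 - t ^ 2 := by nlinarith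
  rw [profile, abs_of_nonneg h0, min_eq_left h, max_eq_right h,
    show ((3 / 5 : ℝ) ^ 2 - 9 / 25) = 0 by norm_num, Real.sqrt_zero]
  field_simp
  norm_num

lemma profile_of_ge {t : ℝ} (h : 3 / 5 ≤ t) :
    profile t = (9 / 25) / (t * (4 / 5 * t + √(t ^ 2 - 9 / 25))) := by
  rw [profile, abs_of_nonneg (by linarith), min_eq_right h, max_eq_left h]
  norm_num

lemma profile_of_ge_of_lt_one {t : ℝ} (h : 3 / 5 ≤ t) (h1 : t < 1) :
    profile t = (4 / 5) / (1 - t ^ 2) - √(t ^ 2 - 9 / 25) / (t * (1 - t ^ 2)) := by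
  rw [profile_of_ge h]
  have hq := Real.sqrt_nonneg (t ^ 2 - 9 / 25)
  have hq2 : √(t ^ 2 - 9 / 25) ^ 2 = t ^ 2 - 9 / 25 := Real.sq_sqrt (by nlinarith)
  set q := √(t ^ 2 - 9 / 25)
  have h2 : 0 < 1 - t ^ 2 := by nlinarith
  have h3 : 0 < t := by linarith
  have h4 : 0 < 4 / 5 * t + q := by linarith
  field_simp
  linear_combination (625 : ℝ) * hq2

/-- The antiderivative of `r / (sin² + r² cos²)`. -/
lemma hasDerivAt_add_arctan {r : ℝ} (hr : 0 < r) (θ : ℝ) :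
    HasDerivAt (fun θ => θ + Real.arctan ((1 - r) * (Real.sin θ * Real.cos θ) /
      (r * Real.cos θ ^ 2 + Real.sin θ ^ 2)))
      (r / (1 - (1 - r ^ 2) * Real.cos θ ^ 2)) θ := by
  have hsc := Real.sin_sq_add_cos_sq θ
  have hD : 0 < r * Real.cos θ ^ 2 + Real.sin θ ^ 2 := by
    rcases eq_or_ne (Real.cos θ) 0 with h | h
    · rw [h] at hsc ⊢; nlinarith
    · positivity
  have hE : 0 < 1 - (1 - r ^ 2) * Real.cos θ ^ 2 := by
    have : 0 < r ^ 2 := by positivity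
    rcases eq_or_ne (Real.cos θ) 0 with h | h
    · rw [h]; norm_num
    · nlinarith [sq_nonneg (Real.sin θ), mul_pos this (by positivity : 0 < Real.cos θ ^ 2)]
  have h1 := (((Real.hasDerivAt_sin θ).mul (Real.hasDerivAt_cos θ)).const_mul (1 - r)).div
    ((((Real.hasDerivAt_cos θ).pow 2).const_mul r).add ((Real.hasDerivAt_sin θ).pow 2)) hD.ne'
  refine ((hasDerivAt_id θ).add h1.arctan).congr_deriv ?_
  simp only [Pi.mul_apply, Pi.add_apply, Pi.pow_apply, Pi.div_apply]
  have hc2 : Real.cos θ ^ 2 = 1 - Real.sin θ ^ 2 := by linarith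
  set S := Real.sin θ
  set C := Real.cos θ
  have key : (r * C ^ 2 + S ^ 2) ^ 2 + ((1 - r) * (S * C)) ^ 2
      = 1 - (1 - r ^ 2) * C ^ 2 := by
    grind
  have key2 : 1 / (1 + ((1 - r) * (S * C) / (r * C ^ 2 + S ^ 2)) ^ 2)
      = (r * C ^ 2 + S ^ 2) ^ 2 / (1 - (1 - r ^ 2) * C ^ 2) := by
    rw [← key]; field_simp
  rw [key2]
  field_simp
  grind


open Set in
lemma integral_profile_of_le {s : ℝ} (h0 : 0 ≤ s) (h : s ≤ 3 / 5) :
    ∫ θ in (0 : ℝ)..(Real.pi / 2), profile (s * Real.cos θ) =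
      Real.pi / 2 * ((4 / 5) / √(1 - s ^ 2)) := by
  have hr : 0 < √(1 - s ^ 2) := Real.sqrt_pos.2 (by nlinarith)
  have hr2 : √(1 - s ^ 2) ^ 2 = 1 - s ^ 2 := Real.sq_sqrt (by nlinarith)
  have hint : IntervalIntegrable (fun θ => profile (s * Real.cos θ)) volume 0 (Real.pi / 2) :=
    (continuous_profile.comp (by fun_prop)).intervalIntegrable _ _
  rw [intervalIntegral.integral_eq_sub_of_hasDerivAt
    (f := fun θ => (4 / 5) / √(1 - s ^ 2) * (θ + Real.arctan ((1 - √(1 - s ^ 2)) *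
      (Real.sin θ * Real.cos θ) / (√(1 - s ^ 2) * Real.cos θ ^ 2 + Real.sin θ ^ 2))))
    (fun θ hθ => ?_) hint]
  · simp
    ring
  · rw [uIcc_of_le (by positivity)] at hθ
    have hc : 0 ≤ Real.cos θ := Real.cos_nonneg_of_mem_Icc ⟨by linarith [hθ.1, Real.pi_pos], hθ.2⟩
    have hc1 := Real.cos_le_one θ
    refine ((hasDerivAt_add_arctan hr θ).const_mul _).congr_deriv ?_
    rw [profile_of_le (by positivity) (by nlinarith), hr2]
    have : 1 - (s * Real.cos θ) ^ 2 = 1 - (1 - (1 - s ^ 2)) * Real.cos θ ^ 2 := by ring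
    rw [this]
    field_simp

lemma hasDerivAt_arcsin_mul_tan {a s θ : ℝ} (ha : 0 < a) (hs : a < s) (hθ : 0 < Real.cos θ)
    (h : a < s * Real.cos θ) :
    HasDerivAt (fun θ => Real.arcsin (a * Real.sin θ / (√(s ^ 2 - a ^ 2) * Real.cos θ)))
      (a / (Real.cos θ * √((s * Real.cos θ) ^ 2 - a ^ 2))) θ := by
  have hsc := Real.sin_sq_add_cos_sq θ
  have hQ : 0 < √(s ^ 2 - a ^ 2) := Real.sqrt_pos.2 (by nlinarith)
  have hQ2 : √(s ^ 2 - a ^ 2) ^ 2 = s ^ 2 - a ^ 2 := Real.sq_sqrt (by nlinarith)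
  have hq : 0 < √((s * Real.cos θ) ^ 2 - a ^ 2) := Real.sqrt_pos.2 (by nlinarith)
  have hq2 : √((s * Real.cos θ) ^ 2 - a ^ 2) ^ 2 = (s * Real.cos θ) ^ 2 - a ^ 2 :=
    Real.sq_sqrt (by nlinarith)
  have hd := ((Real.hasDerivAt_sin θ).const_mul a).div
    ((Real.hasDerivAt_cos θ).const_mul √(s ^ 2 - a ^ 2)) (by positivity)
  set Q := √(s ^ 2 - a ^ 2)
  set q := √((s * Real.cos θ) ^ 2 - a ^ 2)
  set S := Real.sin θ
  set C := Real.cos θ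
  have key : 1 - (a * S / (Q * C)) ^ 2 = (q / (Q * C)) ^ 2 := by
    field_simp
    rw [hQ2, hq2]
    linear_combination (-a ^ 2) * hsc
  have hlt : (a * S / (Q * C)) ^ 2 < 1 := by
    have : 0 < (q / (Q * C)) ^ 2 := by positivity
    linarith
  have hne := abs_lt.1 ((sq_lt_one_iff_abs_lt_one _).1 hlt)
  refine ((Real.hasDerivAt_arcsin hne.1.ne' hne.2.ne).comp θ hd).congr_deriv ?_
  rw [key, Real.sqrt_sq (by positivity)]
  field_simp
  grind

lemma hasDerivAt_arcsin_mul_sin {a c s θ : ℝ} (hc : 0 < c) (ha : 0 < a) (hac : a ^ 2 + c ^ 2 = 1)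
    (hs : a < s) (hs1 : s < 1) (h : a < s * Real.cos θ) :
    HasDerivAt (fun θ => Real.arcsin (c * s * Real.sin θ /
        (√(s ^ 2 - a ^ 2) * √(1 - (s * Real.cos θ) ^ 2))))
      (c * √(1 - s ^ 2) * (s * Real.cos θ) /
        (√((s * Real.cos θ) ^ 2 - a ^ 2) * (1 - (s * Real.cos θ) ^ 2))) θ := by
  have hsc := Real.sin_sq_add_cos_sq θ
  have hc1 := Real.cos_le_one θ
  have hQ : 0 < √(s ^ 2 - a ^ 2) := Real.sqrt_pos.2 (by nlinarith)
  have hQ2 : √(s ^ 2 - a ^ 2) ^ 2 = s ^ 2 - a ^ 2 := Real.sq_sqrt (by nlinarith)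
  have hr : 0 < √(1 - s ^ 2) := Real.sqrt_pos.2 (by nlinarith)
  have hr2 : √(1 - s ^ 2) ^ 2 = 1 - s ^ 2 := Real.sq_sqrt (by nlinarith)
  have hq : 0 < √((s * Real.cos θ) ^ 2 - a ^ 2) := Real.sqrt_pos.2 (by nlinarith)
  have hq2 : √((s * Real.cos θ) ^ 2 - a ^ 2) ^ 2 = (s * Real.cos θ) ^ 2 - a ^ 2 :=
    Real.sq_sqrt (by nlinarith)
  have hx : s * Real.cos θ < 1 := by nlinarith
  have hy : 0 < 1 - (s * Real.cos θ) ^ 2 := by nlinarith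
  have hp : 0 < √(1 - (s * Real.cos θ) ^ 2) := Real.sqrt_pos.2 hy
  have hp2 : √(1 - (s * Real.cos θ) ^ 2) ^ 2 = 1 - (s * Real.cos θ) ^ 2 := Real.sq_sqrt hy.le
  have hd := ((Real.hasDerivAt_sin θ).const_mul (c * s)).div
    ((((((Real.hasDerivAt_cos θ).const_mul s).pow 2).const_sub 1).sqrt hy.ne').const_mul
      √(s ^ 2 - a ^ 2)) (by simp only [Pi.pow_apply]; positivity)
  simp only [Pi.pow_apply] at hd
  set Q := √(s ^ 2 - a ^ 2)
  set r := √(1 - s ^ 2)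
  set p := √(1 - (s * Real.cos θ) ^ 2)
  set q := √((s * Real.cos θ) ^ 2 - a ^ 2)
  set S := Real.sin θ
  set C := Real.cos θ
  have key : 1 - (c * s * S / (Q * p)) ^ 2 = (r * q / (Q * p)) ^ 2 := by
    field_simp
    rw [hQ2, hq2, hr2, hp2]
    grind
  have hlt : (c * s * S / (Q * p)) ^ 2 < 1 := by
    have : 0 < (r * q / (Q * p)) ^ 2 := by positivity
    linarith
  have hne := abs_lt.1 ((sq_lt_one_iff_abs_lt_one _).1 hlt)
  refine ((Real.hasDerivAt_arcsin hne.1.ne' hne.2.ne).comp θ hd).congr_deriv ?_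
  rw [key, Real.sqrt_sq (by positivity), ← hp2]
  field_simp
  rw [hp2, hr2]
  grind

open Set in
lemma integral_profile_of_lt_of_lt_one {s : ℝ} (h : 3 / 5 < s) (h1 : s < 1) :
    ∫ θ in (0 : ℝ)..(Real.pi / 2), profile (s * Real.cos θ) = Real.pi / 2 * ((3 / 5) / s) := by
  have hs0 : 0 < s := by linarith
  have hr : 0 < √(1 - s ^ 2) := Real.sqrt_pos.2 (by nlinarith)
  have hr2 : √(1 - s ^ 2) ^ 2 = 1 - s ^ 2 := Real.sq_sqrt (by nlinarith)
  have hQ : 0 < √(s ^ 2 - (3 / 5) ^ 2) := Real.sqrt_pos.2 (by nlinarith)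
  have hQ2 : √(s ^ 2 - (3 / 5) ^ 2) ^ 2 = s ^ 2 - (3 / 5) ^ 2 := Real.sq_sqrt (by nlinarith)
  have hint (a b : ℝ) : IntervalIntegrable (fun θ => profile (s * Real.cos θ)) volume a b :=
    (continuous_profile.comp (by fun_prop)).intervalIntegrable _ _
  have hlt : 3 / 5 / s < 1 := (div_lt_one hs0).2 h
  have hpos : 0 < 3 / 5 / s := by positivity
  obtain ⟨θ₀, hθ₀⟩ : ∃ θ₀, θ₀ = Real.arccos (3 / 5 / s) := ⟨_, rfl⟩
  have hcos : Real.cos θ₀ = 3 / 5 / s := hθ₀ ▸ Real.cos_arccos (by linarith) hlt.le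
  have hθ0 : 0 ≤ θ₀ := hθ₀ ▸ Real.arccos_nonneg _
  have hθ1 : θ₀ ≤ Real.pi / 2 := by rw [hθ₀, Real.arccos_le_pi_div_two]; exact hpos.le
  have hsin : Real.sin θ₀ = √(s ^ 2 - (3 / 5) ^ 2) / s := by
    rw [hθ₀, Real.sin_arccos, Real.sqrt_eq_iff_mul_self_eq_of_pos (by positivity)]
    rw [div_mul_div_comm, ← pow_two, hQ2]
    field_simp
  rw [← intervalIntegral.integral_add_adjacent_intervals (hint 0 θ₀) (hint θ₀ _),
    intervalIntegral.integral_eq_sub_of_hasDerivAt_of_le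
    (f := fun θ => (4 / 5) / √(1 - s ^ 2) * (θ + Real.arctan ((1 - √(1 - s ^ 2)) *
      (Real.sin θ * Real.cos θ) / (√(1 - s ^ 2) * Real.cos θ ^ 2 + Real.sin θ ^ 2))) +
      (3 / 5) / s * Real.arcsin
        (3 / 5 * Real.sin θ / (√(s ^ 2 - (3 / 5) ^ 2) * Real.cos θ)) -
      (4 / 5) / √(1 - s ^ 2) * Real.arcsin (4 / 5 * s * Real.sin θ /
        (√(s ^ 2 - (3 / 5) ^ 2) * √(1 - (s * Real.cos θ) ^ 2)))) hθ0 ?_ ?_ (hint _ _),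
    intervalIntegral.integral_eq_sub_of_hasDerivAt
    (f := fun θ => (4 / 5) / √(1 - s ^ 2) * (θ + Real.arctan ((1 - √(1 - s ^ 2)) *
      (Real.sin θ * Real.cos θ) / (√(1 - s ^ 2) * Real.cos θ ^ 2 + Real.sin θ ^ 2))))
      ?_ (hint _ _)]
  · have e1 : 3 / 5 * Real.sin θ₀ / (√(s ^ 2 - (3 / 5) ^ 2) * Real.cos θ₀) = 1 := by
      rw [hsin, hcos]
      generalize √(s ^ 2 - (3 / 5) ^ 2) = Q at hQ ⊢
      field_simp
    have e2 : 4 / 5 * s * Real.sin θ₀ /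
        (√(s ^ 2 - (3 / 5) ^ 2) * √(1 - (s * Real.cos θ₀) ^ 2)) = 1 := by
      rw [hcos, mul_div_cancel₀ _ hs0.ne', show (1 - (3 / 5 : ℝ) ^ 2) = (4 / 5) ^ 2 by norm_num,
        Real.sqrt_sq (by norm_num), hsin]
      generalize √(s ^ 2 - (3 / 5) ^ 2) = Q at hQ ⊢
      field_simp
    simp only [e1, e2, Real.arcsin_one, Real.sin_zero, Real.cos_pi_div_two, mul_zero, zero_mul,
      zero_div, Real.arctan_zero, Real.arcsin_zero]
    ring
  · intro θ hθ
    rw [uIcc_of_le hθ1] at hθ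
    have hc : 0 ≤ Real.cos θ :=
      Real.cos_nonneg_of_mem_Icc ⟨by linarith [hθ.1, Real.pi_pos], hθ.2⟩
    have hc1 : Real.cos θ ≤ 3 / 5 / s :=
      hcos ▸ Real.cos_le_cos_of_nonneg_of_le_pi hθ0 (by linarith [hθ.2, Real.pi_pos]) hθ.1
    refine ((hasDerivAt_add_arctan hr θ).const_mul _).congr_deriv ?_
    rw [profile_of_le (by positivity) (by rwa [le_div_iff₀' hs0] at hc1), hr2]
    have : 1 - (s * Real.cos θ) ^ 2 = 1 - (1 - (1 - s ^ 2)) * Real.cos θ ^ 2 := by ring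
    rw [this]
    field_simp
  · have hc (θ : ℝ) (hθ : θ ∈ Icc 0 θ₀) : 0 < Real.cos θ :=
      (hcos ▸ hpos).trans_le
        (Real.cos_le_cos_of_nonneg_of_le_pi hθ.1 (by linarith [Real.pi_pos]) hθ.2)
    refine (ContinuousOn.add (ContinuousOn.mul (by fun_prop) fun θ _ =>
      ?_) (ContinuousOn.mul (by fun_prop) ?_)).sub (ContinuousOn.mul (by fun_prop) ?_)
    · have := (hasDerivAt_add_arctan hr θ).continuousAt
      exact this.continuousWithinAt
    · refine Real.continuous_arcsin.comp_continuousOn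
        (ContinuousOn.div (by fun_prop) (by fun_prop) fun θ hθ => ?_)
      have := hc θ hθ
      positivity
    · refine Real.continuous_arcsin.comp_continuousOn
        (ContinuousOn.div (by fun_prop) (by fun_prop) fun θ hθ => ?_)
      have h2 := hc θ hθ
      have h3 := Real.cos_le_one θ
      have h4 : s * Real.cos θ < 1 := by nlinarith
      have : 0 < √(1 - (s * Real.cos θ) ^ 2) := Real.sqrt_pos.2 (by nlinarith [mul_pos hs0 h2])
      positivity
  · intro θ hθ
    have hc : 3 / 5 / s < Real.cos θ := by
      rw [← hcos]
      exact Real.cos_lt_cos_of_nonneg_of_le_pi hθ.1.le (by linarith [Real.pi_pos]) hθ.2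
    have hc1 := Real.cos_le_one θ
    have h2 : 3 / 5 < s * Real.cos θ := by rwa [div_lt_iff₀' hs0] at hc
    have h3 : s * Real.cos θ < 1 := by nlinarith
    refine ((((hasDerivAt_add_arctan hr θ).const_mul _).add
      ((hasDerivAt_arcsin_mul_tan (by norm_num) h (hpos.trans hc) h2).const_mul _)).sub
      ((hasDerivAt_arcsin_mul_sin (c := 4 / 5) (by norm_num) (by norm_num) (by norm_num)
        h h1 h2).const_mul _)).congr_deriv ?_
    rw [profile_of_ge_of_lt_one h2.le h3, hr2]
    have e : 1 - (1 - (1 - s ^ 2)) * Real.cos θ ^ 2 = 1 - (s * Real.cos θ) ^ 2 := by ring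
    rw [e, show (s * Real.cos θ) ^ 2 - 9 / 25 = (s * Real.cos θ) ^ 2 - (3 / 5) ^ 2 by norm_num]
    have hq : 0 < √((s * Real.cos θ) ^ 2 - (3 / 5) ^ 2) := Real.sqrt_pos.2 (by nlinarith)
    have hq2 : √((s * Real.cos θ) ^ 2 - (3 / 5) ^ 2) ^ 2 = (s * Real.cos θ) ^ 2 - (3 / 5) ^ 2 :=
      Real.sq_sqrt (by nlinarith)
    have hy : 0 < 1 - (s * Real.cos θ) ^ 2 := by nlinarith
    have hC : 0 < Real.cos θ := hpos.trans hc
    set q := √((s * Real.cos θ) ^ 2 - (3 / 5) ^ 2)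
    obtain ⟨y, hyd⟩ : ∃ y, y = 1 - (s * Real.cos θ) ^ 2 := ⟨_, rfl⟩
    rw [← hyd] at hy ⊢
    field_simp
    grind

open Set Topology in
lemma integral_profile_of_ge {s : ℝ} (h : 3 / 5 < s) (h1 : s ≤ 1) :
    ∫ θ in (0 : ℝ)..(Real.pi / 2), profile (s * Real.cos θ) = Real.pi / 2 * ((3 / 5) / s) := by
  rcases h1.lt_or_eq with h1 | rfl
  · exact integral_profile_of_lt_of_lt_one h h1
  have hcont : Continuous fun s : ℝ =>
      ∫ θ in (0 : ℝ)..(Real.pi / 2), profile (s * Real.cos θ) :=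
    intervalIntegral.continuous_parametric_intervalIntegral_of_continuous'
      (f := fun s θ => profile (s * Real.cos θ)) (continuous_profile.comp (by fun_prop)) _ _
  have hcont' : ContinuousAt (fun s : ℝ => Real.pi / 2 * ((3 / 5) / s)) 1 := by
    fun_prop (disch := norm_num)
  refine tendsto_nhds_unique (hcont.continuousAt.tendsto.mono_left nhdsWithin_le_nhds)
    ((hcont'.tendsto.mono_left (nhdsWithin_le_nhds (s := Iio 1))).congr' ?_)
  filter_upwards [Ioo_mem_nhdsLT h] with s hs
  exact (integral_profile_of_lt_of_lt_one hs.1 hs.2).symm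

lemma integral_profile_mul_sin (s : ℝ) :
    ∫ θ in (-Real.pi)..Real.pi, profile (s * Real.sin θ) =
      4 * ∫ θ in (0 : ℝ)..(Real.pi / 2), profile (s * Real.cos θ) := by
  have hint (a b : ℝ) : IntervalIntegrable (fun θ => profile (s * Real.sin θ)) volume a b :=
    (continuous_profile.comp (by fun_prop)).intervalIntegrable _ _
  have e1 : ∫ θ in (0 : ℝ)..(Real.pi / 2), profile (s * Real.sin θ) =
      ∫ θ in (0 : ℝ)..(Real.pi / 2), profile (s * Real.cos θ) := by
    have := intervalIntegral.integral_comp_sub_left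
      (fun θ => profile (s * Real.cos θ)) (Real.pi / 2) (a := 0) (b := Real.pi / 2)
    simpa [Real.cos_pi_div_two_sub] using this
  have e2 : ∫ θ in (Real.pi / 2)..Real.pi, profile (s * Real.sin θ) =
      ∫ θ in (0 : ℝ)..(Real.pi / 2), profile (s * Real.sin θ) := by
    have := intervalIntegral.integral_comp_sub_left
      (fun θ => profile (s * Real.sin θ)) Real.pi (a := Real.pi / 2) (b := Real.pi)
    simpa [Real.sin_pi_sub, sub_half] using this
  have e3 : ∫ θ in (-Real.pi)..0, profile (s * Real.sin θ) =
      ∫ θ in (0 : ℝ)..Real.pi, profile (s * Real.sin θ) := by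
    have := intervalIntegral.integral_comp_neg
      (fun θ => profile (s * Real.sin θ)) (a := -Real.pi) (b := 0)
    simpa [profile_neg] using this
  rw [← intervalIntegral.integral_add_adjacent_intervals (hint (-Real.pi) 0) (hint 0 _), e3,
    ← intervalIntegral.integral_add_adjacent_intervals (hint 0 (Real.pi / 2)) (hint _ _), e2, e1]
  ring

lemma norm_sq_eq_one_iff (u : E 3) : ‖u‖ = 1 ↔ u 0 ^ 2 + u 1 ^ 2 + u 2 ^ 2 = 1 := by
  rw [← sq_eq_sq₀ (norm_nonneg u) zero_le_one, EuclideanSpace.norm_sq_eq]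
  simp [Fin.sum_univ_three]

/-- The set whose radial function at a unit vector `u` is `√(profile (u 2))`. -/
def profileBody : Set (E 3) := {x | ‖x‖ ^ 2 ≤ profile (x 2 / ‖x‖)}

lemma smul_mem_profileBody_iff {u : E 3} (hu : ‖u‖ = 1) {c : ℝ} (hc : 0 ≤ c) :
    c • u ∈ profileBody ↔ c ≤ √(profile (u 2)) := by
  rw [Real.le_sqrt hc (profile_pos _).le]
  rcases hc.eq_or_lt with rfl | hc
  · simp [profileBody, (profile_pos _).le]
  · simp [profileBody, norm_smul, hu, abs_of_pos hc, mul_div_cancel_left₀ _ hc.ne']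

lemma radialFn_profileBody {u : E 3} (hu : ‖u‖ = 1) :
    radialFn profileBody u = √(profile (u 2)) := by
  have : {c : ℝ | 0 ≤ c ∧ c • u ∈ profileBody} = Set.Icc 0 √(profile (u 2)) := by
    ext c
    exact and_congr_right fun hc => smul_mem_profileBody_iff hu hc
  rw [radialFn, this, csSup_Icc (Real.sqrt_nonneg _)]

lemma exists_eq_norm_smul (x : E 3) : ∃ u : E 3, ‖u‖ = 1 ∧ x = ‖x‖ • u := by
  rcases eq_or_ne x 0 with rfl | hx
  · exact ⟨EuclideanSpace.single 0 1, by simp, by simp⟩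
  · exact ⟨‖x‖⁻¹ • x, norm_smul_inv_norm hx, by rw [smul_inv_smul₀ (norm_ne_zero_iff.2 hx)]⟩

lemma isCompact_profileBody : IsCompact profileBody := by
  have h : profileBody = (fun p : E 3 × ℝ => (p.2 * √(profile (p.1 2))) • p.1) ''
      (sphere (0 : E 3) 1 ×ˢ Set.Icc (0 : ℝ) 1) := by
    ext x
    constructor
    · intro hx
      obtain ⟨u, hu, hxu⟩ := exists_eq_norm_smul x
      rw [hxu, smul_mem_profileBody_iff hu (norm_nonneg x)] at hx
      have hp := Real.sqrt_pos.2 (profile_pos (u 2))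
      refine ⟨(u, ‖x‖ / √(profile (u 2))), ⟨by simpa using hu, by positivity,
        (div_le_one hp).2 hx⟩, ?_⟩
      simp only [div_mul_cancel₀ _ hp.ne']
      exact hxu.symm
    · rintro ⟨⟨u, r⟩, ⟨hu, hr⟩, rfl⟩
      have hp := Real.sqrt_nonneg (profile (u 2))
      rw [smul_mem_profileBody_iff (by simpa using hu) (mul_nonneg hr.1 hp)]
      exact mul_le_of_le_one_left hp hr.2
  rw [h]
  refine ((isCompact_sphere _ _).prod isCompact_Icc).image ?_
  have := continuous_profile
  fun_prop

lemma starConvex_profileBody : StarConvex ℝ 0 profileBody := by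
  rw [starConvex_zero_iff]
  intro x hx a ha ha1
  obtain ⟨u, hu, hxu⟩ := exists_eq_norm_smul x
  rw [hxu, smul_mem_profileBody_iff hu (norm_nonneg x)] at hx
  rw [hxu, smul_smul, smul_mem_profileBody_iff hu (by positivity)]
  exact (mul_le_of_le_one_left (norm_nonneg x) ha1).trans hx

lemma isStarBody_profileBody : IsStarBody profileBody := by
  refine ⟨isCompact_profileBody, by simp [profileBody, (profile_pos _).le],
    starConvex_profileBody, ?_⟩
  have h : Continuous fun u : E 3 => √(profile (u 2)) := by
    have := continuous_profile
    fun_prop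
  exact h.continuousOn.congr fun u hu => radialFn_profileBody (by simpa using hu)

lemma isCentered_profileBody : IsCentered profileBody := by
  intro x
  simp [profileBody, neg_div, profile_neg]

lemma not_convex_profileBody : ¬ Convex ℝ profileBody := by
  have h35 : profile (3 / 5) = 5 / 4 := by
    rw [profile_of_le (by norm_num) le_rfl]; norm_num
  have h1 : profile 1 = 9 / 40 := by
    rw [profile_of_ge (by norm_num), show ((1 : ℝ) ^ 2 - 9 / 25) = (4 / 5) ^ 2 by norm_num,
      Real.sqrt_sq (by norm_num)]
    norm_num
  have mem (e : ℝ) (he : e ^ 2 = 1) : !₂[e * (4 / 5), 0, 3 / 5] ∈ profileBody := by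
    have hn : ‖(!₂[e * (4 / 5), 0, 3 / 5] : E 3)‖ = 1 := by
      rw [norm_sq_eq_one_iff]
      simp [mul_pow, he]
      norm_num
    change ‖(!₂[e * (4 / 5), 0, 3 / 5] : E 3)‖ ^ 2 ≤
      profile ((3 / 5) / ‖(!₂[e * (4 / 5), 0, 3 / 5] : E 3)‖)
    rw [hn, div_one, h35]
    norm_num
  intro hconv
  have hmid := hconv (mem 1 (by norm_num)) (mem (-1) (by norm_num))
    (by norm_num : (0 : ℝ) ≤ 1 / 2) (by norm_num : (0 : ℝ) ≤ 1 / 2) (by norm_num)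
  have hu : ‖(EuclideanSpace.single 2 1 : E 3)‖ = 1 := by simp
  have heq : (1 / 2 : ℝ) • (!₂[1 * (4 / 5), 0, 3 / 5] : E 3) +
      (1 / 2 : ℝ) • !₂[-1 * (4 / 5), 0, 3 / 5] = (3 / 5 : ℝ) • EuclideanSpace.single 2 1 := by
    ext i
    fin_cases i <;> (simp; try norm_num)
  rw [heq, smul_mem_profileBody_iff hu (by norm_num), Real.le_sqrt (by norm_num)
    (profile_pos _).le] at hmid
  norm_num [h1] at hmid

lemma radialFn_cylinder_of_le {κ s : ℝ} (hκ : 0 < κ) {u : E 3} (hs0 : 0 ≤ s) (hs : s ≤ 3 / 5)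
    (hus : u 0 ^ 2 + u 1 ^ 2 = s ^ 2) (hu : ‖u‖ = 1) :
    radialFn {x : E 3 | (x 0) ^ 2 + (x 1) ^ 2 ≤ (κ * (3 / 5)) ^ 2 ∧ |x 2| ≤ κ * (4 / 5)} u =
      κ * ((4 / 5) / √(1 - s ^ 2)) := by
  rw [norm_sq_eq_one_iff, hus] at hu
  have h2 : √(1 - s ^ 2) = |u 2| := by rw [← Real.sqrt_sq_eq_abs, ← hu]; ring_nf
  have h3 : 4 / 5 ≤ |u 2| := by rw [← h2]; exact Real.le_sqrt_of_sq_le (by nlinarith)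
  have h4 : 0 < |u 2| := by linarith
  rw [h2, radialFn]
  refine (congrArg sSup (Set.ext fun c => ?_)).trans
    (csSup_Icc (a := 0) (b := κ * ((4 / 5) / |u 2|)) (by positivity))
  simp only [Set.mem_ofPred_eq, PiLp.smul_apply, smul_eq_mul, Set.mem_Icc]
  refine and_congr_right fun hc => ?_
  rw [← mul_div_assoc κ (4 / 5), le_div_iff₀ h4, abs_mul, abs_of_nonneg hc]
  refine ⟨fun h => h.2, fun h => ⟨?_, h⟩⟩
  have h5 : c ≤ κ := by nlinarith
  have h6 : c * s ≤ κ * (3 / 5) := mul_le_mul h5 hs hs0 hκ.le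
  calc (c * u 0) ^ 2 + (c * u 1) ^ 2 = (c * s) ^ 2 := by rw [mul_pow c s, ← hus]; ring
    _ ≤ _ := pow_le_pow_left₀ (by positivity) h6 2

lemma radialFn_cylinder_of_ge {κ s : ℝ} (hκ : 0 < κ) {u : E 3} (hs : 3 / 5 ≤ s)
    (hus : u 0 ^ 2 + u 1 ^ 2 = s ^ 2) (hu : ‖u‖ = 1) :
    radialFn {x : E 3 | (x 0) ^ 2 + (x 1) ^ 2 ≤ (κ * (3 / 5)) ^ 2 ∧ |x 2| ≤ κ * (4 / 5)} u =
      κ * ((3 / 5) / s) := by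
  rw [norm_sq_eq_one_iff, hus] at hu
  have h0 : 0 < s := by linarith
  have h3 : |u 2| ≤ 4 / 5 := abs_le_of_sq_le_sq (by nlinarith) (by norm_num)
  rw [radialFn]
  refine (congrArg sSup (Set.ext fun c => ?_)).trans
    (csSup_Icc (a := 0) (b := κ * ((3 / 5) / s)) (by positivity))
  simp only [Set.mem_ofPred_eq, PiLp.smul_apply, smul_eq_mul, Set.mem_Icc]
  refine and_congr_right fun hc => ?_
  rw [← mul_div_assoc κ (3 / 5), le_div_iff₀ h0, abs_mul, abs_of_nonneg hc,
    show (c * u 0) ^ 2 + (c * u 1) ^ 2 = (c * s) ^ 2 by rw [mul_pow c s, ← hus]; ring,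
    sq_le_sq₀ (by positivity) (by positivity)]
  refine ⟨fun h => h.1, fun h => ⟨h, ?_⟩⟩
  have h5 : c ≤ κ := by nlinarith
  exact mul_le_mul h5 h3 (abs_nonneg _) hκ.le

open Set in
lemma lintegral_indicator_sq_le {g : ℝ} (hg : 0 ≤ g) :
    ∫⁻ r in Ioi (0 : ℝ), ENNReal.ofReal r * {r : ℝ | r ^ 2 ≤ g}.indicator 1 r =
      ENNReal.ofReal (g / 2) := by
  have hm : MeasurableSet {r : ℝ | r ^ 2 ≤ g} :=
    (isClosed_le (by fun_prop) continuous_const).measurableSet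
  have h1 : ∀ r : ℝ, ENNReal.ofReal r * {r : ℝ | r ^ 2 ≤ g}.indicator 1 r =
      {r : ℝ | r ^ 2 ≤ g}.indicator (fun r => ENNReal.ofReal r) r := by
    intro r
    by_cases h : r ^ 2 ≤ g <;> simp [h]
  have h2 : Ioi (0 : ℝ) ∩ {r : ℝ | r ^ 2 ≤ g} = Ioc 0 √g := by
    ext r
    simp only [mem_inter_iff, mem_Ioi, mem_ofPred_eq, mem_Ioc]
    exact and_congr_right fun hr => (Real.le_sqrt hr.le hg).symm
  have h3 : 0 ≤ᵐ[volume.restrict (Ioc (0 : ℝ) √g)] fun r : ℝ => r :=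
    (ae_restrict_mem measurableSet_Ioc).mono fun r hr => hr.1.le
  simp_rw [h1]
  rw [setLIntegral_indicator hm, inter_comm, h2,
    ← ofReal_integral_eq_lintegral_ofReal
      (f := fun r : ℝ => r) continuous_id.integrableOn_Ioc h3,
    ← intervalIntegral.integral_of_le (Real.sqrt_nonneg g)]
  simp [Real.sq_sqrt hg]

open Set in
/-- The area enclosed by the polar curve `r² = G (sin θ)`. -/
lemma volume_setOf_sq_le {G : ℝ → ℝ} (hG : Continuous G) (hG0 : ∀ t, 0 ≤ G t) :
    volume {p : ℝ × ℝ | p.1 ^ 2 + p.2 ^ 2 ≤ G (p.2 / √(p.1 ^ 2 + p.2 ^ 2))} =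
      ENNReal.ofReal (∫ θ in (-Real.pi)..Real.pi, G (Real.sin θ) / 2) := by
  have hA : MeasurableSet {p : ℝ × ℝ | p.1 ^ 2 + p.2 ^ 2 ≤ G (p.2 / √(p.1 ^ 2 + p.2 ^ 2))} :=
    measurableSet_le (by fun_prop) (hG.measurable.comp (by fun_prop))
  have hB : MeasurableSet {p : ℝ × ℝ | p.1 ^ 2 ≤ G (Real.sin p.2)} :=
    (isClosed_le (by fun_prop) (by fun_prop)).measurableSet
  rw [← lintegral_indicator_one hA, ← lintegral_comp_polarCoord_symm]
  have h1 : ∀ p ∈ polarCoord.target, ENNReal.ofReal p.1 •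
      {p : ℝ × ℝ | p.1 ^ 2 + p.2 ^ 2 ≤ G (p.2 / √(p.1 ^ 2 + p.2 ^ 2))}.indicator
        (1 : ℝ × ℝ → ℝ≥0∞) (polarCoord.symm p) =
      ENNReal.ofReal p.1 * {r : ℝ | r ^ 2 ≤ G (Real.sin p.2)}.indicator 1 p.1 := by
    rintro ⟨r, θ⟩ ⟨hr, -⟩
    have hr : 0 < r := hr
    have h2 : (r * Real.cos θ) ^ 2 + (r * Real.sin θ) ^ 2 = r ^ 2 := by
      linear_combination r ^ 2 * Real.sin_sq_add_cos_sq θ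
    rw [smul_eq_mul]
    congr 1
    simp only [indicator, mem_ofPred_eq, polarCoord_symm_apply, h2, Real.sqrt_sq hr.le,
      mul_div_cancel_left₀ _ hr.ne', Pi.one_apply]
  rw [setLIntegral_congr_fun polarCoord.open_target.measurableSet h1, polarCoord_target,
    Measure.volume_eq_prod, setLIntegral_prod_symm]
  · simp_rw [lintegral_indicator_sq_le (hG0 _)]
    rw [intervalIntegral.integral_of_le (by linarith [Real.pi_pos]), integral_Ioc_eq_integral_Ioo,
      ofReal_integral_eq_lintegral_ofReal]
    · exact ((by fun_prop : Continuous fun θ => G (Real.sin θ) / 2).integrableOn_Icc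
        (a := -Real.pi) (b := Real.pi)).mono_set Ioo_subset_Icc_self
    · exact ae_of_all _ fun θ => div_nonneg (hG0 _) zero_le_two
  · refine Measurable.aemeasurable (Measurable.mul (by fun_prop) ?_)
    exact measurable_one.indicator hB

lemma volume_setOf_norm_sq_le {G : ℝ → ℝ} (hG : Continuous G) (hG0 : ∀ t, 0 ≤ G t) :
    volume {v : E 2 | ‖v‖ ^ 2 ≤ G (v 1 / ‖v‖)} =
      ENNReal.ofReal (∫ θ in (-Real.pi)..Real.pi, G (Real.sin θ) / 2) := by
  have hA : MeasurableSet {p : ℝ × ℝ | p.1 ^ 2 + p.2 ^ 2 ≤ G (p.2 / √(p.1 ^ 2 + p.2 ^ 2))} :=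
    measurableSet_le (by fun_prop) (hG.measurable.comp (by fun_prop))
  rw [← volume_setOf_sq_le hG hG0, ← ((volume_preserving_finTwoArrow ℝ).comp
    (PiLp.volume_preserving_ofLp (Fin 2))).measure_preimage hA.nullMeasurableSet]
  congr 1
  ext v
  simp [EuclideanSpace.norm_eq, Fin.sum_univ_two,
    Real.sq_sqrt (by positivity : (0 : ℝ) ≤ v 0 ^ 2 + v 1 ^ 2)]

/-- The Hausdorff measure of the Euclidean plane is a positive multiple of Lebesgue measure. -/
lemma exists_hausdorffMeasure_two_eq :
    ∃ c : ℝ, 0 < c ∧ ∀ A : Set (E 2), (μH[2] A).toReal = c * (volume A).toReal := by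
  have : (μH[2] : Measure (E 2)).IsAddHaarMeasure := by
    simpa using isAddHaarMeasure_hausdorffMeasure (E := E 2)
  refine ⟨(μH[2] : Measure (E 2)).addHaarScalarFactor volume,
    NNReal.coe_pos.2 (Measure.addHaarScalarFactor_pos_of_isAddHaarMeasure _ _), fun A => ?_⟩
  conv_lhs => rw [Measure.isAddLeftInvariant_eq_smul (μH[2] : Measure (E 2)) volume]
  simp

/-- A parametrization of the plane orthogonal to `(s * p, s * q, c)`, as a linear map. -/
def planeMap (p q s c : ℝ) (v : E 2) : E 3 :=
  !₂[-q * v 0 - c * p * v 1, p * v 0 - c * q * v 1, s * v 1]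

lemma norm_planeMap {p q s c : ℝ} (hpq : p ^ 2 + q ^ 2 = 1) (hsc : s ^ 2 + c ^ 2 = 1) (v : E 2) :
    ‖planeMap p q s c v‖ = ‖v‖ := by
  rw [EuclideanSpace.norm_eq, EuclideanSpace.norm_eq]
  congr 1
  simp only [planeMap, Fin.sum_univ_three, Fin.sum_univ_two, Real.norm_eq_abs, sq_abs]
  simp
  linear_combination (v 0 ^ 2 + c ^ 2 * v 1 ^ 2) * hpq + v 1 ^ 2 * hsc

lemma isometry_planeMap {p q s c : ℝ} (hpq : p ^ 2 + q ^ 2 = 1) (hsc : s ^ 2 + c ^ 2 = 1) :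
    Isometry (planeMap p q s c) := by
  refine Isometry.of_dist_eq fun v w => ?_
  rw [dist_eq_norm, dist_eq_norm, ← norm_planeMap hpq hsc]
  congr 1
  ext i
  fin_cases i <;> simp [planeMap] <;> ring

lemma range_planeMap {p q s c : ℝ} (hpq : p ^ 2 + q ^ 2 = 1) (hsc : s ^ 2 + c ^ 2 = 1) {u : E 3}
    (h0 : u 0 = s * p) (h1 : u 1 = s * q) (h2 : u 2 = c) :
    Set.range (planeMap p q s c) = hyperplane u := by
  ext x
  have hx : x ∈ hyperplane u ↔ s * p * x 0 + s * q * x 1 + c * x 2 = 0 := by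
    simp [hyperplane, PiLp.inner_apply, Fin.sum_univ_three, h0, h1, h2]
  rw [hx]
  constructor
  · rintro ⟨v, rfl⟩
    simp [planeMap]
    linear_combination (- s * c * v 1) * hpq
  · intro h
    refine ⟨!₂[-q * x 0 + p * x 1, -c * p * x 0 - c * q * x 1 + s * x 2], ?_⟩
    ext i
    fin_cases i <;> simp [planeMap]
    · grind
    · grind
    · grind

lemma exists_eq_mul_of_sq_add_sq (x y : ℝ) :
    ∃ p q s : ℝ, 0 ≤ s ∧ p ^ 2 + q ^ 2 = 1 ∧ x = s * p ∧ y = s * q := by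
  have hs2 : √(x ^ 2 + y ^ 2) ^ 2 = x ^ 2 + y ^ 2 := Real.sq_sqrt (by positivity)
  rcases (Real.sqrt_nonneg (x ^ 2 + y ^ 2)).eq_or_lt with h | h
  · rw [← h] at hs2
    exact ⟨1, 0, 0, le_rfl, by norm_num, by nlinarith, by nlinarith⟩
  · refine ⟨x / √(x ^ 2 + y ^ 2), y / √(x ^ 2 + y ^ 2), √(x ^ 2 + y ^ 2), h.le, ?_, ?_, ?_⟩
    · rw [div_pow, div_pow, hs2, ← add_div, div_self (hs2 ▸ by positivity)]
    · rw [mul_div_cancel₀ _ h.ne']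
    · rw [mul_div_cancel₀ _ h.ne']

lemma hausdorffMeasure_profileBody_inter_hyperplane {u : E 3} {p q s : ℝ}
    (hpq : p ^ 2 + q ^ 2 = 1) (h0 : u 0 = s * p) (h1 : u 1 = s * q) (hs : s ^ 2 + u 2 ^ 2 = 1) :
    μH[2] (profileBody ∩ hyperplane u) =
      μH[2] {v : E 2 | ‖v‖ ^ 2 ≤ profile (s * (v 1 / ‖v‖))} := by
  rw [← range_planeMap hpq hs h0 h1 rfl, ← Set.image_preimage_eq_inter_range,
    (isometry_planeMap hpq hs).hausdorffMeasure_image (Or.inl zero_le_two)]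
  congr 1
  ext v
  simp only [profileBody, Set.mem_preimage, Set.mem_ofPred_eq, norm_planeMap hpq hs]
  simp [planeMap, mul_div_assoc]

lemma volume_setOf_norm_sq_le_profile (s : ℝ) :
    (volume {v : E 2 | ‖v‖ ^ 2 ≤ profile (s * (v 1 / ‖v‖))}).toReal =
      2 * ∫ θ in (0 : ℝ)..(Real.pi / 2), profile (s * Real.cos θ) := by
  rw [volume_setOf_norm_sq_le (G := fun t => profile (s * t))
    (continuous_profile.comp (by fun_prop)) fun t => (profile_pos _).le,
    intervalIntegral.integral_div, integral_profile_mul_sin, ENNReal.toReal_ofReal]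
  · ring
  · have : 0 ≤ ∫ θ in (0 : ℝ)..(Real.pi / 2), profile (s * Real.cos θ) :=
      intervalIntegral.integral_nonneg (by positivity) fun θ _ => (profile_pos _).le
    positivity

/-- A centered circular cylinder in `ℝ³` is the intersection body of a nonconvex
centered star body. -/
theorem cylinder_is_intersection_body_of_nonconvex_star_body :
    ∃ (a h : ℝ), 0 < a ∧ 0 < h ∧
      ∃ M : Set (E 3), IsStarBody M ∧ IsCentered M ∧ ¬ Convex ℝ M ∧
        ∀ u ∈ sphere (0 : E 3) 1,
          radialFn {x : E 3 | (x 0) ^ 2 + (x 1) ^ 2 ≤ a ^ 2 ∧ |x 2| ≤ h} u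
            = (μH[2] (M ∩ hyperplane u)).toReal := by
  obtain ⟨c, hc, hμ⟩ := exists_hausdorffMeasure_two_eq
  have hκ : 0 < c * Real.pi := by positivity
  refine ⟨c * Real.pi * (3 / 5), c * Real.pi * (4 / 5), by positivity, by positivity,
    profileBody, isStarBody_profileBody, isCentered_profileBody, not_convex_profileBody,
    fun u hu => ?_⟩
  have hu : ‖u‖ = 1 := by simpa using hu
  obtain ⟨p, q, s, hs0, hpq, h0, h1⟩ := exists_eq_mul_of_sq_add_sq (u 0) (u 1)
  have hus : u 0 ^ 2 + u 1 ^ 2 = s ^ 2 := by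
    rw [h0, h1]; linear_combination s ^ 2 * hpq
  have hs : s ^ 2 + u 2 ^ 2 = 1 := by rw [← hus]; exact (norm_sq_eq_one_iff u).1 hu
  rw [hausdorffMeasure_profileBody_inter_hyperplane hpq h0 h1 hs, hμ,
    volume_setOf_norm_sq_le_profile]
  rcases le_or_gt s (3 / 5) with h | h
  · rw [radialFn_cylinder_of_le hκ hs0 h hus hu, integral_profile_of_le hs0 h]
    ring
  · rw [radialFn_cylinder_of_ge hκ h.le hus hu, integral_profile_of_ge h (by nlinarith)]
    ring
end
end

section
/- (Petty; Schneider: the dual Busemann–Petty problem for projections has a negative answer.) For every n ≥ 3 there exist centered convex bodies K₁ and K₂ in ℝⁿ such that λ_{n−1}(P_{u^⊥}(K₁)) ≤ λ_{n−1}(P_{u^⊥}(K₂)) for every u ∈ S^{n−1}, where P_{u^⊥} denotes orthogonal projection onto the hyperplane u^⊥, and yet λ_n(K₁) > λ_n(K₂). -/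
open MeasureTheory Metric
open scoped RealInnerProductSpace ENNReal

noncomputable section

/-! ### Prisms over a flat piece -/

/-- For `S ⊆ {a = b}`, the prism `S + [0, 1) • u`, described through the projection of `y` along `u`
onto the hyperplane `{a = b}`. -/
def prism {n : ℕ} (a : E n →ₗ[ℝ] ℝ) (b : ℝ) (u : E n) (S : Set (E n)) : Set (E n) :=
  {y | y - ((a y - b) / a u) • u ∈ S ∧ b ≤ a y ∧ a y < b + a u}

lemma prism_mono {n : ℕ} (a : E n →ₗ[ℝ] ℝ) (b : ℝ) (u : E n) {S T : Set (E n)} (h : S ⊆ T) :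
    prism a b u S ⊆ prism a b u T := fun _ hy => ⟨h hy.1, hy.2⟩

lemma prism_smul_smul {n : ℕ} (a : E n →ₗ[ℝ] ℝ) (b : ℝ) (u : E n) (S : Set (E n)) {r : ℝ}
    (hr : 0 < r) : prism (r • a) (r * b) u S = prism a b u S := by
  ext y
  have h1 : (r * a y - r * b) / (r * a u) = (a y - b) / a u := by
    rw [← mul_sub, mul_div_mul_left _ _ hr.ne']
  simp only [prism, Set.mem_ofPred_eq, LinearMap.smul_apply, smul_eq_mul, h1, ← mul_add,
    mul_le_mul_iff_right₀ hr, mul_lt_mul_iff_right₀ hr]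

lemma volume_prism_affine {n : ℕ} (L : E n →ₗ[ℝ] E n) (hL : LinearMap.det L ≠ 0) (x₀ : E n)
    (a : E n →ₗ[ℝ] ℝ) (b : ℝ) (u : E n) (S : Set (E n)) :
    volume (prism (a ∘ₗ L) (b - a x₀) u {y | L y + x₀ ∈ S})
      = ENNReal.ofReal |(LinearMap.det L)⁻¹| * volume (prism a b (L u) S) := by
  rw [← measure_preimage_add_right volume x₀ (prism a b (L u) S),
    ← Measure.addHaar_preimage_linearMap volume hL]
  congr 1
  ext y
  have h1 : L (y - ((a (L y) - (b - a x₀)) / a (L u)) • u) + x₀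
      = L y + x₀ - ((a (L y + x₀) - b) / a (L u)) • L u := by
    rw [map_sub, map_smul, map_add]
    have : a (L y) - (b - a x₀) = a (L y) + a x₀ - b := by ring
    rw [this]; abel
  simp only [prism, Set.mem_ofPred_eq, LinearMap.comp_apply, Set.mem_preimage, h1]
  rw [map_add]
  constructor <;> rintro ⟨h, h2, h3⟩ <;> exact ⟨h, by linarith, by linarith⟩

lemma volume_prism_direction {n : ℕ} (a : E n →ₗ[ℝ] ℝ) (b : ℝ) {u w : E n} (hu : 0 < a u)
    (hw : 0 < a w) (S : Set (E n)) :
    volume (prism a b u S) = ENNReal.ofReal (a u / a w) * volume (prism a b w S) := by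
  set f : Module.Dual ℝ (E n) := (a w)⁻¹ • a with hf
  set L := LinearMap.transvection f (u - w) with hL
  have hLy : ∀ y, L y = y + (a y / a w) • (u - w) := fun y => by
    simp [hL, hf, LinearMap.transvection.apply, div_eq_inv_mul]
  have hdet : LinearMap.det L = a u / a w := by
    rw [hL, LinearMap.transvection.det]
    simp only [hf, LinearMap.smul_apply, map_sub, smul_eq_mul]
    field_simp; ring
  have hpos : 0 < a u / a w := div_pos hu hw
  have hLw : L w = u := by rw [hLy, div_self hw.ne']; simp
  have haL : a ∘ₗ L = (a u / a w) • a := by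
    ext y
    simp only [LinearMap.comp_apply, hLy, map_add, map_smul, map_sub, LinearMap.smul_apply,
      smul_eq_mul]
    field_simp; ring
  have key := volume_prism_affine L (hdet ▸ hpos.ne') (-(b / a w) • (u - w)) a b w S
  have hb : b - a (-(b / a w) • (u - w)) = (a u / a w) * b := by
    simp only [map_smul, map_sub, smul_eq_mul]
    field_simp; ring
  rw [hb, haL, prism_smul_smul _ _ _ _ hpos, hLw, hdet, abs_of_pos (inv_pos.2 hpos)] at key
  have hS : prism a b w {y | L y + -(b / a w) • (u - w) ∈ S} = prism a b w S := by
    ext y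
    have h1 : a (y - ((a y - b) / a w) • w) = b := by
      rw [map_sub, map_smul, smul_eq_mul]; field_simp; ring
    simp only [prism, Set.mem_ofPred_eq, hLy, h1]
    rw [add_assoc, ← add_smul, add_neg_cancel, zero_smul, add_zero]
  rw [hS] at key
  rw [key, ← mul_assoc, ← ENNReal.ofReal_mul hpos.le, mul_inv_cancel₀ hpos.ne',
    ENNReal.ofReal_one, one_mul]

lemma volume_prism_homothety {n : ℕ} (hn : n ≠ 0) (a : E n →ₗ[ℝ] ℝ) (b : ℝ) {u : E n}
    (hu : 0 < a u) {c : ℝ} (hc : 0 < c) (x₀ : E n) (S : Set (E n)) :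
    volume (prism a (c * b + a x₀) u S)
      = ENNReal.ofReal (c ^ (n - 1)) * volume (prism a b u {y | c • y + x₀ ∈ S}) := by
  have hdet : LinearMap.det (c • (LinearMap.id : E n →ₗ[ℝ] E n)) = c ^ n := by
    simp [LinearMap.det_smul]
  have hcn : 0 < c ^ n := pow_pos hc n
  have key := volume_prism_affine (c • LinearMap.id) (hdet ▸ hcn.ne') x₀ a (c * b + a x₀)
    (c⁻¹ • u) S
  have h1 : a ∘ₗ (c • LinearMap.id) = c • a := by ext; simp
  have h2 : 0 < a (c⁻¹ • u) := by rw [map_smul]; exact mul_pos (inv_pos.2 hc) hu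
  rw [hdet, h1, add_sub_cancel_right, prism_smul_smul _ _ _ _ hc,
    volume_prism_direction a b h2 hu, abs_of_pos (inv_pos.2 hcn)] at key
  have h3 : (c • (LinearMap.id : E n →ₗ[ℝ] E n)) (c⁻¹ • u) = u := by
    simp [smul_smul, hc.ne']
  have h4 : a (c⁻¹ • u) / a u = c⁻¹ := by
    rw [map_smul, smul_eq_mul]; field_simp
  rw [h3, h4] at key
  have h5 : ENNReal.ofReal (c ^ (n - 1)) = ENNReal.ofReal (c ^ n) * ENNReal.ofReal c⁻¹ := by
    rw [← ENNReal.ofReal_mul hcn.le]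
    obtain ⟨m, rfl⟩ := Nat.exists_eq_succ_of_ne_zero hn
    congr 1
    simp only [Nat.succ_eq_add_one, add_tsub_cancel_right, pow_succ]
    field_simp
  rw [h5, mul_assoc]
  simp only [LinearMap.smul_apply, LinearMap.id_apply] at key
  rw [key, ← mul_assoc, ← ENNReal.ofReal_mul hcn.le, mul_inv_cancel₀ hcn.ne',
    ENNReal.ofReal_one, one_mul]

lemma measurableSet_prism {n : ℕ} (a : E n →ₗ[ℝ] ℝ) (b : ℝ) (u : E n) {S : Set (E n)}
    (hS : MeasurableSet S) : MeasurableSet (prism a b u S) := by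
  have ha : Continuous a := a.continuous_of_finiteDimensional
  have h1 : Continuous fun y => y - ((a y - b) / a u) • u := by fun_prop
  exact (h1.measurable hS).inter
    ((measurableSet_le measurable_const ha.measurable).inter
      (measurableSet_lt ha.measurable measurable_const))

/-! ### Shadows -/

/-- The part of the cylinder `S + ℝ • u` between the hyperplanes `⟪y, u⟫ = 0` and `⟪y, u⟫ = 1`. -/
def slabCylinder {n : ℕ} (u : E n) (S : Set (E n)) : Set (E n) :=
  {y | (∃ x ∈ S, ∃ t : ℝ, y = x + t • u) ∧ 0 ≤ ⟪y, u⟫ ∧ ⟪y, u⟫ < 1}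

lemma volume_slabCylinder_of_flat {n : ℕ} {u : E n} (hu1 : ‖u‖ = 1) (a : E n →ₗ[ℝ] ℝ) (b : ℝ)
    (hu : 0 < a u) {S : Set (E n)} (hS : ∀ x ∈ S, a x = b) :
    volume (slabCylinder u S) = volume (prism a b u S) := by
  have huu : ⟪u, u⟫ = 1 := by rw [real_inner_self_eq_norm_sq, hu1, one_pow]
  set f : Module.Dual ℝ (E n) := (a u)⁻¹ • a - (innerₛₗ ℝ u : E n →ₗ[ℝ] ℝ) with hf
  set L := LinearMap.transvection f u with hL
  have hfy : ∀ y, f y = a y / a u - ⟪y, u⟫ := fun y => by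
    simp [hf, div_eq_inv_mul, real_inner_comm]
  have hdet : LinearMap.det L = 1 := by
    rw [hL, LinearMap.transvection.det, hfy, huu, div_self hu.ne']; simp
  have key : prism a b u S = L ⁻¹' ((fun y => y + (-(b / a u)) • u) ⁻¹' slabCylinder u S) := by
    ext y
    have e1 : L y + (-(b / a u)) • u = y + ((a y - b) / a u - ⟪y, u⟫) • u := by
      rw [hL, LinearMap.transvection.apply, hfy, add_assoc, ← add_smul]
      congr 2; ring
    have e2 : ⟪y + ((a y - b) / a u - ⟪y, u⟫) • u, u⟫ = (a y - b) / a u := by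
      rw [inner_add_left, real_inner_smul_left, huu]; ring
    simp only [Set.mem_preimage, e1, prism, slabCylinder, Set.mem_ofPred_eq, e2]
    refine and_congr ⟨fun h => ⟨_, h, (a y - b) / a u + ((a y - b) / a u - ⟪y, u⟫), ?_⟩, ?_⟩
      (and_congr ?_ ?_)
    · rw [add_smul]; abel
    · rintro ⟨x, hx, t, hxt⟩
      have hy : y = x + (t - ((a y - b) / a u - ⟪y, u⟫)) • u := by
        rw [sub_smul, ← add_sub_assoc, ← hxt]; abel
      generalize t - ((a y - b) / a u - ⟪y, u⟫) = s at hy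
      subst hy
      have : a (x + s • u) - b = s * a u := by rw [map_add, map_smul, hS x hx, smul_eq_mul]; ring
      rw [this, mul_div_cancel_right₀ _ hu.ne']
      simpa using hx
    · rw [le_div_iff₀ hu]; constructor <;> intro h <;> linarith
    · rw [div_lt_iff₀ hu]; constructor <;> intro h <;> linarith
  rw [key, Measure.addHaar_preimage_linearMap volume (by rw [hdet]; exact one_ne_zero), hdet,
    measure_preimage_add_right]
  simp

/-- The area of the orthogonal projection is proportional to the volume of a cylinder. -/
lemma exists_hausdorff_projection_eq {n : ℕ} {u : E n} (hu : ‖u‖ = 1) :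
    ∃ k : ℝ≥0∞, ∀ S : Set (E n),
      μH[(n : ℝ) - 1] ((fun x : E n => x - ⟪x, u⟫ • u) '' S) = k * volume (slabCylinder u S) := by
  have huu : ⟪u, u⟫ = 1 := by rw [real_inner_self_eq_norm_sq, hu, one_pow]
  have hn : n ≠ 0 := by
    rintro rfl
    have : u = 0 := Subsingleton.elim _ _
    simp [this] at hu
  let V : Submodule ℝ (E n) := (Submodule.span ℝ {u})ᗮ
  have memV : ∀ v : E n, v ∈ V ↔ ⟪v, u⟫ = 0 := fun v => by
    rw [Submodule.mem_orthogonal_singleton_iff_inner_left]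
  have hfin : (Module.finrank ℝ V : ℝ) = (n : ℝ) - 1 := by
    have h1 := Submodule.finrank_add_finrank_orthogonal (Submodule.span ℝ {u})
    rw [finrank_span_singleton (by rintro rfl; simp at hu), finrank_euclideanSpace_fin] at h1
    have h2 : (1 : ℝ) + (Module.finrank ℝ V : ℝ) = n := by exact_mod_cast h1
    linarith
  let μ : Measure V := μH[Module.finrank ℝ V]
  let Φ : (V × ℝ) ≃ₗ[ℝ] E n :=
    { toFun := fun p => (p.1 : E n) + p.2 • u
      map_add' := fun p q => by simp [add_smul]; abel
      map_smul' := fun r p => by simp [smul_smul]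
      invFun := fun y => (⟨y - ⟪y, u⟫ • u, (memV _).2 (by
        rw [inner_sub_left, real_inner_smul_left, huu]; ring)⟩, ⟪y, u⟫)
      left_inv := fun p => by
        have h : ⟪(p.1 : E n), u⟫ = 0 := (memV _).1 p.1.2
        have : ⟪(p.1 : E n) + p.2 • u, u⟫ = p.2 := by
          rw [inner_add_left, real_inner_smul_left, huu, h]; ring
        ext
        · simp [this]
        · simp [this]
      right_inv := fun y => by simp }
  let Ψ : (V × ℝ) ≃L[ℝ] E n := Φ.toContinuousLinearEquiv
  have hΨ : ∀ p, Ψ p = (p.1 : E n) + p.2 • u := fun p => rfl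
  let ν : Measure (E n) := Measure.map Ψ (μ.prod volume)
  have : ν.IsAddHaarMeasure := Ψ.isAddHaarMeasure_map _
  refine ⟨Measure.addHaarScalarFactor ν volume, fun S => ?_⟩
  have hν := Measure.isAddLeftInvariant_eq_smul ν volume
  let A : Set V := {v | ∃ x ∈ S, (v : E n) = x - ⟪x, u⟫ • u}
  have hA : (fun x : E n => x - ⟪x, u⟫ • u) '' S = Subtype.val '' A := by
    ext y
    constructor
    · rintro ⟨x, hx, rfl⟩
      exact ⟨⟨x - ⟪x, u⟫ • u, (memV _).2 (by
        rw [inner_sub_left, real_inner_smul_left, huu]; ring)⟩, ⟨x, hx, rfl⟩, rfl⟩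
    · rintro ⟨v, ⟨x, hx, h⟩, rfl⟩
      exact ⟨x, hx, h.symm⟩
  have hpre : Ψ ⁻¹' slabCylinder u S = A ×ˢ Set.Ico (0 : ℝ) 1 := by
    ext p
    have h : ⟪(p.1 : E n), u⟫ = 0 := (memV _).1 p.1.2
    have h2 : ⟪(p.1 : E n) + p.2 • u, u⟫ = p.2 := by
      rw [inner_add_left, real_inner_smul_left, huu, h]; ring
    simp only [Set.mem_preimage, hΨ, slabCylinder, Set.mem_ofPred_eq, h2, Set.mem_prod, Set.mem_Ico,
      A]
    refine and_congr_left fun _ => exists_congr fun x => and_congr_right fun _ => ?_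
    constructor
    · rintro ⟨t, ht⟩
      have h3 : ⟪x, u⟫ + t = p.2 := by
        rw [← h2, ht, inner_add_left, real_inner_smul_left, huu]; ring
      rw [eq_sub_iff_add_eq, ← add_right_cancel_iff (a := t • u), add_assoc, ← add_smul, h3, ht]
    · intro h3
      exact ⟨p.2 - ⟪x, u⟫, by rw [h3, sub_smul]; abel⟩
  have h1 : ν (slabCylinder u S) = μ A := by
    have : ν (slabCylinder u S) = (μ.prod volume) (Ψ ⁻¹' slabCylinder u S) :=
      Ψ.toHomeomorph.toMeasurableEquiv.map_apply _
    rw [this, hpre, Measure.prod_prod]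
    simp
  rw [hA, ← hfin, isometry_subtype_coe.hausdorffMeasure_image (Or.inl (by positivity))]
  change μ A = _
  rw [← h1]
  exact DFunLike.congr_fun hν (slabCylinder u S)

/-! ### Sign vectors -/

/-- The linear form `x ↦ ∑ j, ε j * x j` of a sign vector `ε`. -/
def signForm {n : ℕ} (ε : Fin n → ℤˣ) : E n →ₗ[ℝ] ℝ where
  toFun x := ∑ j, ((ε j : ℤ) : ℝ) * x j
  map_add' x y := by simp [mul_add, Finset.sum_add_distrib]
  map_smul' r x := by simp [Finset.mul_sum, mul_left_comm]

lemma signForm_apply {n : ℕ} (ε : Fin n → ℤˣ) (x : E n) :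
    signForm ε x = ∑ j, ((ε j : ℤ) : ℝ) * x j := rfl

lemma unit_sign_mul_self (δ : ℤˣ) : ((δ : ℤ) : ℝ) * ((δ : ℤ) : ℝ) = 1 := by
  rcases Int.units_eq_one_or δ with rfl | rfl <;> simp

lemma abs_sign (δ : ℤˣ) : |((δ : ℤ) : ℝ)| = 1 := by
  rcases Int.units_eq_one_or δ with rfl | rfl <;> simp

lemma sign_eq_or_eq_neg (δ η : ℤˣ) : δ = η ∨ δ = -η := by
  rcases Int.units_eq_one_or δ with rfl | rfl <;> rcases Int.units_eq_one_or η with rfl | rfl <;>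
    simp

lemma sign_mul_le_abs (δ : ℤˣ) (r : ℝ) : ((δ : ℤ) : ℝ) * r ≤ |r| := by
  have := le_abs_self (((δ : ℤ) : ℝ) * r)
  rwa [abs_mul, abs_sign, one_mul] at this

lemma signForm_neg {n : ℕ} (ε : Fin n → ℤˣ) (x : E n) : signForm (-ε) x = -signForm ε x := by
  simp [signForm_apply]

lemma signForm_single {n : ℕ} (ε : Fin n → ℤˣ) (i : Fin n) (r : ℝ) :
    signForm ε (EuclideanSpace.single i r) = ((ε i : ℤ) : ℝ) * r := by
  simp [signForm_apply]

/-- Reverse the `i`-th sign. -/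
def flipSign {n : ℕ} (i : Fin n) (ε : Fin n → ℤˣ) : Fin n → ℤˣ := Function.update ε i (-ε i)

lemma flipSign_same {n : ℕ} (i : Fin n) (ε : Fin n → ℤˣ) : flipSign i ε i = -ε i := by
  simp [flipSign]

lemma flipSign_of_ne {n : ℕ} {i j : Fin n} (h : j ≠ i) (ε : Fin n → ℤˣ) :
    flipSign i ε j = ε j := by
  simp [flipSign, h]

lemma flipSign_involutive {n : ℕ} (i : Fin n) :
    Function.Involutive (flipSign i : (Fin n → ℤˣ) → _) := fun ε => by simp [flipSign]

lemma signForm_flipSign {n : ℕ} (i : Fin n) (ε : Fin n → ℤˣ) (x : E n) :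
    signForm (flipSign i ε) x = signForm ε x - 2 * (((ε i : ℤ) : ℝ) * x i) := by
  rw [signForm_apply, signForm_apply, ← Finset.add_sum_erase _ _ (Finset.mem_univ i),
    ← Finset.add_sum_erase _ (fun j => ((ε j : ℤ) : ℝ) * x j) (Finset.mem_univ i), flipSign_same]
  have : ∑ j ∈ Finset.univ.erase i, ((flipSign i ε j : ℤ) : ℝ) * x j
      = ∑ j ∈ Finset.univ.erase i, ((ε j : ℤ) : ℝ) * x j :=
    Finset.sum_congr rfl fun j hj => by rw [flipSign_of_ne (Finset.ne_of_mem_erase hj)]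
  rw [this]; push_cast; ring

lemma exists_signForm_eq {n : ℕ} (x : E n) : ∃ ε : Fin n → ℤˣ, signForm ε x = ∑ j, |x j| := by
  refine ⟨fun j => if 0 ≤ x j then 1 else -1, ?_⟩
  rw [signForm_apply]
  refine Finset.sum_congr rfl fun j _ => ?_
  by_cases h : 0 ≤ x j
  · simp [h, abs_of_nonneg h]
  · simp [h, abs_of_neg (not_le.1 h)]

lemma exists_signForm_pos {n : ℕ} {u : E n} (hu : u ≠ 0) : ∃ ε : Fin n → ℤˣ, 0 < signForm ε u := by
  obtain ⟨ε, hε⟩ := exists_signForm_eq u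
  obtain ⟨i, hi⟩ : ∃ i, u i ≠ 0 := by
    by_contra! h
    exact hu (by ext i; simp [h i])
  refine ⟨ε, hε ▸ Finset.sum_pos' (fun _ _ => abs_nonneg _) ⟨i, Finset.mem_univ _, abs_pos.2 hi⟩⟩

lemma sum_flipSign {n : ℕ} (i : Fin n) (g : (Fin n → ℤˣ) → ℝ) :
    ∑ ε, g (flipSign i ε) = ∑ ε, g ε :=
  Equiv.sum_comp (flipSign_involutive i).toPerm g

lemma card_signs (n : ℕ) : Fintype.card (Fin n → ℤˣ) = 2 ^ n := by simp

lemma two_pow_mul_abs_le {n : ℕ} (u : E n) (i : Fin n) :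
    2 ^ n * |u i| ≤ ∑ ε : Fin n → ℤˣ, |signForm ε u| := by
  have h : ∑ ε : Fin n → ℤˣ, (|signForm ε u| + |signForm (flipSign i ε) u|)
      = 2 * ∑ ε : Fin n → ℤˣ, |signForm ε u| := by
    rw [Finset.sum_add_distrib, sum_flipSign i fun ε => |signForm ε u|, two_mul]
  have h2 : ∑ _ε : Fin n → ℤˣ, 2 * |u i|
      ≤ ∑ ε : Fin n → ℤˣ, (|signForm ε u| + |signForm (flipSign i ε) u|) := by
    refine Finset.sum_le_sum fun ε _ => ?_
    rw [signForm_flipSign]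
    have := abs_sub (signForm ε u) (signForm ε u - 2 * (((ε i : ℤ) : ℝ) * u i))
    rwa [sub_sub_cancel, abs_mul, abs_mul, abs_sign, one_mul, abs_two] at this
  rw [h, Finset.sum_const, Finset.card_univ, card_signs, nsmul_eq_mul] at h2
  push_cast at h2
  linarith

lemma abs_triple_le (s a b c : ℝ) :
    4 * (|a| + |b| + |c|) ≤ |s| + |s - 2 * a| + |s - 2 * b| + |s - 2 * c| + |s - 2 * a - 2 * b|
      + |s - 2 * a - 2 * c| + |s - 2 * b - 2 * c| + |s - 2 * a - 2 * b - 2 * c| := by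
  have h1 := abs_sub s (s - 2 * a - 2 * b - 2 * c)
  have h2 := abs_sub (s - 2 * a) (s - 2 * b - 2 * c)
  have h3 := abs_sub (s - 2 * b) (s - 2 * a - 2 * c)
  have h4 := abs_sub (s - 2 * c) (s - 2 * a - 2 * b)
  have k1 : 2 * (|a| + |b| + |c|) ≤ |a + b + c| + |b + c - a| + |a + c - b| + |a + b - c| := by
    rcases abs_cases a with ⟨e1, _⟩ | ⟨e1, _⟩ <;> rcases abs_cases b with ⟨e2, _⟩ | ⟨e2, _⟩ <;>
    rcases abs_cases c with ⟨e3, _⟩ | ⟨e3, _⟩ <;> rw [e1, e2, e3] <;>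
    linarith [le_abs_self (a + b + c), le_abs_self (b + c - a), le_abs_self (a + c - b),
      le_abs_self (a + b - c), neg_le_abs (a + b + c), neg_le_abs (b + c - a),
      neg_le_abs (a + c - b), neg_le_abs (a + b - c)]
  have e1 : s - (s - 2 * a - 2 * b - 2 * c) = 2 * (a + b + c) := by ring
  have e2 : s - 2 * a - (s - 2 * b - 2 * c) = 2 * (b + c - a) := by ring
  have e3 : s - 2 * b - (s - 2 * a - 2 * c) = 2 * (a + c - b) := by ring
  have e4 : s - 2 * c - (s - 2 * a - 2 * b) = 2 * (a + b - c) := by ring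
  rw [e1, abs_mul, abs_two] at h1
  rw [e2, abs_mul, abs_two] at h2
  rw [e3, abs_mul, abs_two] at h3
  rw [e4, abs_mul, abs_two] at h4
  linarith

lemma two_pow_mul_triple_le {n : ℕ} (u : E n) {i j k : Fin n} (hij : i ≠ j) (hik : i ≠ k)
    (hjk : j ≠ k) :
    2 ^ n * (|u i| + |u j| + |u k|) ≤ 2 * ∑ ε : Fin n → ℤˣ, |signForm ε u| := by
  set g : (Fin n → ℤˣ) → ℝ := fun ε => |signForm ε u| with hg
  have h : ∑ ε : Fin n → ℤˣ, 4 * (|u i| + |u j| + |u k|) ≤ ∑ ε : Fin n → ℤˣ,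
      (g ε + g (flipSign i ε) + g (flipSign j ε) + g (flipSign k ε) + g (flipSign j (flipSign i ε))
        + g (flipSign k (flipSign i ε)) + g (flipSign k (flipSign j ε))
        + g (flipSign k (flipSign j (flipSign i ε)))) := by
    refine Finset.sum_le_sum fun ε _ => ?_
    have := abs_triple_le (signForm ε u) (((ε i : ℤ) : ℝ) * u i) (((ε j : ℤ) : ℝ) * u j)
      (((ε k : ℤ) : ℝ) * u k)
    simp only [abs_mul (((ε _ : ℤˣ) : ℤ) : ℝ), abs_sign, one_mul] at this
    simpa only [hg, signForm_flipSign, flipSign_of_ne hij.symm, flipSign_of_ne hik.symm,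
      flipSign_of_ne hjk.symm] using this
  simp only [Finset.sum_add_distrib] at h
  rw [sum_flipSign k fun ε => g ε, sum_flipSign j fun ε => g ε, sum_flipSign i fun ε => g ε,
    sum_flipSign i fun ε => g (flipSign j ε), sum_flipSign j fun ε => g ε,
    sum_flipSign i fun ε => g (flipSign k ε), sum_flipSign k fun ε => g ε,
    sum_flipSign j fun ε => g (flipSign k ε), sum_flipSign k fun ε => g ε,
    sum_flipSign i fun ε => g (flipSign k (flipSign j ε)),
    sum_flipSign j fun ε => g (flipSign k ε), sum_flipSign k fun ε => g ε,
    Finset.sum_const, Finset.card_univ, card_signs, nsmul_eq_mul] at h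
  push_cast at h
  linarith

lemma two_pow_mul_sum_abs_le {n : ℕ} (hn : 3 ≤ n) (u : E n) :
    2 ^ n * ∑ i, |u i| ≤ (n - 1) * ∑ ε : Fin n → ℤˣ, |signForm ε u| := by
  obtain ⟨m, rfl⟩ := Nat.exists_eq_add_of_le' hn
  have h3 := two_pow_mul_triple_le u (i := 0) (j := Fin.succ 0) (k := Fin.succ (Fin.succ 0))
    (Fin.succ_ne_zero _).symm (Fin.succ_ne_zero _).symm
    ((Fin.succ_injective _).ne (Fin.succ_ne_zero _).symm)
  have h1 : ∑ i : Fin m, 2 ^ (m + 3) * |u i.succ.succ.succ|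
      ≤ ∑ _i : Fin m, ∑ ε : Fin (m + 3) → ℤˣ, |signForm ε u| :=
    Finset.sum_le_sum fun i _ => two_pow_mul_abs_le u _
  rw [← Finset.mul_sum, Finset.sum_const, Finset.card_univ, Fintype.card_fin, nsmul_eq_mul] at h1
  rw [Fin.sum_univ_succ, Fin.sum_univ_succ, Fin.sum_univ_succ]
  push_cast
  linarith

lemma sum_max_signForm {n : ℕ} (u : E n) :
    2 * ∑ ε : Fin n → ℤˣ, max (signForm ε u) 0 = ∑ ε : Fin n → ℤˣ, |signForm ε u| := by
  have h : ∑ ε : Fin n → ℤˣ, max (signForm (-ε) u) 0 = ∑ ε : Fin n → ℤˣ, max (signForm ε u) 0 :=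
    Equiv.sum_comp (Equiv.neg (Fin n → ℤˣ)) fun ε => max (signForm ε u) 0
  rw [two_mul]
  nth_rw 2 [← h]
  rw [← Finset.sum_add_distrib]
  refine Finset.sum_congr rfl fun ε _ => ?_
  rw [signForm_neg]
  rcases le_total 0 (signForm ε u) with h0 | h0
  · rw [max_eq_left h0, max_eq_right (by linarith), abs_of_nonneg h0, add_zero]
  · rw [max_eq_right h0, max_eq_left (by linarith), abs_of_nonpos h0, zero_add]

/-- The total mass of the visible facets, up to a constant factor. -/
def visibleMass {n : ℕ} (u : E n) : ℝ≥0∞ := ∑ ε : Fin n → ℤˣ, ENNReal.ofReal (signForm ε u)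

lemma visibleMass_eq {n : ℕ} (u : E n) :
    visibleMass u = ENNReal.ofReal (∑ ε : Fin n → ℤˣ, max (signForm ε u) 0) := by
  rw [visibleMass, ENNReal.ofReal_sum_of_nonneg fun _ _ => le_max_right _ _]
  refine Finset.sum_congr rfl fun ε _ => ?_
  rcases le_total 0 (signForm ε u) with h0 | h0
  · rw [max_eq_left h0]
  · rw [max_eq_right h0, ENNReal.ofReal_of_nonpos h0, ENNReal.ofReal_zero]

lemma visibleMass_single {n : ℕ} (hn : n ≠ 0) (i : Fin n) (δ : ℤˣ) :
    visibleMass (EuclideanSpace.single i ((δ : ℤ) : ℝ)) = ENNReal.ofReal (2 ^ (n - 1)) := by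
  rw [visibleMass_eq]
  congr 1
  have h := sum_max_signForm (EuclideanSpace.single i ((δ : ℤ) : ℝ))
  simp only [signForm_single, abs_mul, abs_sign, Finset.sum_const, Finset.card_univ,
    card_signs, nsmul_eq_mul, mul_one] at h ⊢
  obtain ⟨m, rfl⟩ := Nat.exists_eq_succ_of_ne_zero hn
  simp only [Nat.succ_eq_add_one, add_tsub_cancel_right]
  push_cast [pow_succ] at h
  linarith

lemma sum_caps_le_visibleMass {n : ℕ} (hn : 3 ≤ n) (u : E n) :
    ∑ p : Fin n × ℤˣ, ENNReal.ofReal (((p.2 : ℤ) : ℝ) * u p.1) * ENNReal.ofReal (2 ^ (n - 1))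
      ≤ ((n - 1 : ℕ) : ℝ≥0∞) * visibleMass u := by
  have h1 : ∑ p : Fin n × ℤˣ, ENNReal.ofReal (((p.2 : ℤ) : ℝ) * u p.1)
      = ENNReal.ofReal (∑ i, |u i|) := by
    rw [ENNReal.ofReal_sum_of_nonneg fun _ _ => abs_nonneg _, Fintype.sum_prod_type]
    refine Finset.sum_congr rfl fun i _ => ?_
    have : (Finset.univ : Finset ℤˣ) = {1, -1} := rfl
    rw [this, Finset.sum_pair (by decide)]
    rcases le_total 0 (u i) with h0 | h0
    · simp [h0, abs_of_nonneg h0]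
    · simp [h0, abs_of_nonpos h0]
  rw [← Finset.sum_mul, h1, visibleMass_eq, ← ENNReal.ofReal_natCast, ← ENNReal.ofReal_mul
    (Finset.sum_nonneg fun _ _ => abs_nonneg _), ← ENNReal.ofReal_mul (Nat.cast_nonneg _)]
  apply ENNReal.ofReal_le_ofReal
  have h2 := two_pow_mul_sum_abs_le hn u
  rw [← sum_max_signForm] at h2
  obtain ⟨m, rfl⟩ := Nat.exists_eq_add_of_le' (by omega : 1 ≤ n)
  simp only [add_tsub_cancel_right]
  push_cast [pow_succ] at h2 ⊢
  linarith

/-! ### Facets of the cross-polytope -/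

/-- The facet of the cross-polytope of radius `r` in the orthant of `ε`. -/
def facet {n : ℕ} (r : ℝ) (ε : Fin n → ℤˣ) : Set (E n) :=
  {x | signForm ε x = r ∧ ∀ j, 0 ≤ ((ε j : ℤ) : ℝ) * x j}

/-- The relative interior of the facet of the unit cross-polytope in the orthant of `ε`. -/
def openFacet {n : ℕ} (ε : Fin n → ℤˣ) : Set (E n) :=
  {x | signForm ε x = 1 ∧ ∀ j, 0 < ((ε j : ℤ) : ℝ) * x j}

/-- The part of a facet where no coordinate exceeds `b`. -/
def truncFacet {n : ℕ} (s b : ℝ) (ε : Fin n → ℤˣ) : Set (E n) :=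
  {x | x ∈ facet s ε ∧ ∀ j, ((ε j : ℤ) : ℝ) * x j ≤ b}

/-- The relatively open part of a facet where the `j`-th coordinate exceeds `b`. -/
def corner {n : ℕ} (s b : ℝ) (ε : Fin n → ℤˣ) (j : Fin n) : Set (E n) :=
  {x | signForm ε x = s ∧ (∀ k ≠ j, 0 < ((ε k : ℤ) : ℝ) * x k) ∧ b < ((ε j : ℤ) : ℝ) * x j}

/-- The reflection multiplying each coordinate by a sign. -/
def signReflection {n : ℕ} (ε : Fin n → ℤˣ) : E n →ₗ[ℝ] E n where
  toFun x := WithLp.toLp 2 fun j => ((ε j : ℤ) : ℝ) * x j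
  map_add' x y := by ext j; simp [mul_add]
  map_smul' r x := by ext j; simp [mul_left_comm]

lemma signReflection_apply {n : ℕ} (ε : Fin n → ℤˣ) (x : E n) (j : Fin n) :
    signReflection ε x j = ((ε j : ℤ) : ℝ) * x j := rfl

lemma signForm_one_signReflection {n : ℕ} (ε : Fin n → ℤˣ) (x : E n) :
    signForm 1 (signReflection ε x) = signForm ε x := by
  simp [signForm_apply, signReflection_apply]

lemma abs_det_signReflection {n : ℕ} (ε : Fin n → ℤˣ) : |LinearMap.det (signReflection ε)| = 1 := by
  have h : signReflection ε ∘ₗ signReflection ε = LinearMap.id := by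
    ext x j
    simp [signReflection_apply, ← mul_assoc, unit_sign_mul_self]
  have h2 : LinearMap.det (signReflection ε) * LinearMap.det (signReflection ε) = 1 := by
    rw [← LinearMap.det_comp, h, LinearMap.det_id]
  rcases mul_self_eq_one_iff.1 h2 with h3 | h3 <;> simp [h3]

lemma volume_prism_signReflection {n : ℕ} (ε : Fin n → ℤˣ) (u : E n) (S : Set (E n)) :
    volume (prism (signForm ε) 1 u {y | signReflection ε y ∈ S})
      = volume (prism (signForm 1) 1 (signReflection ε u) S) := by
  have hd := abs_det_signReflection ε
  have h := volume_prism_affine (signReflection ε) (fun h => by simp [h] at hd) 0 (signForm 1) 1 u S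
  have h1 : signForm 1 ∘ₗ signReflection ε = signForm ε :=
    LinearMap.ext fun x => signForm_one_signReflection ε x
  simpa [h1, abs_inv, hd] using h

lemma volume_level_set {n : ℕ} {f : E n →ₗ[ℝ] ℝ} (hf : f ≠ 0) (c : ℝ) :
    volume {y | f y = c} = 0 := by
  obtain ⟨w, hw⟩ : ∃ w, f w ≠ 0 := by
    by_contra! h
    exact hf (LinearMap.ext h)
  have h : {y | f y = c} = (fun y => y + (-(c / f w)) • w) ⁻¹' (LinearMap.ker f : Set (E n)) := by
    ext y
    simp [hw, ← sub_eq_add_neg, sub_eq_zero]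
  rw [h, measure_preimage_add_right]
  refine Measure.addHaar_submodule _ _ fun h2 => hf (LinearMap.ker_eq_top.1 h2)

lemma volume_prism_openFacet {n : ℕ} (hn : 2 ≤ n) (ε : Fin n → ℤˣ) (u : E n) :
    volume (prism (signForm ε) 1 u (openFacet ε)) = volume (prism (signForm ε) 1 u (facet 1 ε)) := by
  refine le_antisymm (measure_mono (prism_mono _ _ _ fun x hx => ⟨hx.1, fun j => (hx.2 j).le⟩)) ?_
  let f : Fin n → E n →ₗ[ℝ] ℝ := fun j =>
    EuclideanSpace.projₗ j - (u j / signForm ε u) • signForm ε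
  have hfy : ∀ j y, f j y = y j - u j / signForm ε u * signForm ε y := fun j y => by simp [f]
  have hf : ∀ j, f j ≠ 0 := by
    intro j h
    have : Nontrivial (Fin n) := Fin.nontrivial_iff_two_le.2 hn
    obtain ⟨k, hk⟩ := exists_ne j
    have h1 := LinearMap.congr_fun h (EuclideanSpace.single k ((ε k : ℤ) : ℝ))
    have h2 := LinearMap.congr_fun h (EuclideanSpace.single j 1)
    rw [hfy, signForm_single, unit_sign_mul_self] at h1
    rw [hfy, signForm_single] at h2
    have h3 : u j / signForm ε u = 0 := by simpa [hk.symm] using h1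
    simp [h3] at h2
  have hsub : prism (signForm ε) 1 u (facet 1 ε) ⊆ prism (signForm ε) 1 u (openFacet ε) ∪
      ⋃ j, {y | f j y = -(u j / signForm ε u)} := by
    intro y hy
    by_cases h : y - ((signForm ε y - 1) / signForm ε u) • u ∈ openFacet ε
    · exact Or.inl ⟨h, hy.2⟩
    · right
      have h2 : ∃ j, ((ε j : ℤ) : ℝ) * (y - ((signForm ε y - 1) / signForm ε u) • u) j = 0 := by
        by_contra! h3
        exact h ⟨hy.1.1, fun j => lt_of_le_of_ne (hy.1.2 j) (h3 j).symm⟩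
      obtain ⟨j, hj⟩ := h2
      refine Set.mem_iUnion.2 ⟨j, ?_⟩
      have h3 := (mul_eq_zero.1 hj).resolve_left fun h0 => by simpa [h0] using abs_sign (ε j)
      simp only [PiLp.sub_apply, PiLp.smul_apply, smul_eq_mul] at h3
      rw [Set.mem_ofPred_eq, hfy]
      have h4 : (signForm ε y - 1) / signForm ε u * u j
        = u j / signForm ε u * signForm ε y - u j / signForm ε u := by ring
      linarith
  calc _ ≤ _ := measure_mono hsub
    _ ≤ _ := measure_union_le _ _
    _ = _ := by rw [measure_iUnion_null fun j => volume_level_set (hf j) _, add_zero]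

lemma exists_volume_prism_facet {n : ℕ} (hn : n ≠ 0) : ∃ τ : ℝ≥0∞, ∀ (ε : Fin n → ℤˣ) (u : E n),
    0 < signForm ε u →
      volume (prism (signForm ε) 1 u (facet 1 ε)) = ENNReal.ofReal (signForm ε u) * τ := by
  let w : E n := EuclideanSpace.single ⟨0, Nat.pos_of_ne_zero hn⟩ 1
  have hw : signForm 1 w = 1 := by simp [w, signForm_single]
  refine ⟨volume (prism (signForm 1) 1 w (facet 1 1)), fun ε u hu => ?_⟩
  have h1 : facet 1 ε = {y | signReflection ε y ∈ facet 1 1} := by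
    ext y
    simp only [facet, Set.mem_ofPred_eq, signForm_one_signReflection, signReflection_apply]
    simp
  rw [h1, volume_prism_signReflection, volume_prism_direction (signForm 1) 1 (w := w)
    (by rwa [signForm_one_signReflection]) (by rw [hw]; exact one_pos), hw, div_one,
    signForm_one_signReflection]

lemma volume_prism_facet_dilate {n : ℕ} (hn : n ≠ 0) {s : ℝ} (hs : 0 < s) (ε : Fin n → ℤˣ) {u : E n}
    (hu : 0 < signForm ε u) : volume (prism (signForm ε) s u (facet s ε))
      = ENNReal.ofReal (s ^ (n - 1)) * volume (prism (signForm ε) 1 u (facet 1 ε)) := by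
  have h := volume_prism_homothety hn (signForm ε) 1 hu hs 0 (facet s ε)
  have h1 : facet 1 ε = {y | s • y + 0 ∈ facet s ε} := by
    ext y
    simp only [facet, Set.mem_ofPred_eq, add_zero, map_smul, smul_eq_mul, PiLp.smul_apply,
      mul_left_comm _ s, mul_eq_left₀ hs.ne', mul_nonneg_iff_of_pos_left hs]
  rwa [← h1, map_zero, add_zero, mul_one] at h

lemma volume_prism_corner {n : ℕ} (hn : n ≠ 0) {s b c : ℝ} (hc : 0 < c) (hs : s = b + c)
    (ε : Fin n → ℤˣ) (j : Fin n) {u : E n}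
    (hu : 0 < signForm ε u) : volume (prism (signForm ε) s u (corner s b ε j))
      = ENNReal.ofReal (c ^ (n - 1)) * volume (prism (signForm ε) 1 u (openFacet ε)) := by
  have hx : signForm ε (EuclideanSpace.single j (((ε j : ℤ) : ℝ) * b)) = b := by
    rw [signForm_single, ← mul_assoc, unit_sign_mul_self, one_mul]
  have h := volume_prism_homothety hn (signForm ε) 1 hu hc
    (EuclideanSpace.single j (((ε j : ℤ) : ℝ) * b)) (corner s b ε j)
  have h1 : openFacet ε
      = {y | c • y + EuclideanSpace.single j (((ε j : ℤ) : ℝ) * b) ∈ corner s b ε j} := by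
    ext y
    have e1 : ∀ k ≠ j, ((ε k : ℤ) : ℝ) *
        (c • y + EuclideanSpace.single j (((ε j : ℤ) : ℝ) * b)) k = c * (((ε k : ℤ) : ℝ) * y k) :=
      fun k hk => by simp [hk]; ring
    have e2 : ((ε j : ℤ) : ℝ) * (c • y + EuclideanSpace.single j (((ε j : ℤ) : ℝ) * b)) j
        = c * (((ε j : ℤ) : ℝ) * y j) + b := by
      have := unit_sign_mul_self (ε j)
      simp only [PiLp.add_apply, PiLp.smul_apply, PiLp.single_apply, if_true, smul_eq_mul]
      linear_combination b * this
    simp only [openFacet, corner, Set.mem_ofPred_eq]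
    rw [map_add, hx, map_smul, smul_eq_mul, e2, hs, add_comm b, add_left_inj, mul_eq_left₀ hc.ne',
      lt_add_iff_pos_left, mul_pos_iff_of_pos_left hc]
    refine and_congr_right fun _ => ⟨fun h => ⟨fun k hk => ?_, h j⟩, fun h k => ?_⟩
    · rw [e1 k hk]; exact mul_pos hc (h k)
    · by_cases hk : k = j
      · exact hk ▸ h.2
      · have := h.1 k hk
        rw [e1 k hk] at this
        exact (mul_pos_iff_of_pos_left hc).1 this
  rwa [← h1, hx, mul_one, add_comm, ← hs] at h

lemma disjoint_prism {n : ℕ} (a : E n →ₗ[ℝ] ℝ) (b : ℝ) (u : E n) {S T : Set (E n)}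
    (h : Disjoint S T) : Disjoint (prism a b u S) (prism a b u T) :=
  Set.disjoint_left.2 fun _ hy hy' => Set.disjoint_left.1 h hy.1 hy'.1

lemma continuous_signForm {n : ℕ} (ε : Fin n → ℤˣ) : Continuous (signForm ε) :=
  (signForm ε).continuous_of_finiteDimensional

lemma measurableSet_corner {n : ℕ} (s b : ℝ) (ε : Fin n → ℤˣ) (j : Fin n) :
    MeasurableSet (corner s b ε j) := by
  have h1 : MeasurableSet {x : E n | signForm ε x = s} :=
    (isClosed_eq (continuous_signForm ε) continuous_const).measurableSet
  have h2 : MeasurableSet {x : E n | ∀ k ≠ j, 0 < ((ε k : ℤ) : ℝ) * x k} := by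
    simp only [Set.ofPred_forall]
    exact .iInter fun k => .iInter fun _ =>
      (isOpen_lt continuous_const (by fun_prop)).measurableSet
  have h3 : MeasurableSet {x : E n | b < ((ε j : ℤ) : ℝ) * x j} :=
    (isOpen_lt continuous_const (by fun_prop)).measurableSet
  exact h1.inter (h2.inter h3)

lemma measurableSet_openFacet {n : ℕ} (ε : Fin n → ℤˣ) : MeasurableSet (openFacet ε) := by
  have h1 : MeasurableSet {x : E n | signForm ε x = 1} :=
    (isClosed_eq (continuous_signForm ε) continuous_const).measurableSet
  have h2 : MeasurableSet {x : E n | ∀ k, 0 < ((ε k : ℤ) : ℝ) * x k} := by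
    simp only [Set.ofPred_forall]
    exact .iInter fun k => (isOpen_lt continuous_const (by fun_prop)).measurableSet
  exact h1.inter h2

lemma corner_subset_facet {n : ℕ} {s b : ℝ} (hb : 0 ≤ b) (ε : Fin n → ℤˣ) (j : Fin n) :
    corner s b ε j ⊆ facet s ε := fun x hx => ⟨hx.1, fun k => by
  by_cases hk : k = j
  · exact hk ▸ hb.trans hx.2.2.le
  · exact (hx.2.1 k hk).le⟩

lemma disjoint_corner {n : ℕ} {s b : ℝ} (hb : 0 ≤ b) (hs : s ≤ 2 * b) (ε : Fin n → ℤˣ)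
    {j k : Fin n} (hjk : j ≠ k) : Disjoint (corner s b ε j) (corner s b ε k) := by
  refine Set.disjoint_left.2 fun x hx hx' => ?_
  have h1 := (corner_subset_facet hb ε j hx).2
  have h2 : ∑ i ∈ {j, k}, ((ε i : ℤ) : ℝ) * x i ≤ signForm ε x :=
    Finset.sum_le_sum_of_subset_of_nonneg (Finset.subset_univ _) fun i _ _ => h1 i
  rw [Finset.sum_pair hjk, hx.1] at h2
  linarith [hx.2.2, hx'.2.2]

lemma volume_prism_truncFacet_add_le {n : ℕ} (hn : 2 ≤ n) {τ : ℝ≥0∞}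
    (hτ : ∀ (ε : Fin n → ℤˣ) (u : E n), 0 < signForm ε u →
      volume (prism (signForm ε) 1 u (facet 1 ε)) = ENNReal.ofReal (signForm ε u) * τ)
    {s b c : ℝ} (hc : 0 < c) (hs : s = b + c) (hcb : c ≤ b) (ε : Fin n → ℤˣ) {u : E n}
    (hu : 0 < signForm ε u) :
    volume (prism (signForm ε) s u (truncFacet s b ε))
        + n * (ENNReal.ofReal (c ^ (n - 1)) * (ENNReal.ofReal (signForm ε u) * τ))
      ≤ ENNReal.ofReal (s ^ (n - 1)) * (ENNReal.ofReal (signForm ε u) * τ) := by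
  have hn0 : n ≠ 0 := by omega
  have hb : 0 ≤ b := hc.le.trans hcb
  rw [← hτ ε u hu, ← volume_prism_facet_dilate hn0 (by linarith : 0 < s) ε hu,
    ← volume_prism_openFacet hn ε u]
  have h1 : (n : ℝ≥0∞) * (ENNReal.ofReal (c ^ (n - 1))
      * volume (prism (signForm ε) 1 u (openFacet ε)))
      = volume (⋃ j, prism (signForm ε) s u (corner s b ε j)) := by
    rw [measure_iUnion (fun j k hjk => disjoint_prism _ _ _ (disjoint_corner hb (by linarith) ε hjk))
      fun j => measurableSet_prism _ _ _ (measurableSet_corner s b ε j), tsum_fintype]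
    simp only [volume_prism_corner hn0 hc hs ε _ hu, Finset.sum_const, Finset.card_univ,
      Fintype.card_fin, nsmul_eq_mul]
  rw [h1, ← measure_union]
  · refine measure_mono (Set.union_subset (prism_mono _ _ _ fun x hx => hx.1)
      (Set.iUnion_subset fun j => prism_mono _ _ _ (corner_subset_facet hb ε j)))
  · refine Set.disjoint_iUnion_right.2 fun j => disjoint_prism _ _ _ ?_
    exact Set.disjoint_left.2 fun x hx hx' => (hx.2 j).not_gt hx'.2.2
  · exact .iUnion fun j => measurableSet_prism _ _ _ (measurableSet_corner s b ε j)

/-! ### Shadows of polytopes -/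

lemma exists_exit {n : ℕ} {ι : Type*} [Finite ι] (a : ι → E n →ₗ[ℝ] ℝ) (b : ι → ℝ) {x u : E n}
    (hx : ∀ i, a i x ≤ b i) (hu : ∃ i, 0 < a i u) :
    ∃ (t : ℝ) (i : ι), (∀ j, a j (x + t • u) ≤ b j) ∧ a i (x + t • u) = b i ∧ 0 < a i u := by
  obtain ⟨i, hi, hmin⟩ := Set.exists_min_image {i | 0 < a i u} (fun i => (b i - a i x) / a i u)
    (Set.toFinite _) hu
  have hi : 0 < a i u := hi
  refine ⟨(b i - a i x) / a i u, i, fun j => ?_, ?_, hi⟩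
  · have h0 : 0 ≤ (b i - a i x) / a i u := div_nonneg (sub_nonneg.2 (hx i)) hi.le
    rw [map_add, map_smul, smul_eq_mul]
    rcases le_or_gt (a j u) 0 with hj | hj
    · nlinarith [hx j]
    · have h1 := hmin j hj
      rw [le_div_iff₀ hj] at h1
      linarith
  · rw [map_add, map_smul, smul_eq_mul, div_mul_cancel₀ _ hi.ne']
    ring

lemma volume_slabCylinder_polytope_le {n : ℕ} {ι : Type*} [Fintype ι] (a : ι → E n →ₗ[ℝ] ℝ)
    (b : ι → ℝ) {u : E n} (hu1 : ‖u‖ = 1) (hu : ∃ i, 0 < a i u) (M : ι → ℝ≥0∞)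
    (hM : ∀ i, 0 < a i u →
      volume (prism (a i) (b i) u {x | (∀ j, a j x ≤ b j) ∧ a i x = b i}) ≤ M i) :
    volume (slabCylinder u {x | ∀ j, a j x ≤ b j}) ≤ ∑ i, M i := by
  classical
  let G : ι → Set (E n) := fun i => {x | (∀ j, a j x ≤ b j) ∧ a i x = b i}
  have hsub : slabCylinder u {x | ∀ j, a j x ≤ b j}
      ⊆ ⋃ i ∈ Finset.univ.filter fun i => 0 < a i u, slabCylinder u (G i) := by
    rintro y ⟨⟨x, hx, t, rfl⟩, hy⟩
    obtain ⟨t', i, h1, h2, h3⟩ := exists_exit a b hx hu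
    refine Set.mem_biUnion (x := i) (by simpa using h3) ⟨⟨x + t' • u, ⟨h1, h2⟩, t - t', ?_⟩, hy⟩
    rw [add_assoc, ← add_smul, add_sub_cancel]
  calc _ ≤ _ := measure_mono hsub
    _ ≤ _ := measure_biUnion_finset_le _ _
    _ ≤ ∑ i ∈ Finset.univ.filter fun i => 0 < a i u, M i := by
      refine Finset.sum_le_sum fun i hi => ?_
      have hi : 0 < a i u := by simpa using hi
      rw [volume_slabCylinder_of_flat hu1 (a i) (b i) hi fun x hx => hx.2]
      exact hM i hi
    _ ≤ _ := Finset.sum_le_sum_of_subset (Finset.filter_subset _ _)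

/-- The cross-polytope of radius `r`. -/
def crossPolytope (n : ℕ) (r : ℝ) : Set (E n) := {x | ∀ ε : Fin n → ℤˣ, signForm ε x ≤ r}

lemma nonneg_of_active {n : ℕ} {r : ℝ} {x : E n} (hx : x ∈ crossPolytope n r) {ε : Fin n → ℤˣ}
    (h : signForm ε x = r) (j : Fin n) : 0 ≤ ((ε j : ℤ) : ℝ) * x j := by
  have h1 := hx (flipSign j ε)
  rw [signForm_flipSign] at h1
  linarith

lemma volume_slabCylinder_crossPolytope_le {n : ℕ} (hn : n ≠ 0) {τ : ℝ≥0∞}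
    (hτ : ∀ (ε : Fin n → ℤˣ) (u : E n), 0 < signForm ε u →
      volume (prism (signForm ε) 1 u (facet 1 ε)) = ENNReal.ofReal (signForm ε u) * τ)
    {c : ℝ} (hc : 0 < c) {u : E n} (hu : ‖u‖ = 1) :
    volume (slabCylinder u (crossPolytope n c))
      ≤ visibleMass u * (ENNReal.ofReal (c ^ (n - 1)) * τ) := by
  rw [visibleMass, Finset.sum_mul]
  refine volume_slabCylinder_polytope_le signForm (fun _ => c) hu
    (exists_signForm_pos (by rintro rfl; simp at hu)) _ fun ε hε => ?_
  rw [mul_left_comm, ← hτ ε u hε, ← volume_prism_facet_dilate hn hc ε hε]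
  exact measure_mono (prism_mono _ _ _ fun x hx => ⟨hx.2, nonneg_of_active hx.1 hx.2⟩)

lemma disjoint_slabCylinder_openFacet {n : ℕ} {u : E n} {ε η : Fin n → ℤˣ} (hne : ε ≠ η)
    (hε : 0 < signForm ε u) (hη : 0 < signForm η u) :
    Disjoint (slabCylinder u (openFacet ε)) (slabCylinder u (openFacet η)) := by
  have key : ∀ {ε η : Fin n → ℤˣ}, ε ≠ η → ∀ {x : E n}, x ∈ openFacet η → signForm ε x < 1 := by
    intro ε η hne x hx
    rw [← hx.1, signForm_apply, signForm_apply]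
    have hle : ∀ j, ((ε j : ℤ) : ℝ) * x j ≤ ((η j : ℤ) : ℝ) * x j := fun j => by
      rcases sign_eq_or_eq_neg (ε j) (η j) with h | h
      · rw [h]
      · have := hx.2 j
        rw [h]; push_cast; linarith
    obtain ⟨j, hj⟩ := Function.ne_iff.1 hne
    refine Finset.sum_lt_sum (fun j _ => hle j) ⟨j, Finset.mem_univ _, ?_⟩
    have := hx.2 j
    rw [(sign_eq_or_eq_neg (ε j) (η j)).resolve_left hj]; push_cast; linarith
  refine Set.disjoint_left.2 ?_
  rintro y ⟨⟨x, hx, t, rfl⟩, -⟩ ⟨⟨z, hz, r, hzr⟩, -⟩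
  have hz' : z = x + (t - r) • u := by rw [sub_smul, ← add_sub_assoc, hzr, add_sub_cancel_right]
  have h1 := key hne hz
  have h2 := key hne.symm hx
  have h3 := hz.1
  rw [hz', map_add, map_smul, smul_eq_mul, hx.1] at h1
  rw [hz', map_add, map_smul, smul_eq_mul] at h3
  have h4 : t - r < 0 := by nlinarith
  nlinarith

lemma measurableSet_slabCylinder_of_flat {n : ℕ} {u : E n} (a : E n →ₗ[ℝ] ℝ) (b : ℝ)
    (hu : a u ≠ 0) {S : Set (E n)} (hS : ∀ x ∈ S, a x = b) (hm : MeasurableSet S) :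
    MeasurableSet (slabCylinder u S) := by
  have ha : Continuous a := a.continuous_of_finiteDimensional
  have h1 : Continuous fun y => y - ((a y - b) / a u) • u := by fun_prop
  have h2 : {y | ∃ x ∈ S, ∃ t : ℝ, y = x + t • u}
      = (fun y => y - ((a y - b) / a u) • u) ⁻¹' S := by
    ext y
    constructor
    · rintro ⟨x, hx, t, rfl⟩
      simp [hS x hx, hu, hx]
    · exact fun h => ⟨_, h, _, (sub_add_cancel _ _).symm⟩
  have h3 : MeasurableSet {y | ∃ x ∈ S, ∃ t : ℝ, y = x + t • u} := h2 ▸ h1.measurable hm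
  have h4 : Measurable fun y : E n => ⟪y, u⟫ := by fun_prop
  exact h3.inter ((measurableSet_le measurable_const h4).inter
    (measurableSet_lt h4 measurable_const))

lemma le_volume_slabCylinder_crossPolytope {n : ℕ} (hn : 2 ≤ n) {τ : ℝ≥0∞}
    (hτ : ∀ (ε : Fin n → ℤˣ) (u : E n), 0 < signForm ε u →
      volume (prism (signForm ε) 1 u (facet 1 ε)) = ENNReal.ofReal (signForm ε u) * τ)
    {u : E n} (hu : ‖u‖ = 1) :
    visibleMass u * τ ≤ volume (slabCylinder u (crossPolytope n 1)) := by
  classical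
  have hsub : (⋃ ε ∈ Finset.univ.filter fun ε : Fin n → ℤˣ => 0 < signForm ε u,
      slabCylinder u (openFacet ε)) ⊆ slabCylinder u (crossPolytope n 1) := by
    refine Set.iUnion₂_subset fun ε _ => ?_
    rintro y ⟨⟨x, hx, h⟩, hy⟩
    refine ⟨⟨x, fun η => ?_, h⟩, hy⟩
    rw [← hx.1, signForm_apply, signForm_apply]
    refine Finset.sum_le_sum fun j _ => ?_
    have := sign_mul_le_abs (η j) (x j)
    rwa [← one_mul |x j|, ← abs_sign (ε j), ← abs_mul, abs_of_pos (hx.2 j)] at this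
  refine le_trans (le_of_eq ?_) (measure_mono hsub)
  rw [measure_biUnion_finset
    (fun ε hε η hη hne => disjoint_slabCylinder_openFacet hne (by simpa using hε) (by simpa using hη))
    (fun ε hε => measurableSet_slabCylinder_of_flat (signForm ε) 1
      (by simpa using (Finset.mem_filter.1 hε).2.ne') (fun x hx => hx.1) (measurableSet_openFacet ε)),
    visibleMass, Finset.sum_mul]
  rw [Finset.sum_filter]
  refine Finset.sum_congr rfl fun ε _ => ?_
  split_ifs with h
  · rw [volume_slabCylinder_of_flat hu (signForm ε) 1 h fun x hx => hx.1,
      volume_prism_openFacet hn, hτ ε u h]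
  · rw [ENNReal.ofReal_of_nonpos (not_lt.1 h), zero_mul]

/-! ### Truncated cross-polytopes -/

/-- The linear form `x ↦ δ * x i` for `p = (i, δ)`. -/
def coordForm {n : ℕ} (p : Fin n × ℤˣ) : E n →ₗ[ℝ] ℝ :=
  ((p.2 : ℤ) : ℝ) • EuclideanSpace.projₗ p.1

lemma coordForm_apply {n : ℕ} (p : Fin n × ℤˣ) (x : E n) :
    coordForm p x = ((p.2 : ℤ) : ℝ) * x p.1 := rfl

/-- The cross-polytope of radius `s` with the tips beyond `|x i| = b` cut off. -/
def truncCrossPolytope (n : ℕ) (s b : ℝ) : Set (E n) :=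
  {x | ∀ i, Sum.elim signForm coordForm i x ≤ Sum.elim (fun _ => s) (fun _ => b) i}

lemma mem_truncCrossPolytope {n : ℕ} {s b : ℝ} {x : E n} :
    x ∈ truncCrossPolytope n s b ↔
      x ∈ crossPolytope n s ∧ ∀ p : Fin n × ℤˣ, ((p.2 : ℤ) : ℝ) * x p.1 ≤ b :=
  Sum.forall

lemma sub_single_mem_crossPolytope {n : ℕ} {s b c : ℝ} (hs : s = b + c) {x : E n}
    (hx : x ∈ crossPolytope n s) (p : Fin n × ℤˣ) (hp : b ≤ ((p.2 : ℤ) : ℝ) * x p.1) :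
    x + (-b) • EuclideanSpace.single p.1 ((p.2 : ℤ) : ℝ) ∈ crossPolytope n c := by
  intro ε
  rw [map_add, map_smul, signForm_single, smul_eq_mul]
  rcases sign_eq_or_eq_neg (ε p.1) p.2 with h | h
  · rw [h, unit_sign_mul_self]
    linarith [hx ε]
  · have h1 := hx (flipSign p.1 ε)
    have h2 := unit_sign_mul_self p.2
    rw [signForm_flipSign, h] at h1
    rw [h]
    push_cast at h1 ⊢
    linear_combination h1 + hs + b * h2 + 2 * hp

lemma volume_prism_cap_le {n : ℕ} (hn : n ≠ 0) {τ : ℝ≥0∞}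
    (hτ : ∀ (ε : Fin n → ℤˣ) (u : E n), 0 < signForm ε u →
      volume (prism (signForm ε) 1 u (facet 1 ε)) = ENNReal.ofReal (signForm ε u) * τ)
    {s b c : ℝ} (hc : 0 < c) (hs : s = b + c) (p : Fin n × ℤˣ) {u : E n} (hu : 0 < coordForm p u)
    {S : Set (E n)} (hS : ∀ x ∈ S, x ∈ crossPolytope n s ∧ coordForm p x = b) :
    volume (prism (coordForm p) b u S) ≤ ENNReal.ofReal (((p.2 : ℤ) : ℝ) * u p.1)
      * ENNReal.ofReal (2 ^ (n - 1)) * (ENNReal.ofReal (c ^ (n - 1)) * τ) := by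
  set w : E n := EuclideanSpace.single p.1 ((p.2 : ℤ) : ℝ) with hw
  have hw1 : coordForm p w = 1 := by
    rw [coordForm_apply, hw, PiLp.single_eq_same, unit_sign_mul_self]
  have hwn : ‖w‖ = 1 := by rw [hw, PiLp.norm_single, Real.norm_eq_abs, abs_sign]
  have hw0 : 0 < coordForm p w := by rw [hw1]; exact one_pos
  rw [volume_prism_direction _ _ hu hw0, hw1, div_one, coordForm_apply, mul_assoc,
    ← volume_slabCylinder_of_flat hwn (coordForm p) b hw0 fun x hx => (hS x hx).2]
  refine mul_le_mul_right ?_ _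
  have h := volume_slabCylinder_crossPolytope_le hn hτ hc hwn
  rw [hw, visibleMass_single hn, ← hw] at h
  refine le_trans (measure_mono ?_) h
  rintro y ⟨⟨x, hx, t, rfl⟩, hy⟩
  refine ⟨⟨_, sub_single_mem_crossPolytope hs (hS x hx).1 p (hS x hx).2.ge, t + b, ?_⟩, hy⟩
  rw [add_assoc, ← hw, ← add_smul, neg_add_cancel_comm_assoc]

lemma volume_slabCylinder_truncCrossPolytope_le {n : ℕ} (hn : 3 ≤ n) {s b c : ℝ} (hc : 0 < c)
    (hs : s = b + c) (hcb : c ≤ b) (hpow : s ^ (n - 1) = 1 + c ^ (n - 1)) {u : E n}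
    (hu : ‖u‖ = 1) :
    volume (slabCylinder u (truncCrossPolytope n s b))
      ≤ volume (slabCylinder u (crossPolytope n 1)) := by
  have hn0 : n ≠ 0 := by omega
  obtain ⟨τ, hτ⟩ := exists_volume_prism_facet hn0
  refine le_trans ?_ (le_volume_slabCylinder_crossPolytope (by omega) hτ hu)
  by_cases htop : visibleMass u * τ = ⊤
  · rw [htop]; exact le_top
  set C := ENNReal.ofReal (c ^ (n - 1)) with hC
  have hS : ENNReal.ofReal (s ^ (n - 1)) = 1 + C := by
    rw [hpow, ENNReal.ofReal_add zero_le_one (by positivity), ENNReal.ofReal_one]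
  let A : (Fin n → ℤˣ) → ℝ≥0∞ := fun ε =>
    if 0 < signForm ε u then volume (prism (signForm ε) s u (truncFacet s b ε)) else 0
  have hA : ∑ ε, A ε + n * (C * (visibleMass u * τ)) ≤ (1 + C) * (visibleMass u * τ) := by
    simp only [visibleMass, Finset.sum_mul, Finset.mul_sum]
    rw [← Finset.sum_add_distrib]
    refine Finset.sum_le_sum fun ε _ => ?_
    simp only [A]
    split_ifs with h
    · rw [← hS]
      exact volume_prism_truncFacet_add_le (by omega) hτ hc hs hcb ε h
    · simp [ENNReal.ofReal_of_nonpos (not_lt.1 h)]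
  have hK : volume (slabCylinder u (truncCrossPolytope n s b))
      ≤ ∑ ε, A ε + ∑ p : Fin n × ℤˣ, ENNReal.ofReal (((p.2 : ℤ) : ℝ) * u p.1)
        * ENNReal.ofReal (2 ^ (n - 1)) * (C * τ) := by
    obtain ⟨ε₀, h₀⟩ := exists_signForm_pos (u := u) (by rintro rfl; simp at hu)
    have h := volume_slabCylinder_polytope_le (Sum.elim signForm coordForm)
      (Sum.elim (fun _ => s) (fun _ => b)) hu ⟨Sum.inl ε₀, h₀⟩
      (Sum.elim A fun p : Fin n × ℤˣ => ENNReal.ofReal (((p.2 : ℤ) : ℝ) * u p.1)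
        * ENNReal.ofReal (2 ^ (n - 1)) * (C * τ)) ?_
    · rwa [Fintype.sum_sum_type] at h
    · rintro (ε | p) hi
      · have hi : 0 < signForm ε u := hi
        simp only [Sum.elim_inl, A, if_pos hi]
        refine measure_mono (prism_mono _ _ _ fun x hx => ?_)
        obtain ⟨hx1, hx2⟩ := mem_truncCrossPolytope.1 hx.1
        exact ⟨⟨hx.2, nonneg_of_active hx1 hx.2⟩, fun j => hx2 (j, ε j)⟩
      · exact volume_prism_cap_le hn0 hτ hc hs p hi fun x hx =>
          ⟨(mem_truncCrossPolytope.1 hx.1).1, hx.2⟩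
  have hcap := mul_le_mul_left (sum_caps_le_visibleMass hn u) (C * τ)
  rw [Finset.sum_mul] at hcap
  have hfin : (n : ℝ≥0∞) * (C * (visibleMass u * τ)) ≠ ⊤ :=
    ENNReal.mul_ne_top (ENNReal.natCast_ne_top _) (ENNReal.mul_ne_top ENNReal.ofReal_ne_top htop)
  refine (ENNReal.add_le_add_iff_right hfin).1 ?_
  calc volume (slabCylinder u (truncCrossPolytope n s b)) + n * (C * (visibleMass u * τ))
      ≤ ∑ ε, A ε + ((n - 1 : ℕ) : ℝ≥0∞) * visibleMass u * (C * τ)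
        + n * (C * (visibleMass u * τ)) := by gcongr; exact hK.trans (by gcongr)
    _ = (∑ ε, A ε + n * (C * (visibleMass u * τ)))
        + ((n - 1 : ℕ) : ℝ≥0∞) * visibleMass u * (C * τ) := by ring
    _ ≤ (1 + C) * (visibleMass u * τ) + ((n - 1 : ℕ) : ℝ≥0∞) * visibleMass u * (C * τ) := by gcongr
    _ = visibleMass u * τ + n * (C * (visibleMass u * τ)) := by
      obtain ⟨m, rfl⟩ := Nat.exists_eq_succ_of_ne_zero hn0
      simp only [Nat.succ_eq_add_one, add_tsub_cancel_right]
      push_cast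
      ring

/-! ### The two bodies -/

lemma isConvexBody_polytope {n : ℕ} {ι : Type*} [Finite ι] (a : ι → E n →ₗ[ℝ] ℝ) (b : ι → ℝ)
    (hb : ∀ i, 0 < b i) (hbdd : Bornology.IsBounded {x | ∀ i, a i x ≤ b i}) :
    IsConvexBody {x | ∀ i, a i x ≤ b i} := by
  have ha : ∀ i, Continuous (a i) := fun i => (a i).continuous_of_finiteDimensional
  refine ⟨isCompact_of_isClosed_isBounded ?_ hbdd, ?_, 0, ?_⟩
  · simp only [Set.ofPred_forall]
    exact isClosed_iInter fun i => isClosed_le (ha i) continuous_const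
  · simp only [Set.ofPred_forall]
    exact convex_iInter fun i => convex_halfSpace_le (a i).isLinear _
  · have ho : IsOpen {x : E n | ∀ i, a i x < b i} := by
      simp only [Set.ofPred_forall]
      exact isOpen_iInter_of_finite fun i => isOpen_lt (ha i) continuous_const
    exact interior_maximal (fun x hx i => (hx i).le) ho (by simpa using hb)

lemma isBounded_crossPolytope (n : ℕ) (r : ℝ) : Bornology.IsBounded (crossPolytope n r) := by
  refine (isBounded_iff_forall_norm_le).2 ⟨r, fun x hx => ?_⟩
  obtain ⟨ε, hε⟩ := exists_signForm_eq x
  refine le_trans ?_ (hε ▸ hx ε)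
  rw [EuclideanSpace.norm_eq]
  refine Real.sqrt_le_iff.2 ⟨Finset.sum_nonneg fun _ _ => abs_nonneg _, ?_⟩
  exact Finset.sum_sq_le_sq_sum_of_nonneg fun _ _ => abs_nonneg _

lemma truncCrossPolytope_subset (n : ℕ) (s b : ℝ) :
    truncCrossPolytope n s b ⊆ crossPolytope n s := fun _ hx => (mem_truncCrossPolytope.1 hx).1

lemma isConvexBody_crossPolytope (n : ℕ) {r : ℝ} (hr : 0 < r) :
    IsConvexBody (crossPolytope n r) :=
  isConvexBody_polytope signForm (fun _ => r) (fun _ => hr) (isBounded_crossPolytope n r)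

lemma isConvexBody_truncCrossPolytope (n : ℕ) {s b : ℝ} (hs : 0 < s) (hb : 0 < b) :
    IsConvexBody (truncCrossPolytope n s b) :=
  isConvexBody_polytope _ _ (Sum.forall.2 ⟨fun _ => hs, fun _ => hb⟩)
    ((isBounded_crossPolytope n s).subset (truncCrossPolytope_subset n s b))

lemma isCentered_of_neg_mem {n : ℕ} {K : Set (E n)} (h : ∀ x ∈ K, -x ∈ K) : IsCentered K :=
  fun x => ⟨h x, fun hx => neg_neg x ▸ h _ hx⟩

lemma neg_mem_crossPolytope {n : ℕ} {r : ℝ} {x : E n} (hx : x ∈ crossPolytope n r) :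
    -x ∈ crossPolytope n r := fun ε => by
  rw [map_neg, ← signForm_neg]
  exact hx _

lemma isCentered_truncCrossPolytope (n : ℕ) (s b : ℝ) : IsCentered (truncCrossPolytope n s b) :=
  isCentered_of_neg_mem fun x hx => by
    rw [mem_truncCrossPolytope] at hx ⊢
    refine ⟨neg_mem_crossPolytope hx.1, fun p => ?_⟩
    simpa using hx.2 (p.1, -p.2)

lemma measure_crossPolytope {n : ℕ} (μ : Measure (E n)) [μ.IsAddHaarMeasure] {r : ℝ} (hr : 0 < r) :
    μ (crossPolytope n r) = ENNReal.ofReal (r ^ n) * μ (crossPolytope n 1) := by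
  have h : crossPolytope n 1 = (fun x => r • x) ⁻¹' crossPolytope n r := by
    ext x
    simp only [crossPolytope, Set.mem_preimage, Set.mem_ofPred_eq, map_smul, smul_eq_mul,
      mul_le_iff_le_one_right hr]
  rw [h, Measure.addHaar_preimage_smul μ hr.ne', ← mul_assoc, ← ENNReal.ofReal_mul (by positivity),
    finrank_euclideanSpace_fin, abs_of_pos (by positivity), mul_inv_cancel₀ (by positivity),
    ENNReal.ofReal_one, one_mul]

lemma measure_crossPolytope_le {n : ℕ} (μ : Measure (E n)) [μ.IsAddHaarMeasure] {s b c : ℝ}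
    (hs : s = b + c) : μ (crossPolytope n s)
      ≤ μ (truncCrossPolytope n s b) + 2 * n * μ (crossPolytope n c) := by
  have hsub : crossPolytope n s ⊆ truncCrossPolytope n s b ∪ ⋃ p : Fin n × ℤˣ,
      (fun x => x + (-b) • EuclideanSpace.single p.1 ((p.2 : ℤ) : ℝ)) ⁻¹' crossPolytope n c := by
    intro x hx
    by_cases h : ∀ p : Fin n × ℤˣ, ((p.2 : ℤ) : ℝ) * x p.1 ≤ b
    · exact Or.inl (mem_truncCrossPolytope.2 ⟨hx, h⟩)
    · push Not at h
      obtain ⟨p, hp⟩ := h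
      exact Or.inr (Set.mem_iUnion.2 ⟨p, sub_single_mem_crossPolytope hs hx p hp.le⟩)
  refine (measure_mono hsub).trans ((measure_union_le _ _).trans ?_)
  gcongr
  refine (measure_iUnion_fintype_le _ _).trans_eq ?_
  simp only [measure_preimage_add_right, Finset.sum_const, Finset.card_univ, Fintype.card_prod,
    Fintype.card_fin, Fintype.card_units_int, nsmul_eq_mul]
  push_cast
  ring

lemma measure_crossPolytope_lt {n : ℕ} (μ : Measure (E n)) [μ.IsAddHaarMeasure] {s b c : ℝ}
    (hc : 0 < c) (hs0 : 0 < s) (hs : s = b + c) (h : 1 + 2 * n * c ^ n < s ^ n) :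
    μ (crossPolytope n 1) < μ (truncCrossPolytope n s b) := by
  obtain ⟨hcpt, -, hne⟩ := isConvexBody_crossPolytope n one_pos
  have hpos : μ (crossPolytope n 1) ≠ 0 :=
    (Measure.measure_pos_of_nonempty_interior μ hne).ne'
  have hfin : μ (crossPolytope n 1) ≠ ⊤ := hcpt.measure_ne_top
  by_contra! hle
  have h1 := (measure_crossPolytope_le μ hs).trans (add_le_add_left hle _)
  rw [measure_crossPolytope μ hs0, measure_crossPolytope μ hc] at h1
  have h2 : ENNReal.ofReal (s ^ n) * μ (crossPolytope n 1)
      ≤ ENNReal.ofReal (1 + 2 * n * c ^ n) * μ (crossPolytope n 1) := by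
    refine h1.trans_eq ?_
    rw [ENNReal.ofReal_add zero_le_one (by positivity), ENNReal.ofReal_mul (by positivity),
      ENNReal.ofReal_mul (by positivity), ENNReal.ofReal_natCast, ENNReal.ofReal_one,
      ENNReal.ofReal_ofNat]
    ring
  rw [ENNReal.mul_le_mul_iff_left hpos hfin, ENNReal.ofReal_le_ofReal_iff (by positivity)] at h2
  exact h2.not_gt h

lemma exists_truncation_parameters {n : ℕ} (hn : 3 ≤ n) : ∃ s c : ℝ, 0 < c ∧ 2 * c ≤ s ∧
    s ^ (n - 1) = 1 + c ^ (n - 1) ∧ 1 + 2 * n * c ^ n < s ^ n := by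
  have hn' : (3 : ℝ) ≤ n := by exact_mod_cast hn
  obtain ⟨m, rfl⟩ := Nat.exists_eq_add_of_le' (by omega : 1 ≤ n)
  simp only [add_tsub_cancel_right]
  have hm : m ≠ 0 := by omega
  set N : ℝ := ((m + 1 : ℕ) : ℝ) with hN
  set c : ℝ := 1 / (4 * N) with hcdef
  have hc : 0 < c := by positivity
  have hNc : N * c = 1 / 4 := by rw [hcdef]; field_simp
  have hcm : 0 < c ^ m := pow_pos hc m
  set s : ℝ := (1 + c ^ m) ^ ((m : ℝ)⁻¹) with hsdef
  have hs0 : 0 ≤ s := by positivity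
  have hs : s ^ m = 1 + c ^ m := Real.rpow_inv_natCast_pow (by positivity) hm
  have hs1 : 1 ≤ s := by
    by_contra! h
    have := pow_le_one₀ (n := m) hs0 h.le
    linarith
  refine ⟨s, c, hc, by nlinarith, hs, ?_⟩
  have e : 2 * N * c ^ (m + 1) = c ^ m / 2 := by rw [pow_succ]; linear_combination 2 * c ^ m * hNc
  rw [e, pow_succ, hs]
  nlinarith

/-- (Petty; Schneider.) The dual Busemann–Petty problem for projections has a
negative answer for every `n ≥ 3`: the orthogonal projection
`P_{u^⊥} x = x - ⟪x, u⟫ u` onto `u^⊥` can satisfy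
`λ_{n-1}(P_{u^⊥} K₁) ≤ λ_{n-1}(P_{u^⊥} K₂)` for all `u ∈ S^{n-1}` while
`λ_n(K₁) > λ_n(K₂)`. -/
theorem dual_busemann_petty_negative (n : ℕ) (hn : 3 ≤ n) :
    ∃ K₁ K₂ : Set (E n),
      IsConvexBody K₁ ∧ IsCentered K₁ ∧ IsConvexBody K₂ ∧ IsCentered K₂ ∧
      (∀ u ∈ sphere (0 : E n) 1,
        μH[(n : ℝ) - 1] ((fun x : E n => x - ⟪x, u⟫ • u) '' K₁)
          ≤ μH[(n : ℝ) - 1] ((fun x : E n => x - ⟪x, u⟫ • u) '' K₂)) ∧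
      μH[(n : ℝ)] K₂ < μH[(n : ℝ)] K₁ := by
  obtain ⟨s, c, hc, hcs, hpow, hvol⟩ := exists_truncation_parameters hn
  have hs : s = (s - c) + c := (sub_add_cancel s c).symm
  refine ⟨truncCrossPolytope n s (s - c), crossPolytope n 1,
    isConvexBody_truncCrossPolytope n (by linarith) (by linarith),
    isCentered_truncCrossPolytope n _ _, isConvexBody_crossPolytope n one_pos,
    isCentered_of_neg_mem fun x => neg_mem_crossPolytope, fun u hu => ?_, ?_⟩
  · have hu1 : ‖u‖ = 1 := by simpa using hu
    obtain ⟨k, hk⟩ := exists_hausdorff_projection_eq hu1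
    rw [hk, hk]
    refine mul_le_mul_right ?_ _
    exact volume_slabCylinder_truncCrossPolytope_le hn hc hs (by linarith) hpow hu1
  · have : (μH[(n : ℝ)] : Measure (E n)).IsAddHaarMeasure := by
      have h := isAddHaarMeasure_hausdorffMeasure (E := E n)
      rwa [finrank_euclideanSpace_fin] at h
    exact measure_crossPolytope_lt _ hc (by linarith) hs hvol
end
end

section
/- (Funk's inversion formula, in the form used.) Let K be a centered convex body in ℝ³ whose radial function ρ_K is C^∞ on S², and let g be the continuous even function on S² with ρ_K = Rg. Fix u₀ ∈ S² and an orthonormal basis (e₁, e₂, u₀) of ℝ³, write r(θ,φ) = ρ_K(sin φ cos θ · e₁ + sin φ sin θ · e₂ + cos φ · u₀), and let A_K(φ) = (1/(2π)) ∫₀^{2π} r(θ,φ) dθ be the average of ρ_K over the circle of latitude at angle φ from u₀. Define F(t) = ∫₀ᵗ x·A_K(arcsin x)/√(t² − x²) dx for t ∈ (0,1). Then F is differentiable on (0,1) and g(u₀) = lim_{t→1⁻} (1/(2π)) F′(t). -/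
open MeasureTheory Metric
open scoped RealInnerProductSpace ENNReal

noncomputable section

/-- The arc-length parametrization of the unit circle spanned by an orthonormal pair. -/
def circleParam {V : Type*} [NormedAddCommGroup V] [InnerProductSpace ℝ V] (a b : V) (s : ℝ) : V :=
  Real.cos s • a + Real.sin s • b

section CircleParam

variable {V : Type*} [NormedAddCommGroup V] [InnerProductSpace ℝ V] {a b : V}

theorem continuous_circleParam (a b : V) : Continuous (circleParam a b) := by
  unfold circleParam; fun_prop

theorem norm_sq_smul_add_smul (ha : ‖a‖ = 1) (hb : ‖b‖ = 1) (hab : ⟪a, b⟫ = 0) (p q : ℝ) :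
    ‖p • a + q • b‖ ^ 2 = p ^ 2 + q ^ 2 := by
  rw [norm_add_sq_real, norm_smul, norm_smul, inner_smul_left, inner_smul_right, ha, hb, hab]
  simp

theorem norm_circleParam_sub (ha : ‖a‖ = 1) (hb : ‖b‖ = 1) (hab : ⟪a, b⟫ = 0) (s t : ℝ) :
    ‖circleParam a b s - circleParam a b t‖ = 2 * |Real.sin ((s - t) / 2)| := by
  have h : circleParam a b s - circleParam a b t =
      (Real.cos s - Real.cos t) • a + (Real.sin s - Real.sin t) • b := by
    unfold circleParam; module
  rw [← sq_eq_sq₀ (norm_nonneg _) (by positivity), h, norm_sq_smul_add_smul ha hb hab, mul_pow,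
    sq_abs, Real.cos_sub_cos, Real.sin_sub_sin]
  nlinarith [Real.sin_sq_add_cos_sq ((s + t) / 2)]

theorem lipschitzWith_circleParam (ha : ‖a‖ = 1) (hb : ‖b‖ = 1) (hab : ⟪a, b⟫ = 0) :
    LipschitzWith 1 (circleParam a b) := by
  refine LipschitzWith.of_dist_le_mul fun s t => ?_
  rw [dist_eq_norm, dist_eq_norm, norm_circleParam_sub ha hb hab, Real.norm_eq_abs]
  have := Real.abs_sin_le_abs (x := (s - t) / 2)
  rw [abs_div, abs_two] at this
  push_cast
  linarith

theorem injOn_circleParam (ha : ‖a‖ = 1) (hb : ‖b‖ = 1) (hab : ⟪a, b⟫ = 0) :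
    Set.InjOn (circleParam a b) (Set.Ioc (-Real.pi) Real.pi) := by
  intro s hs t ht hst
  have h := norm_circleParam_sub ha hb hab s t
  rw [hst, sub_self, norm_zero] at h
  have h0 : Real.sin ((s - t) / 2) = 0 := by
    rw [← abs_eq_zero]; linarith
  rw [Real.sin_eq_zero_iff_of_lt_of_lt (by linarith [hs.1, ht.2]) (by linarith [hs.2, ht.1])] at h0
  linarith

theorem abs_sub_le_norm_circleParam_sub (ha : ‖a‖ = 1) (hb : ‖b‖ = 1) (hab : ⟪a, b⟫ = 0)
    {δ : ℝ} (hδ : δ ≤ 1) {s t : ℝ} (hst : |s - t| ≤ δ) :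
    |s - t| ≤ (1 + δ) * ‖circleParam a b s - circleParam a b t‖ := by
  rw [norm_circleParam_sub ha hb hab]
  have h := Real.abs_sub_sin_le ((s - t) / 2)
  have h1 : |(s - t) / 2| = |s - t| / 2 := by rw [abs_div, abs_two]
  have h2 := abs_sub_abs_le_abs_sub ((s - t) / 2) (Real.sin ((s - t) / 2))
  rw [h1] at h h2
  set d := |s - t|
  have hd : 0 ≤ d := abs_nonneg _
  have h3 : d * (1 - δ / 24) ≤ 2 * |Real.sin ((s - t) / 2)| := by
    have : d ^ 3 ≤ d * δ := by
      have : d ^ 2 ≤ δ := by nlinarith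
      nlinarith
    nlinarith
  have h4 : 1 ≤ (1 + δ) * (1 - δ / 24) := by nlinarith
  nlinarith [mul_le_mul_of_nonneg_left h3 (by linarith : (0 : ℝ) ≤ 1 + δ)]

variable [MeasurableSpace V] [BorelSpace V]

theorem hausdorffMeasure_image_circleParam (ha : ‖a‖ = 1) (hb : ‖b‖ = 1) (hab : ⟪a, b⟫ = 0)
    {B : Set ℝ} (hB : MeasurableSet B) (hBs : B ⊆ Set.Ioc (-Real.pi) Real.pi) :
    μH[1] (circleParam a b '' B) = volume B := by
  have hinj := injOn_circleParam ha hb hab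
  apply le_antisymm
  · have := (lipschitzWith_circleParam ha hb hab).hausdorffMeasure_image_le zero_le_one B
    simpa [hausdorffMeasure_real] using this
  have key : ∀ δ : ℝ, 0 < δ → δ ≤ 1 →
      volume B ≤ ENNReal.ofReal (1 + δ) * μH[1] (circleParam a b '' B) := by
    intro δ hδ hδ1
    set I : ℤ → Set ℝ := fun n => Set.Ioc (n • δ) ((n + 1) • δ)
    have hI : B = ⋃ n, B ∩ I n := by
      rw [← Set.inter_iUnion, iUnion_Ioc_zsmul hδ, Set.inter_univ]
    have hdisj : Pairwise (Function.onFun Disjoint fun n => B ∩ I n) := fun m n hmn =>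
      (Set.pairwise_disjoint_Ioc_zsmul δ hmn).mono Set.inter_subset_right Set.inter_subset_right
    have piece : ∀ n, volume (B ∩ I n) ≤
        ENNReal.ofReal (1 + δ) * μH[1] (circleParam a b '' (B ∩ I n)) := by
      intro n
      have hinj' : Set.InjOn (circleParam a b) (B ∩ I n) :=
        hinj.mono (Set.inter_subset_left.trans hBs)
      have hL : LipschitzOnWith (1 + δ).toNNReal
          (Function.invFunOn (circleParam a b) (B ∩ I n)) (circleParam a b '' (B ∩ I n)) := by
        refine LipschitzOnWith.of_dist_le_mul ?_
        rintro _ ⟨s, hs, rfl⟩ _ ⟨t, ht, rfl⟩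
        rw [hinj'.leftInvOn_invFunOn hs, hinj'.leftInvOn_invFunOn ht, dist_eq_norm, dist_eq_norm,
          Real.coe_toNNReal _ (by linarith)]
        refine abs_sub_le_norm_circleParam_sub ha hb hab hδ1 ?_
        have h1 := hs.2
        have h2 := ht.2
        simp only [I, zsmul_eq_mul, Set.mem_Ioc, Int.cast_add, Int.cast_one] at h1 h2
        rw [abs_le]
        constructor <;> linarith
      have h := hL.hausdorffMeasure_image_le zero_le_one
      rw [hinj'.leftInvOn_invFunOn.image_image, hausdorffMeasure_real, ENNReal.rpow_one] at h
      exact h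
    calc volume B = ∑' n, volume (B ∩ I n) := by
          conv_lhs => rw [hI]
          exact measure_iUnion hdisj fun n => hB.inter measurableSet_Ioc
      _ ≤ ∑' n, ENNReal.ofReal (1 + δ) * μH[1] (circleParam a b '' (B ∩ I n)) :=
          ENNReal.tsum_le_tsum piece
      _ = ENNReal.ofReal (1 + δ) * μH[1] (circleParam a b '' B) := by
          rw [ENNReal.tsum_mul_left]
          conv_rhs => rw [hI, Set.image_iUnion]
          rw [measure_iUnion]
          · intro m n hmn
            exact (hdisj hmn).image hinj (Set.inter_subset_left.trans hBs)
              (Set.inter_subset_left.trans hBs)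
          · intro n
            exact (hB.inter measurableSet_Ioc).image_of_continuousOn_injOn
              (continuous_circleParam a b).continuousOn
              (hinj.mono (Set.inter_subset_left.trans hBs))
  have hlim : Filter.Tendsto
      (fun δ : ℝ => ENNReal.ofReal (1 + δ) * μH[1] (circleParam a b '' B))
      (nhdsWithin 0 (Set.Ioi 0)) (nhds (ENNReal.ofReal (1 + 0) * μH[1] (circleParam a b '' B))) := by
    refine ENNReal.Tendsto.mul_const ?_ (Or.inl (by simp))
    refine ENNReal.tendsto_ofReal (Filter.Tendsto.mono_left ?_ nhdsWithin_le_nhds)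
    exact (continuous_const.add continuous_id).tendsto _
  rw [add_zero, ENNReal.ofReal_one, one_mul] at hlim
  refine ge_of_tendsto hlim ?_
  filter_upwards [Ioc_mem_nhdsGT (zero_lt_one' ℝ)] with δ hδ using key δ hδ.1 hδ.2

theorem restrict_hausdorffMeasure_circleParam (ha : ‖a‖ = 1) (hb : ‖b‖ = 1) (hab : ⟪a, b⟫ = 0) :
    (μH[1] : Measure V).restrict (circleParam a b '' Set.Ioc (-Real.pi) Real.pi) =
      (volume.restrict (Set.Ioc (-Real.pi) Real.pi)).map (circleParam a b) := by
  have hm : Measurable (circleParam a b) := (continuous_circleParam a b).measurable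
  ext S hS
  rw [Measure.restrict_apply hS, Measure.map_apply hm hS, Measure.restrict_apply (hm hS),
    ← hausdorffMeasure_image_circleParam ha hb hab ((hm hS).inter measurableSet_Ioc)
      Set.inter_subset_right, Set.image_preimage_inter]

theorem integral_circleParam (ha : ‖a‖ = 1) (hb : ‖b‖ = 1) (hab : ⟪a, b⟫ = 0) {g : V → ℝ}
    (hg : Continuous g) :
    ∫ v in circleParam a b '' Set.Ioc (-Real.pi) Real.pi, g v ∂μH[1] =
      ∫ s in (-Real.pi)..Real.pi, g (circleParam a b s) := by
  rw [restrict_hausdorffMeasure_circleParam ha hb hab,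
    integral_map (continuous_circleParam a b).measurable.aemeasurable
      (hg.stronglyMeasurable.aestronglyMeasurable),
    intervalIntegral.integral_of_le (by linarith [Real.pi_pos])]

theorem exists_cos_sin_eq {p q : ℝ} (h : p ^ 2 + q ^ 2 = 1) :
    ∃ s ∈ Set.Ioc (-Real.pi) Real.pi, p = Real.cos s ∧ q = Real.sin s := by
  have hn : ‖(⟨p, q⟩ : ℂ)‖ = 1 := by
    rw [← sq_eq_sq₀ (norm_nonneg _) zero_le_one, Complex.sq_norm, Complex.normSq_mk]
    linarith
  refine ⟨Complex.arg ⟨p, q⟩, Complex.arg_mem_Ioc _, ?_, ?_⟩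
  · simpa [hn] using (Complex.norm_mul_cos_arg ⟨p, q⟩).symm
  · simpa [hn] using (Complex.norm_mul_sin_arg ⟨p, q⟩).symm

end CircleParam

section FunkFormula

variable {a b u : E 3}

theorem orthonormal_vec_three (haa : ⟪a, a⟫ = 1) (hbb : ⟪b, b⟫ = 1) (huu : ⟪u, u⟫ = 1)
    (hab : ⟪a, b⟫ = 0) (hau : ⟪a, u⟫ = 0) (hbu : ⟪b, u⟫ = 0) : Orthonormal ℝ ![a, b, u] := by
  rw [orthonormal_iff_ite]
  intro i j
  fin_cases i <;> fin_cases j <;>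
    simp only [Matrix.cons_val, Fin.mk_zero, Fin.mk_one, Fin.reduceFinMk, Fin.reduceEq, if_true,
      if_false, real_inner_comm, haa, hbb, huu, hab, hau, hbu, Fin.isValue]

theorem inner_of_orthonormal_vec_three (h : Orthonormal ℝ ![a, b, u]) :
    ⟪a, a⟫ = 1 ∧ ⟪b, b⟫ = 1 ∧ ⟪u, u⟫ = 1 ∧ ⟪a, b⟫ = 0 ∧ ⟪a, u⟫ = 0 ∧ ⟪b, u⟫ = 0 := by
  rw [orthonormal_iff_ite] at h
  exact ⟨by simpa using h 0 0, by simpa using h 1 1, by simpa using h 2 2, by simpa using h 0 1,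
    by simpa using h 0 2, by simpa using h 1 2⟩

theorem eq_sum_inner_smul_of_orthonormal (h : Orthonormal ℝ ![a, b, u]) (x : E 3) :
    x = ⟪a, x⟫ • a + ⟪b, x⟫ • b + ⟪u, x⟫ • u := by
  have hspan : ⊤ ≤ Submodule.span ℝ (Set.range ![a, b, u]) :=
    (h.linearIndependent.span_eq_top_of_card_eq_finrank (by simp)).ge
  have hx := (OrthonormalBasis.mk h hspan).sum_repr' x
  simpa [Fin.sum_univ_three] using hx.symm

theorem sphere_inter_hyperplane_eq (h : Orthonormal ℝ ![a, b, u]) :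
    sphere (0 : E 3) 1 ∩ hyperplane u = circleParam a b '' Set.Ioc (-Real.pi) Real.pi := by
  obtain ⟨haa, hbb, huu, hab, hau, hbu⟩ := inner_of_orthonormal_vec_three h
  have ha : ‖a‖ = 1 := by simpa using h.1 0
  have hb : ‖b‖ = 1 := by simpa using h.1 1
  ext x
  constructor
  · rintro ⟨hx, hxu⟩
    have hx' := eq_sum_inner_smul_of_orthonormal h x
    rw [real_inner_comm x u, show ⟪x, u⟫ = 0 from hxu, zero_smul, add_zero] at hx'
    have hn : ⟪a, x⟫ ^ 2 + ⟪b, x⟫ ^ 2 = 1 := by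
      rw [← norm_sq_smul_add_smul ha hb hab, ← hx', mem_sphere_zero_iff_norm.1 hx, one_pow]
    obtain ⟨s, hs, hp, hq⟩ := exists_cos_sin_eq hn
    exact ⟨s, hs, by rw [circleParam, ← hp, ← hq, ← hx']⟩
  · rintro ⟨s, -, rfl⟩
    constructor
    · rw [mem_sphere_zero_iff_norm, ← sq_eq_sq₀ (norm_nonneg _) zero_le_one, circleParam,
        norm_sq_smul_add_smul ha hb hab, Real.cos_sq_add_sin_sq, one_pow]
    · simp [hyperplane, circleParam, inner_add_left, inner_smul_left, hau, hbu]

theorem radon_three_eq (h : Orthonormal ℝ ![a, b, u]) {g : E 3 → ℝ} (hg : Continuous g) :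
    radon 3 g u = ∫ s in (-Real.pi)..Real.pi, g (circleParam a b s) := by
  rw [radon, sphere_inter_hyperplane_eq h, show ((3 : ℕ) : ℝ) - 2 = 1 by norm_num]
  exact integral_circleParam (by simpa using h.1 0) (by simpa using h.1 1)
    (inner_of_orthonormal_vec_three h).2.2.2.1 hg

theorem radon_congr {n : ℕ} {g g' : E n → ℝ} (h : ∀ v ∈ sphere (0 : E n) 1, g v = g' v)
    (u : E n) : radon n g u = radon n g' u := by
  have hu : IsClosed (hyperplane u) :=
    isClosed_eq (continuous_id.inner continuous_const) continuous_const
  exact setIntegral_congr_fun (isClosed_sphere.inter hu).measurableSet fun v hv => h v hv.1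

/-- The point at height `z` and longitude `θ` on the unit sphere, with poles `± u`. -/
def latitudePoint (a b u : E 3) (z θ : ℝ) : E 3 :=
  (√(1 - z ^ 2) * Real.cos θ) • a + (√(1 - z ^ 2) * Real.sin θ) • b + z • u

/-- The integral of `g` over the circle of latitude at height `z`, with respect to longitude. -/
def latitudeIntegral (a b u : E 3) (g : E 3 → ℝ) (z : ℝ) : ℝ :=
  ∫ θ in (0 : ℝ)..(2 * Real.pi), g (latitudePoint a b u z θ)

theorem continuous_latitudePoint (a b u : E 3) :
    Continuous (Function.uncurry (latitudePoint a b u)) := by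
  unfold latitudePoint Function.uncurry; fun_prop

theorem continuous_latitudeIntegral (a b u : E 3) {g : E 3 → ℝ} (hg : Continuous g) :
    Continuous (latitudeIntegral a b u g) :=
  intervalIntegral.continuous_parametric_intervalIntegral_of_continuous'
    (f := fun z θ => g (latitudePoint a b u z θ)) (hg.comp (continuous_latitudePoint a b u)) _ _

theorem integral_latitudePoint_shift (a b u : E 3) (g : E 3 → ℝ) (z α : ℝ) :
    ∫ θ in (0 : ℝ)..(2 * Real.pi), g (latitudePoint a b u z (θ + α)) =
      latitudeIntegral a b u g z := by
  have hp : Function.Periodic (fun θ => g (latitudePoint a b u z θ)) (2 * Real.pi) := by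
    intro θ
    simp [latitudePoint]
  rw [intervalIntegral.integral_comp_add_right (fun θ => g (latitudePoint a b u z θ)),
    zero_add, add_comm (2 * Real.pi), hp.intervalIntegral_add_eq α 0, zero_add]
  rfl

theorem latitudePoint_mem_sphere (h : Orthonormal ℝ ![a, b, u]) {z : ℝ} (hz : z ^ 2 ≤ 1) (θ : ℝ) :
    latitudePoint a b u z θ ∈ sphere (0 : E 3) 1 := by
  obtain ⟨haa, hbb, huu, hab, hau, hbu⟩ := inner_of_orthonormal_vec_three h
  rw [mem_sphere_zero_iff_norm, ← sq_eq_sq₀ (norm_nonneg _) zero_le_one,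
    ← real_inner_self_eq_norm_sq]
  simp only [latitudePoint, inner_add_left, inner_add_right,
    real_inner_smul_right, haa, hbb, huu, hab, hau, hbu, real_inner_comm]
  have := Real.sq_sqrt (sub_nonneg.2 hz)
  linear_combination (Real.sin θ ^ 2 + Real.cos θ ^ 2) * this +
    (1 - z ^ 2) * Real.sin_sq_add_cos_sq θ

theorem latitudeIntegral_neg (h : Orthonormal ℝ ![a, b, u]) {g : E 3 → ℝ}
    (hge : ∀ v ∈ sphere (0 : E 3) 1, g (-v) = g v) {z : ℝ} (hz : z ^ 2 ≤ 1) :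
    latitudeIntegral a b u g (-z) = latitudeIntegral a b u g z := by
  rw [← integral_latitudePoint_shift a b u g (-z) Real.pi]
  refine intervalIntegral.integral_congr fun θ _ => ?_
  rw [← hge _ (latitudePoint_mem_sphere h hz θ)]
  congr 1
  simp only [latitudePoint, Real.cos_add_pi, Real.sin_add_pi, neg_sq]
  module

/-- Averaging the spherical Radon transform over the circle of latitude at angle `φ`. -/
theorem integral_radon_latitude (h : Orthonormal ℝ ![a, b, u]) {g : E 3 → ℝ} (hg : Continuous g)
    (φ : ℝ) :
    ∫ θ in (0 : ℝ)..(2 * Real.pi), radon 3 g ((Real.sin φ * Real.cos θ) • a +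
        (Real.sin φ * Real.sin θ) • b + Real.cos φ • u) =
      ∫ s in (-Real.pi)..Real.pi, latitudeIntegral a b u g (Real.sin φ * Real.cos s) := by
  obtain ⟨haa, hbb, huu, hab, hau, hbu⟩ := inner_of_orthonormal_vec_three h
  set p : ℝ → E 3 := fun θ => -(Real.cos φ * Real.cos θ) • a + -(Real.cos φ * Real.sin θ) • b +
    Real.sin φ • u with hp
  set q : ℝ → E 3 := fun θ => -Real.sin θ • a + Real.cos θ • b with hq
  have horth : ∀ θ, Orthonormal ℝ ![p θ, q θ, (Real.sin φ * Real.cos θ) • a +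
      (Real.sin φ * Real.sin θ) • b + Real.cos φ • u] := by
    intro θ
    have h1 := Real.sin_sq_add_cos_sq θ
    have h2 := Real.sin_sq_add_cos_sq φ
    apply orthonormal_vec_three <;>
      simp only [hp, hq, inner_add_left, inner_add_right,
        real_inner_smul_right, haa, hbb, huu, hab, hau, hbu, real_inner_comm]
    · linear_combination (Real.cos φ ^ 2) * h1 + h2
    · linear_combination h1
    · linear_combination (Real.sin φ ^ 2) * h1 + h2
    · ring
    · linear_combination (-Real.sin φ * Real.cos φ) * h1
    · ring
  have hcont : Continuous (Function.uncurry fun θ s => g (circleParam (p θ) (q θ) s)) := by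
    unfold circleParam Function.uncurry
    fun_prop
  simp_rw [fun θ => radon_three_eq (horth θ) hg]
  rw [intervalIntegral_intervalIntegral_swap]
  swap
  · exact (hcont.continuousOn.integrableOn_compact
      (isCompact_uIcc.prod isCompact_uIcc)).mono_set
        (Set.prod_mono Set.uIoc_subset_uIcc Set.uIoc_subset_uIcc)
  refine intervalIntegral.integral_congr fun s _ => ?_
  set z := Real.sin φ * Real.cos s with hz
  have hz2 : (-(Real.cos s * Real.cos φ)) ^ 2 + Real.sin s ^ 2 = 1 - z ^ 2 := by
    have h1 := Real.sin_sq_add_cos_sq s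
    have h2 := Real.sin_sq_add_cos_sq φ
    rw [hz]
    linear_combination (Real.cos s ^ 2) * h2 + h1
  obtain ⟨α, hα1, hα2⟩ : ∃ α, -(Real.cos s * Real.cos φ) = √(1 - z ^ 2) * Real.cos α ∧
      Real.sin s = √(1 - z ^ 2) * Real.sin α := by
    have hn : ‖(⟨-(Real.cos s * Real.cos φ), Real.sin s⟩ : ℂ)‖ = √(1 - z ^ 2) := by
      rw [← hz2, Complex.norm_def, Complex.normSq_mk, sq, sq]
    refine ⟨Complex.arg ⟨-(Real.cos s * Real.cos φ), Real.sin s⟩, ?_, ?_⟩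
    · rw [← hn, Complex.norm_mul_cos_arg]
    · rw [← hn, Complex.norm_mul_sin_arg]
  rw [← integral_latitudePoint_shift a b u g z α]
  refine intervalIntegral.integral_congr fun θ _ => ?_
  congr 1
  simp only [hp, hq, circleParam, latitudePoint, Real.cos_add, Real.sin_add, mul_sub, mul_add]
  have e1 : √(1 - z ^ 2) * (Real.cos θ * Real.cos α) - √(1 - z ^ 2) * (Real.sin θ * Real.sin α) =
      -(Real.cos s * Real.cos φ) * Real.cos θ - Real.sin s * Real.sin θ := by
    linear_combination (-Real.cos θ) * hα1 + Real.sin θ * hα2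
  have e2 : √(1 - z ^ 2) * (Real.sin θ * Real.cos α) + √(1 - z ^ 2) * (Real.cos θ * Real.sin α) =
      -(Real.cos s * Real.cos φ) * Real.sin θ + Real.sin s * Real.cos θ := by
    linear_combination (-Real.sin θ) * hα1 - Real.cos θ * hα2
  rw [e1, e2, hz]
  module

end FunkFormula

section Abel

theorem integral_sin_pow_mul_integral_cos_pow (n : ℕ) :
    (∫ x in (0 : ℝ)..Real.pi / 2, Real.sin x ^ (n + 1)) *
      (∫ s in (-Real.pi)..Real.pi, Real.cos s ^ n) =
        Real.pi * ∫ y in (-1 : ℝ)..1, y ^ n := by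
  induction n using Nat.twoStepInduction with
  | zero => simp; ring
  | one => simp
  | more n ih _ =>
    rw [show n + 2 + 1 = (n + 1) + 2 by ring, integral_sin_pow, integral_cos_pow]
    rw [integral_pow] at ih ⊢
    simp only [Real.sin_zero, Real.cos_zero, Real.cos_pi_div_two, Real.sin_pi, Real.sin_neg,
      neg_zero, mul_zero, sub_zero, zero_div, zero_add, ne_eq, Nat.add_eq_zero_iff, one_ne_zero,
      and_false, not_false_eq_true, zero_pow, zero_mul]
    have hpow : (-1 : ℝ) ^ (n + 2 + 1) = (-1) ^ (n + 1) := by ring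
    rw [hpow]
    push_cast at ih ⊢
    have h1 : (n : ℝ) + 1 ≠ 0 := by positivity
    have h2 : (n : ℝ) + 2 ≠ 0 := by positivity
    have h3 : (n : ℝ) + 1 + 2 ≠ 0 := by positivity
    have h4 : (n : ℝ) + 2 + 1 ≠ 0 := by positivity
    field_simp at ih ⊢
    linear_combination ((n : ℝ) + 2) * ((n : ℝ) + 3) * ih

theorem integral_integral_polynomial (p : Polynomial ℝ) :
    ∫ x in (0 : ℝ)..Real.pi / 2, Real.sin x *
        ∫ s in (-Real.pi)..Real.pi, p.eval (Real.sin x * Real.cos s) =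
      Real.pi * ∫ y in (-1 : ℝ)..1, p.eval y := by
  induction p using Polynomial.induction_on' with
  | add p q hp hq =>
    have hcont : ∀ r : Polynomial ℝ, Continuous fun x => Real.sin x *
        ∫ s in (-Real.pi)..Real.pi, r.eval (Real.sin x * Real.cos s) := fun r =>
      Real.continuous_sin.mul
        (intervalIntegral.continuous_parametric_intervalIntegral_of_continuous'
          (f := fun x s => r.eval (Real.sin x * Real.cos s))
          (r.continuous.comp (by fun_prop)) _ _)
    have hcont' : ∀ (r : Polynomial ℝ) (x : ℝ),
        Continuous fun s => r.eval (Real.sin x * Real.cos s) := fun r x =>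
      r.continuous.comp (by fun_prop)
    simp only [Polynomial.eval_add]
    rw [intervalIntegral.integral_add (p.continuous.intervalIntegrable _ _)
      (q.continuous.intervalIntegrable _ _), mul_add, ← hp, ← hq,
      ← intervalIntegral.integral_add ((hcont p).intervalIntegrable _ _)
      ((hcont q).intervalIntegrable _ _)]
    refine intervalIntegral.integral_congr fun x _ => ?_
    rw [intervalIntegral.integral_add ((hcont' p x).intervalIntegrable _ _)
      ((hcont' q x).intervalIntegrable _ _), mul_add]
  | monomial n c =>
    simp only [Polynomial.eval_monomial, intervalIntegral.integral_const_mul, mul_pow]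
    rw [mul_left_comm, ← integral_sin_pow_mul_integral_cos_pow, ← mul_assoc,
      ← intervalIntegral.integral_const_mul c, ← intervalIntegral.integral_mul_const]
    refine intervalIntegral.integral_congr fun x _ => ?_
    ring

/-- Archimedes' theorem on a hemisphere, for functions of one coordinate. -/
theorem integral_integral_sin_mul_cos {h : ℝ → ℝ} (hh : Continuous h) :
    ∫ x in (0 : ℝ)..Real.pi / 2, Real.sin x *
        ∫ s in (-Real.pi)..Real.pi, h (Real.sin x * Real.cos s) =
      Real.pi * ∫ y in (-1 : ℝ)..1, h y := by
  have hcont : ∀ {f : ℝ → ℝ}, Continuous f → Continuous fun x => Real.sin x *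
      ∫ s in (-Real.pi)..Real.pi, f (Real.sin x * Real.cos s) := fun {f} hf =>
    Real.continuous_sin.mul
      (intervalIntegral.continuous_parametric_intervalIntegral_of_continuous'
        (f := fun x s => f (Real.sin x * Real.cos s)) (hf.comp (by fun_prop)) _ _)
  refine eq_of_abs_sub_le_all fun ε hε => ?_
  set C : ℝ := Real.pi ^ 2 + 2 * Real.pi with hC
  have hCpos : 0 < C := by positivity
  obtain ⟨p, hp⟩ := exists_polynomial_near_of_continuousOn (-1) 1 h hh.continuousOn (ε / C)
    (by positivity)
  have hpi := Real.pi_pos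
  have inner_bound : ∀ x, |(∫ s in (-Real.pi)..Real.pi, h (Real.sin x * Real.cos s)) -
      ∫ s in (-Real.pi)..Real.pi, p.eval (Real.sin x * Real.cos s)| ≤
        ε / C * (2 * Real.pi) := by
    intro x
    rw [← intervalIntegral.integral_sub
      ((hh.comp' (by fun_prop : Continuous fun s => Real.sin x * Real.cos s)).intervalIntegrable _ _)
      ((p.continuous.comp'
        (by fun_prop : Continuous fun s => Real.sin x * Real.cos s)).intervalIntegrable _ _)]
    have := intervalIntegral.norm_integral_le_of_norm_le_const (a := -Real.pi) (b := Real.pi)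
      (f := fun s => h (Real.sin x * Real.cos s) - p.eval (Real.sin x * Real.cos s))
      (C := ε / C) fun s _ => by
        rw [Real.norm_eq_abs, abs_sub_comm]
        refine (hp _ ?_).le
        rw [Set.mem_Icc, ← abs_le, abs_mul]
        exact mul_le_one₀ (Real.abs_sin_le_one x) (abs_nonneg _) (Real.abs_cos_le_one s)
    rwa [Real.norm_eq_abs, sub_neg_eq_add, ← two_mul, abs_of_pos (by positivity : 0 < 2 * Real.pi)]
      at this
  have left_bound : |(∫ x in (0 : ℝ)..Real.pi / 2, Real.sin x *
        ∫ s in (-Real.pi)..Real.pi, h (Real.sin x * Real.cos s)) -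
      ∫ x in (0 : ℝ)..Real.pi / 2, Real.sin x *
        ∫ s in (-Real.pi)..Real.pi, p.eval (Real.sin x * Real.cos s)| ≤ ε / C * Real.pi ^ 2 := by
    rw [← intervalIntegral.integral_sub ((hcont hh).intervalIntegrable _ _)
      ((hcont p.continuous).intervalIntegrable _ _)]
    have := intervalIntegral.norm_integral_le_of_norm_le_const (a := 0) (b := Real.pi / 2)
      (f := fun x => Real.sin x * (∫ s in (-Real.pi)..Real.pi, h (Real.sin x * Real.cos s)) -
        Real.sin x * ∫ s in (-Real.pi)..Real.pi, p.eval (Real.sin x * Real.cos s))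
      (C := ε / C * (2 * Real.pi)) fun x _ => by
        rw [Real.norm_eq_abs, ← mul_sub, abs_mul]
        calc _ ≤ 1 * (ε / C * (2 * Real.pi)) :=
              mul_le_mul (Real.abs_sin_le_one x) (inner_bound x) (abs_nonneg _) zero_le_one
          _ = _ := one_mul _
    rw [Real.norm_eq_abs, sub_zero, abs_of_pos (by positivity : 0 < Real.pi / 2)] at this
    refine this.trans_eq (by ring)
  have right_bound : |(∫ y in (-1 : ℝ)..1, h y) - ∫ y in (-1 : ℝ)..1, p.eval y| ≤ ε / C * 2 := by
    rw [← intervalIntegral.integral_sub (hh.intervalIntegrable _ _)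
      (p.continuous.intervalIntegrable _ _)]
    have := intervalIntegral.norm_integral_le_of_norm_le_const (a := -1) (b := 1)
      (f := fun y => h y - p.eval y) (C := ε / C) fun y hy => by
        rw [Set.uIoc_of_le (by norm_num)] at hy
        rw [Real.norm_eq_abs, abs_sub_comm]
        exact (hp y ⟨hy.1.le, hy.2⟩).le
    rwa [Real.norm_eq_abs, show |(1 : ℝ) - -1| = 2 by norm_num] at this
  rw [integral_integral_polynomial p] at left_bound
  have hε' : ε / C * Real.pi ^ 2 + ε / C * 2 * Real.pi = ε := by
    have : ε / C * C = ε := div_mul_cancel₀ _ hCpos.ne'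
    rw [hC] at this
    linarith
  rw [abs_le] at left_bound right_bound ⊢
  constructor <;> nlinarith

theorem integral_integral_scaled {h : ℝ → ℝ} (hh : Continuous h)
    (heven : ∀ y ∈ Set.Icc (0 : ℝ) 1, h (-y) = h y) {t : ℝ} (ht : t ∈ Set.Icc (0 : ℝ) 1) :
    t * ∫ x in (0 : ℝ)..Real.pi / 2, Real.sin x *
        ∫ s in (-Real.pi)..Real.pi, h (t * Real.sin x * Real.cos s) =
      2 * Real.pi * ∫ y in (0 : ℝ)..t, h y := by
  have h1 := integral_integral_sin_mul_cos (h := fun y => h (t * y)) (hh.comp (by fun_prop))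
  simp only [← mul_assoc] at h1
  rw [h1, mul_left_comm, intervalIntegral.mul_integral_comp_mul_left, mul_neg, mul_one,
    ← intervalIntegral.integral_add_adjacent_intervals (b := 0) (hh.intervalIntegrable _ _)
      (hh.intervalIntegrable _ _)]
  have h2 : ∫ y in (-t)..0, h y = ∫ y in (0 : ℝ)..t, h y := by
    have := intervalIntegral.integral_comp_neg (a := 0) (b := t) h
    rw [neg_zero] at this
    rw [← this]
    refine intervalIntegral.integral_congr fun y hy => ?_
    rw [Set.uIcc_of_le ht.1] at hy
    exact heven y ⟨hy.1, hy.2.trans ht.2⟩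
  rw [h2]
  ring

/-- The substitution `x = t sin a` in an Abel-type integral. -/
theorem integral_div_sqrt_sq_sub_sq (f : ℝ → ℝ) {t : ℝ} (ht : 0 < t) :
    ∫ x in (0 : ℝ)..t, x * f x / √(t ^ 2 - x ^ 2) =
      t * ∫ x in (0 : ℝ)..Real.pi / 2, Real.sin x * f (t * Real.sin x) := by
  have hpi := Real.pi_pos
  have himg : (fun x => t * Real.sin x) '' Set.Ioo 0 (Real.pi / 2) = Set.Ioo 0 t := by
    ext y
    constructor
    · rintro ⟨x, ⟨hx0, hx1⟩, rfl⟩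
      have h0 := Real.sin_pos_of_pos_of_lt_pi hx0 (by linarith)
      have h1 : Real.sin x < 1 := by
        rw [← Real.sin_pi_div_two]
        exact Real.sin_lt_sin_of_lt_of_le_pi_div_two (by linarith) le_rfl hx1
      exact ⟨by positivity, by nlinarith⟩
    · rintro ⟨hy0, hy1⟩
      have h0 : 0 < y / t := by positivity
      have h1 : y / t < 1 := (div_lt_one ht).2 hy1
      refine ⟨Real.arcsin (y / t), ⟨Real.arcsin_pos.2 h0, Real.arcsin_lt_pi_div_two.2 h1⟩, ?_⟩
      simp only
      rw [Real.sin_arcsin (by linarith) h1.le, mul_div_cancel₀ _ ht.ne']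
  have hinj : Set.InjOn (fun x => t * Real.sin x) (Set.Ioo 0 (Real.pi / 2)) := by
    intro x hx y hy hxy
    refine Real.injOn_sin ⟨by linarith [hx.1], hx.2.le⟩ ⟨by linarith [hy.1], hy.2.le⟩ ?_
    exact mul_left_cancel₀ ht.ne' hxy
  rw [intervalIntegral.integral_of_le ht.le, integral_Ioc_eq_integral_Ioo, ← himg,
    integral_image_eq_integral_abs_deriv_smul measurableSet_Ioo
      (fun x _ => ((Real.hasDerivAt_sin x).const_mul t).hasDerivWithinAt) hinj,
    intervalIntegral.integral_of_le (by positivity), integral_Ioc_eq_integral_Ioo,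
    ← integral_const_mul]
  refine setIntegral_congr_fun measurableSet_Ioo fun x hx => ?_
  have hc : 0 < Real.cos x := Real.cos_pos_of_mem_Ioo ⟨by linarith [hx.1], hx.2⟩
  have hs : √(t ^ 2 - (t * Real.sin x) ^ 2) = t * Real.cos x := by
    rw [← Real.sqrt_sq (by positivity : 0 ≤ t * Real.cos x)]
    congr 1
    linear_combination (-t ^ 2) * Real.sin_sq_add_cos_sq x
  simp only [smul_eq_mul]
  rw [hs, abs_of_pos (by positivity)]
  field_simp

end Abel

/-- Funk's inversion formula, in the form used: with spherical polar coordinates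
about the pole `u₀`, `A_K(φ)` the average of `ρ_K` over the circle of latitude at
angle `φ`, and `F(t) = ∫₀ᵗ x A_K(arcsin x)/√(t² − x²) dx`, the function `F` is
differentiable on `(0,1)` and `g(u₀) = lim_{t→1⁻} (1/(2π)) F′(t)`. -/
theorem funk_inversion_formula (K : Set (E 3))
    (hK : IsConvexBody K) (hc : IsCentered K)
    (hsm : SmoothOnSphere (radialFn K))
    (g : E 3 → ℝ) (hg : ContinuousOn g (sphere (0 : E 3) 1))
    (hge : ∀ u ∈ sphere (0 : E 3) 1, g (-u) = g u)
    (hrg : ∀ u ∈ sphere (0 : E 3) 1, radialFn K u = radon 3 g u)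
    (u₀ e₁ e₂ : E 3) (hb : Orthonormal ℝ ![e₁, e₂, u₀])
    (r : ℝ → ℝ → ℝ)
    (hr : ∀ θ φ, r θ φ = radialFn K
      ((Real.sin φ * Real.cos θ) • e₁ + (Real.sin φ * Real.sin θ) • e₂ +
        Real.cos φ • u₀))
    (A : ℝ → ℝ)
    (hA : ∀ φ, A φ = (1 / (2 * Real.pi)) * ∫ θ in (0 : ℝ)..(2 * Real.pi), r θ φ)
    (F : ℝ → ℝ)
    (hF : ∀ t, F t = ∫ x in (0 : ℝ)..t,
      x * A (Real.arcsin x) / Real.sqrt (t ^ 2 - x ^ 2)) :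
    (∀ t ∈ Set.Ioo (0 : ℝ) 1, DifferentiableAt ℝ F t) ∧
      Filter.Tendsto (fun t => (1 / (2 * Real.pi)) * deriv F t)
        (nhdsWithin 1 (Set.Iio 1)) (nhds (g u₀)) := by
  obtain ⟨g', hg'⟩ : ∃ g' : C(E 3, ℝ), ∀ v ∈ sphere (0 : E 3) 1, g v = g' v := by
    obtain ⟨g', hg'⟩ := ContinuousMap.exists_restrict_eq (isClosed_sphere (x := (0 : E 3)) (ε := 1))
      ⟨fun v => g v, continuousOn_iff_continuous_domRestrict.mp hg⟩
    exact ⟨g', fun v hv => (DFunLike.congr_fun hg' ⟨v, hv⟩).symm⟩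
  have hge' : ∀ v ∈ sphere (0 : E 3) 1, g' (-v) = g' v := fun v hv => by
    rw [← hg' v hv, ← hg' (-v) (by simpa using hv), hge v hv]
  set G := latitudeIntegral e₁ e₂ u₀ g' with hG
  have hGcont : Continuous G := continuous_latitudeIntegral e₁ e₂ u₀ g'.continuous
  obtain ⟨h11, h22, h33, h12, h13, h23⟩ := inner_of_orthonormal_vec_three hb
  have hpi := Real.pi_pos
  have hAG : ∀ φ, A φ = (1 / (2 * Real.pi)) *
      ∫ s in (-Real.pi)..Real.pi, G (Real.sin φ * Real.cos s) := by
    intro φ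
    rw [hA, ← integral_radon_latitude hb g'.continuous φ]
    congr 1
    refine intervalIntegral.integral_congr fun θ _ => ?_
    rw [hr, hrg, radon_congr hg']
    rw [mem_sphere_zero_iff_norm, ← sq_eq_sq₀ (norm_nonneg _) zero_le_one,
      ← real_inner_self_eq_norm_sq]
    simp only [inner_add_left, inner_add_right,
      real_inner_smul_right, h11, h22, h33, h12, h13, h23, real_inner_comm]
    linear_combination (Real.sin φ ^ 2) * Real.sin_sq_add_cos_sq θ + Real.sin_sq_add_cos_sq φ
  have hFG : ∀ t ∈ Set.Ioo (0 : ℝ) 1, F t = ∫ y in (0 : ℝ)..t, G y := by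
    intro t ht
    rw [hF, integral_div_sqrt_sq_sub_sq (fun x => A (Real.arcsin x)) ht.1]
    have heven : ∀ y ∈ Set.Icc (0 : ℝ) 1, G (-y) = G y := fun y hy =>
      latitudeIntegral_neg hb hge' (by nlinarith [hy.1, hy.2])
    have h := integral_integral_scaled hGcont heven (Set.Ioo_subset_Icc_self ht)
    have hinner : ∫ x in (0 : ℝ)..Real.pi / 2, Real.sin x * A (Real.arcsin (t * Real.sin x)) =
        (1 / (2 * Real.pi)) * ∫ x in (0 : ℝ)..Real.pi / 2, Real.sin x *
          ∫ s in (-Real.pi)..Real.pi, G (t * Real.sin x * Real.cos s) := by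
      rw [← intervalIntegral.integral_const_mul]
      refine intervalIntegral.integral_congr fun x _ => ?_
      have hx : |t * Real.sin x| ≤ 1 := by
        rw [abs_mul, abs_of_pos ht.1]
        exact mul_le_one₀ ht.2.le (abs_nonneg _) (Real.abs_sin_le_one x)
      rw [hAG, Real.sin_arcsin (abs_le.1 hx).1 (abs_le.1 hx).2]
      ring
    rw [hinner, mul_left_comm, h]
    field_simp
  have hderiv : ∀ t ∈ Set.Ioo (0 : ℝ) 1, HasDerivAt F (G t) t := by
    intro t ht
    refine (intervalIntegral.integral_hasDerivAt_right (hGcont.intervalIntegrable 0 t)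
      (hGcont.stronglyMeasurableAtFilter _ _) hGcont.continuousAt).congr_of_eventuallyEq ?_
    filter_upwards [isOpen_Ioo.mem_nhds ht] with s hs using hFG s hs
  refine ⟨fun t ht => (hderiv t ht).differentiableAt, ?_⟩
  have hG1 : (1 / (2 * Real.pi)) * G 1 = g u₀ := by
    have hu : u₀ ∈ sphere (0 : E 3) 1 := by simpa using hb.1 2
    simp only [hG, latitudeIntegral, latitudePoint, one_pow, sub_self, Real.sqrt_zero, zero_mul,
      zero_smul, one_smul, zero_add, intervalIntegral.integral_const, sub_zero, smul_eq_mul,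
      hg' u₀ hu]
    field_simp
  rw [← hG1]
  refine Filter.Tendsto.congr' ?_
    ((continuous_const.mul hGcont).continuousWithinAt (s := Set.Iio 1) (x := 1))
  filter_upwards [Ioo_mem_nhdsLT (zero_lt_one' ℝ)] with t ht
  rw [(hderiv t ht).deriv]
  rfl
end
end
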